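/- Let d ≥ 1 and let Γ ≤ GL_d(ℂ) be a group generated by a finite symmetric set X. If Γ is mixed identity free, then there exists a constant C > 0 such that for every positive integer n there is an element γ ∈ Γ with ‖γ‖_X ≤ C·n such that w(γ) ≠ 1 simultaneously for every nontrivial mixed word w ∈ Γ∗⟨x⟩ with ‖w‖ ≤ n. -/

import Mathlib

open Matrix

/-- The free product `Γ ∗ ⟨x⟩` of a group `Γ` with an infinite cyclic group `⟨x⟩`. -/
abbrev MixedWordGroup (G : Type*) [Group G] : Type _ :=
  Monoid.Coprod G (Multiplicative ℤ)

/-- The distinguished generator `x` of the free factor `⟨x⟩` in `Γ ∗ ⟨x⟩`. -/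
def xGen (G : Type*) [Group G] : MixedWordGroup G :=
  Monoid.Coprod.inr (Multiplicative.ofAdd (1 : ℤ))

/-- Evaluation of a mixed word: the unique homomorphism `Γ ∗ ⟨x⟩ → Γ` restricting to the
identity on `Γ` and sending `x` to `γ`. -/
def evalWord {G : Type*} [Group G] (γ : G) : MixedWordGroup G →* G :=
  Monoid.Coprod.lift (MonoidHom.id G) (zpowersHom G γ)

/-- Word length of `g` with respect to the set `S`. -/
noncomputable def wordLength {G : Type*} [Group G] (S : Set G) (g : G) : ℕ :=
  sInf {n | ∃ l : List G, (∀ a ∈ l, a ∈ S) ∧ l.length = n ∧ l.prod = g}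

/-- The generating set `X ∪ {x, x⁻¹}` of `Γ ∗ ⟨x⟩`. -/
def mixedGenSet {G : Type*} [Group G] (X : Set G) : Set (MixedWordGroup G) :=
  (Monoid.Coprod.inl '' X) ∪ {xGen G, (xGen G)⁻¹}

namespace Monoid.CoprodI.Word

variable {ι : Type*} {M : ι → Type*} [∀ i, Monoid (M i)] [∀ i, DecidableEq (M i)] [DecidableEq ι]

theorem equivPair_head_of_smul_same {i : ι} (m : M i) (w : Word M) :
    (equivPair i (of m • w)).head = m * (equivPair i w).head := by
  rw [equivPair_smul_same]

theorem fstIdx_eq_of_head_ne_one {i : ι} {w : Word M} (h : (equivPair i w).head ≠ 1) :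
    fstIdx w = some i := by
  by_contra h'
  exact h (by rw [equivPair_eq_of_fstIdx_ne h'])

theorem equivPair_head_of_smul_of_ne {i j : ι} (hij : i ≠ j) {m : M j} (hm : m ≠ 1)
    {w : Word M} (h : (equivPair i w).head ≠ 1) : (equivPair i (of m • w)).head = 1 := by
  have h1 := fstIdx_eq_of_head_ne_one h
  have h2 : fstIdx w ≠ some j := by
    rw [h1]; simpa using hij
  have h3 : fstIdx (of m • w) ≠ some i := by
    rw [of_smul_def, equivPair_eq_of_fstIdx_ne h2]
    simp only [mul_one, rcons, hm, dite_false, fstIdx_cons]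
    simpa using hij.symm
  rw [equivPair_eq_of_fstIdx_ne h3]

end Monoid.CoprodI.Word

section FreeProduct

open Monoid

/-- The two free factors of `G ∗ ⟨x⟩`, as a family indexed by `Bool`. -/
def mixedFactor (G : Type) : Bool → Type
  | false => G
  | true => Multiplicative ℤ

instance mixedFactorGroup (G : Type) [Group G] : ∀ b, Group (mixedFactor G b)
  | false => inferInstanceAs (Group G)
  | true => inferInstanceAs (Group (Multiplicative ℤ))

variable {G : Type} [Group G]

/-- The inclusion of `G` in the indexed free product. -/
def constHom (G : Type) [Group G] : G →* CoprodI (mixedFactor G) :=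
  CoprodI.of (M := mixedFactor G) (i := false)

/-- The inclusion of the infinite cyclic factor in the indexed free product. -/
def cyclicHom (G : Type) [Group G] : Multiplicative ℤ →* CoprodI (mixedFactor G) :=
  CoprodI.of (M := mixedFactor G) (i := true)

/-- Comparison of the binary free product with the indexed one. -/
def mixedToCoprodI (G : Type) [Group G] : MixedWordGroup G →* CoprodI (mixedFactor G) :=
  Coprod.lift (constHom G) (cyclicHom G)

/-- A family of homomorphisms on the two free factors. -/
def factorHoms {N : Type} [Group N] (f : G →* N) (g : Multiplicative ℤ →* N) :
    ∀ b, mixedFactor G b →* N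
  | false => f
  | true => g

theorem mixedToCoprodI_injective : Function.Injective (mixedToCoprodI G) := by
  let ψ : CoprodI (mixedFactor G) →* MixedWordGroup G :=
    CoprodI.lift (factorHoms Coprod.inl Coprod.inr)
  have h : ψ.comp (mixedToCoprodI G) = MonoidHom.id _ := by
    refine Coprod.hom_ext ?_ ?_
    · ext g
      simp only [mixedToCoprodI, MonoidHom.comp_apply, Coprod.lift_apply_inl]
      exact CoprodI.lift_of _ (i := false) _
    · refine MonoidHom.ext fun g => ?_
      simp only [mixedToCoprodI, MonoidHom.comp_apply, Coprod.lift_apply_inr]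
      exact CoprodI.lift_of _ (i := true) _
  exact fun a b hab => by
    have := congrArg ψ hab
    rwa [← MonoidHom.comp_apply, ← MonoidHom.comp_apply, h] at this

/-- The word `x c x⁻¹ · x² c x⁻²`. -/
def spreadWord (c : G) : MixedWordGroup G :=
  xGen G * Coprod.inl c * xGen G * Coprod.inl c * (xGen G)⁻¹ * (xGen G)⁻¹

/-- Substitution of `x c x⁻¹ · x² c x⁻²` for the variable. -/
def spreadSubst (c : G) : MixedWordGroup G →* MixedWordGroup G :=
  Coprod.lift Coprod.inl (zpowersHom _ (spreadWord c))

theorem spreadSubst_injective {c : G} (hc : c ≠ 1) : Function.Injective (spreadSubst c) := by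
  classical
  let V : CoprodI (mixedFactor G) := mixedToCoprodI G (spreadWord c)
  let F : ∀ b, mixedFactor G b →* CoprodI (mixedFactor G) :=
    factorHoms (constHom G) (zpowersHom _ V)
  let hd : CoprodI.Word (mixedFactor G) → Multiplicative ℤ :=
    fun w => (CoprodI.Word.equivPair (M := mixedFactor G) true w).head
  have hdX : ∀ (z : Multiplicative ℤ) (w : CoprodI.Word (mixedFactor G)),
      hd (cyclicHom G z • w) = z * hd w := fun z w =>
    CoprodI.Word.equivPair_head_of_smul_same (M := mixedFactor G) (i := true) z w
  have hdC : ∀ (g : G), g ≠ 1 → ∀ (w : CoprodI.Word (mixedFactor G)), hd w ≠ 1 →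
      hd (constHom G g • w) = 1 := fun g hg w hw =>
    CoprodI.Word.equivPair_head_of_smul_of_ne (M := mixedFactor G) (i := true) (j := false)
      (by simp) (m := g) hg hw
  let t : Multiplicative ℤ := Multiplicative.ofAdd 1
  have hV : V = cyclicHom G t * constHom G c * cyclicHom G t * constHom G c *
      cyclicHom G (t⁻¹ * t⁻¹) := by
    simp only [V, spreadWord, xGen, mixedToCoprodI, map_mul, map_inv, Coprod.lift_apply_inl,
      Coprod.lift_apply_inr, mul_assoc]
    rfl
  have hVinv : V⁻¹ = cyclicHom G (t * t) * constHom G c⁻¹ * cyclicHom G t⁻¹ * constHom G c⁻¹ *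
      cyclicHom G (t⁻¹) := by
    rw [hV]; simp only [_root_.mul_inv_rev, map_mul, map_inv, inv_inv, mul_assoc]
  have ht : t ≠ 1 := by decide
  have ht' : t⁻¹ ≠ 1 := by decide
  have ht2 : t * t ≠ 1 := by decide
  have ht2' : t⁻¹ * t⁻¹ ≠ 1 := by decide
  have hc' : c⁻¹ ≠ 1 := by simpa using hc
  have pos : ∀ w, (hd w = 1 ∨ hd w = t) → hd (V • w) = t := by
    intro w hw
    rw [hV]
    simp only [mul_smul]
    rw [hdX, hdC c hc, mul_one]
    rw [hdX, hdC c hc, mul_one]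
    · exact ht
    · rw [hdX]; rcases hw with h | h <;> rw [h] <;> decide
  have neg : ∀ w, (hd w = 1 ∨ hd w = t * t) → hd (V⁻¹ • w) = t * t := by
    intro w hw
    rw [hVinv]
    simp only [mul_smul]
    rw [hdX, hdC _ hc', mul_one]
    rw [hdX, hdC _ hc', mul_one]
    · exact ht'
    · rw [hdX]; rcases hw with h | h <;> rw [h] <;> decide
  have posn : ∀ (n : ℕ) w, hd w = 1 → hd (V ^ (n + 1) • w) = t := by
    intro n w hw
    induction n with
    | zero => simpa using pos w (Or.inl hw)
    | succ n ih => rw [pow_succ', mul_smul]; exact pos _ (Or.inr ih)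
  have negn : ∀ (n : ℕ) w, hd w = 1 → hd (V⁻¹ ^ (n + 1) • w) = t * t := by
    intro n w hw
    induction n with
    | zero => simpa using neg w (Or.inl hw)
    | succ n ih => rw [pow_succ', mul_smul]; exact neg _ (Or.inr ih)
  have hVz : ∀ (z : Multiplicative ℤ), z ≠ 1 → ∀ w, hd w = 1 →
      hd (zpowersHom _ V z • w) ≠ 1 := by
    intro z hz w hw
    rw [zpowersHom_apply]
    rcases Int.lt_trichotomy z.toAdd 0 with h | h | h
    · obtain ⟨n, hn⟩ : ∃ n : ℕ, z.toAdd = -((n + 1 : ℕ) : ℤ) := ⟨(-z.toAdd - 1).toNat, by omega⟩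
      rw [hn, _root_.zpow_neg, zpow_natCast, ← inv_pow, negn n w hw]
      exact ht2
    · exact absurd (Multiplicative.toAdd.injective h) hz
    · obtain ⟨n, hn⟩ : ∃ n : ℕ, z.toAdd = ((n + 1 : ℕ) : ℤ) := ⟨(z.toAdd - 1).toNat, by omega⟩
      rw [hn, zpow_natCast, posn n w hw]
      exact ht
  have hinj : Function.Injective (CoprodI.lift F) := by
    refine CoprodI.lift_injective_of_ping_pong F (Or.inr ⟨true, ?_⟩)
      (fun b => {w | if b then hd w ≠ 1 else hd w = 1}) ?_ ?_ ?_
    · have : Infinite (mixedFactor G true) := inferInstanceAs (Infinite (Multiplicative ℤ))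
      exact (Cardinal.natCast_lt_aleph0 (n := 3)).le.trans (Cardinal.aleph0_le_mk _)
    · have h1 : hd CoprodI.Word.empty = 1 := by
        change (CoprodI.Word.equivPair (M := mixedFactor G) true CoprodI.Word.empty).head = 1
        rw [CoprodI.Word.equivPair_eq_of_fstIdx_ne]
        simp [CoprodI.Word.fstIdx, CoprodI.Word.empty]
      rintro (_ | _)
      · exact ⟨CoprodI.Word.empty, by simpa using h1⟩
      · refine ⟨cyclicHom G t • CoprodI.Word.empty, ?_⟩
        simp [hdX, h1, ht]
    · rintro (_ | _) (_ | _) h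
      · exact absurd rfl h
      · exact Set.disjoint_left.2 fun w h1 h2 => by simp_all
      · exact Set.disjoint_left.2 fun w h1 h2 => by simp_all
      · exact absurd rfl h
    · rintro (_ | _) (_ | _) h g hg
      · exact absurd rfl h
      · rintro _ ⟨w, hw, rfl⟩
        simp only [if_true, Set.mem_ofPred_eq] at hw
        exact hdC g hg w hw
      · rintro _ ⟨w, hw, rfl⟩
        simp only [Set.mem_ofPred_eq] at hw
        exact hVz g hg w (by simpa using hw)
      · exact absurd rfl h
  have hcomp : (mixedToCoprodI G).comp (spreadSubst c) = (CoprodI.lift F).comp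
      (mixedToCoprodI G) := by
    refine Coprod.hom_ext ?_ ?_
    · ext g
      simp only [mixedToCoprodI, spreadSubst, MonoidHom.comp_apply, Coprod.lift_apply_inl]
      exact (CoprodI.lift_of F (i := false) g).symm
    · refine MonoidHom.ext fun z => ?_
      simp only [spreadSubst, mixedToCoprodI, MonoidHom.comp_apply, Coprod.lift_apply_inr]
      refine Eq.trans ?_ (CoprodI.lift_of F (i := true) z).symm
      change _ = zpowersHom _ V z
      simp only [zpowersHom_apply, map_zpow]
      rfl
  have : Function.Injective ((mixedToCoprodI G).comp (spreadSubst c)) := by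
    rw [hcomp]
    exact hinj.comp mixedToCoprodI_injective
  exact Function.Injective.of_comp (f := mixedToCoprodI G) this

theorem evalWord_spreadSubst (c γ : G) (w : MixedWordGroup G) :
    evalWord γ (spreadSubst c w) =
      evalWord ((γ * c * γ⁻¹) * (γ ^ 2 * c * (γ ^ 2)⁻¹)) w := by
  have h : (evalWord γ).comp (spreadSubst c) =
      evalWord ((γ * c * γ⁻¹) * (γ ^ 2 * c * (γ ^ 2)⁻¹)) := by
    refine Coprod.hom_ext ?_ ?_
    · ext g; simp [evalWord, spreadSubst]
    · refine MonoidHom.ext fun z => ?_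
      simp only [evalWord, spreadSubst, MonoidHom.comp_apply, Coprod.lift_apply_inr,
        zpowersHom_apply, map_zpow]
      congr 1
      simp only [spreadWord, xGen, map_mul, map_inv, Coprod.lift_apply_inl, Coprod.lift_apply_inr,
        zpowersHom_apply]
      simp [pow_two, mul_assoc]
  exact DFunLike.congr_fun h w

/-- A subset `A` of `G` separates mixed words if no nontrivial mixed word is trivial on `A`. -/
def SeparatesWords (A : Set G) : Prop :=
  ∀ w : MixedWordGroup G, w ≠ 1 → ∃ γ ∈ A, evalWord γ w ≠ 1

theorem SeparatesWords.of_normalized {M N : Subgroup G} (hM : SeparatesWords (M : Set G))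
    (hN : N ≠ ⊥) (hMN : ∀ m ∈ M, ∀ c ∈ N, m * c * m⁻¹ ∈ N) : SeparatesWords (N : Set G) := by
  intro w hw
  obtain ⟨c, hcN, hc⟩ : ∃ c ∈ N, c ≠ 1 := by
    by_contra! h
    exact hN ((Subgroup.eq_bot_iff_forall N).2 h)
  obtain ⟨γ, hγ, h⟩ := hM (spreadSubst c w)
    (fun h => hw (spreadSubst_injective hc (by rw [h, map_one])))
  refine ⟨_, ?_, by rwa [evalWord_spreadSubst] at h⟩
  exact N.mul_mem (hMN _ hγ _ hcN) (hMN _ (M.pow_mem hγ 2) _ hcN)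

theorem xGen_pow_ne_one {n : ℕ} (hn : n ≠ 0) : xGen G ^ n ≠ 1 := by
  intro h
  have h2 := congrArg (Coprod.snd : MixedWordGroup G →* _) h
  simp only [xGen, map_pow, Coprod.snd_apply_inr, map_one, ← ofAdd_nsmul] at h2
  have h3 := congrArg Multiplicative.toAdd h2
  simp at h3
  exact hn h3

theorem commutator_word_ne_one {c : G} (hc : c ≠ 1) :
    xGen G * Coprod.inl c * (xGen G)⁻¹ * (Coprod.inl c)⁻¹ ≠ 1 := by
  intro h
  have h2 : xGen G * Coprod.inl c * (xGen G)⁻¹ = Coprod.inl c := by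
    rwa [mul_inv_eq_one] at h
  have h3 : spreadWord c = Coprod.inl (c * c) := by
    have : spreadWord c = (xGen G * Coprod.inl c * (xGen G)⁻¹) *
      (xGen G * (xGen G * Coprod.inl c * (xGen G)⁻¹) * (xGen G)⁻¹) := by
      simp [spreadWord, mul_assoc]
    rw [this, h2, h2, map_mul]
  have h4 : spreadSubst c (xGen G) = spreadSubst c (Coprod.inl (c * c)) := by
    simp only [spreadSubst, xGen, Coprod.lift_apply_inr, Coprod.lift_apply_inl, zpowersHom_apply]
    simpa using h3
  have h5 := spreadSubst_injective hc h4
  have h6 := congrArg (Coprod.snd : MixedWordGroup G →* _) h5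
  simp only [xGen, Coprod.snd_apply_inr, Coprod.snd_apply_inl] at h6
  exact absurd h6 (by decide)

end FreeProduct

section ZariskiGroups

open Topology TopologicalSpace Pointwise

/-- Groups with a Noetherian `T1` topology of finite dimension for which all translations and the
inversion are continuous; the Zariski topology of a linear group is the main example. -/
class ZariskiGroup (G : Type*) [Group G] [TopologicalSpace G] : Prop where
  t1 : T1Space G
  noetherian : NoetherianSpace G
  continuous_mul_left : ∀ g : G, Continuous (g * ·)
  continuous_mul_right : ∀ g : G, Continuous (· * g)
  continuous_inv : Continuous (fun g : G => g⁻¹)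
  continuous_conj_apply : ∀ c : G, Continuous (fun g : G => g * c * g⁻¹)
  dim_finite : ∃ n : ℕ, topologicalKrullDim G ≤ n

attribute [instance] ZariskiGroup.t1 ZariskiGroup.noetherian

namespace ZariskiGroup

variable {G : Type*} [Group G] [TopologicalSpace G] [ZariskiGroup G]

theorem continuous_conj (g : G) : Continuous (fun x => g * x * g⁻¹) :=
  (continuous_mul_right g⁻¹).comp (continuous_mul_left g)

theorem isIrreducible_mul {A B : Set G} (hA : IsIrreducible A) (hB : IsIrreducible B) :
    IsIrreducible (A * B) := by
  refine ⟨hA.nonempty.mul hB.nonempty, ?_⟩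
  rintro U V hU hV ⟨_, ⟨a, ha, b, hb, rfl⟩, hu⟩ ⟨_, ⟨a', ha', b', hb', rfl⟩, hv⟩
  obtain ⟨c, hcA, hc1, hc2⟩ := hA.2 ((· * b) ⁻¹' U) ((· * b') ⁻¹' V)
    (hU.preimage (continuous_mul_right b)) (hV.preimage (continuous_mul_right b'))
    ⟨a, ha, hu⟩ ⟨a', ha', hv⟩
  obtain ⟨e, heB, he1, he2⟩ := hB.2 ((c * ·) ⁻¹' U) ((c * ·) ⁻¹' V)
    (hU.preimage (continuous_mul_left c)) (hV.preimage (continuous_mul_left c))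
    ⟨b, hb, hc1⟩ ⟨b', hb', hc2⟩
  exact ⟨c * e, ⟨c, hcA, e, heB, rfl⟩, he1, he2⟩

theorem isIrreducible_inv {A : Set G} (hA : IsIrreducible A) : IsIrreducible A⁻¹ := by
  rw [← Set.image_inv_eq_inv]
  exact hA.image _ continuous_inv.continuousOn

/-- The identity component of a subgroup: the union of its irreducible subsets containing `1`. -/
def idComp (H : Subgroup G) : Subgroup G where
  carrier := {g | ∃ W : Set G, IsIrreducible W ∧ (1 : G) ∈ W ∧ W ⊆ H ∧ g ∈ W}
  one_mem' := ⟨{1}, isIrreducible_singleton, rfl, by simp, rfl⟩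
  mul_mem' := by
    rintro a b ⟨A, hA, hA1, hAH, ha⟩ ⟨B, hB, hB1, hBH, hb⟩
    refine ⟨A * B, isIrreducible_mul hA hB, ⟨1, hA1, 1, hB1, one_mul 1⟩, ?_, ⟨a, ha, b, hb, rfl⟩⟩
    rintro _ ⟨x, hx, y, hy, rfl⟩
    exact H.mul_mem (hAH hx) (hBH hy)
  inv_mem' := by
    rintro a ⟨A, hA, hA1, hAH, ha⟩
    refine ⟨A⁻¹, isIrreducible_inv hA, by simpa using hA1, fun x hx => ?_, by simpa using ha⟩
    exact H.inv_mem_iff.1 (hAH hx)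

theorem idComp_le (H : Subgroup G) : idComp H ≤ H := by
  rintro g ⟨W, -, -, hW, hg⟩
  exact hW hg

theorem subset_idComp {H : Subgroup G} {W : Set G} (hW : IsIrreducible W) (h1 : (1 : G) ∈ W)
    (hWH : W ⊆ H) : W ⊆ idComp H :=
  fun _ hg => ⟨W, hW, h1, hWH, hg⟩

theorem isIrreducible_idComp (H : Subgroup G) : IsIrreducible (idComp H : Set G) := by
  refine ⟨⟨1, (idComp H).one_mem⟩, ?_⟩
  rintro U V hU hV ⟨a, ⟨A, hA, hA1, hAH, ha⟩, hu⟩ ⟨b, ⟨B, hB, hB1, hBH, hb⟩, hv⟩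
  have hsub : A * B ⊆ idComp H := by
    refine subset_idComp (isIrreducible_mul hA hB) ⟨1, hA1, 1, hB1, one_mul 1⟩ ?_
    rintro _ ⟨x, hx, y, hy, rfl⟩
    exact H.mul_mem (hAH hx) (hBH hy)
  obtain ⟨c, hc, hcU⟩ := (isIrreducible_mul hA hB).2 U V hU hV
    ⟨a, ⟨a, ha, 1, hB1, mul_one a⟩, hu⟩ ⟨b, ⟨1, hA1, b, hb, one_mul b⟩, hv⟩
  exact ⟨c, hsub hc, hcU⟩

theorem isClosed_idComp {H : Subgroup G} (hH : IsClosed (H : Set G)) :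
    IsClosed (idComp H : Set G) := by
  refine isClosed_of_closure_subset (subset_idComp (isIrreducible_idComp H).closure
    (subset_closure (idComp H).one_mem) ?_)
  exact closure_minimal (idComp_le H) hH

theorem idComp_mono {H K : Subgroup G} (h : H ≤ K) : idComp H ≤ idComp K := by
  rintro g ⟨W, hW, h1, hWH, hg⟩
  exact ⟨W, hW, h1, hWH.trans h, hg⟩

theorem conj_mem_idComp {H K : Subgroup G} (x : G) (hx : ∀ h ∈ H, x * h * x⁻¹ ∈ K) {g : G}
    (hg : g ∈ idComp H) : x * g * x⁻¹ ∈ idComp K := by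
  obtain ⟨W, hW, h1, hWH, hg⟩ := hg
  refine subset_idComp (hW.image _ (continuous_conj x).continuousOn) ⟨1, h1, by simp⟩ ?_
    ⟨g, hg, rfl⟩
  rintro _ ⟨w, hw, rfl⟩
  exact hx w (hWH hw)

theorem finite_of_idComp_eq_bot {H : Subgroup G} (hH : IsClosed (H : Set G))
    (h : idComp H = ⊥) : (H : Set G).Finite := by
  obtain ⟨S, hSf, -, hSi, hSu⟩ := NoetherianSpace.exists_finite_set_isClosed_irreducible hH
  rw [hSu]
  refine hSf.sUnion fun Z hZ => ?_
  obtain ⟨z, hz⟩ := (hSi Z hZ).nonempty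
  have hZH : Z ⊆ H := hSu ▸ Set.subset_sUnion_of_mem hZ
  refine (Set.finite_singleton z).subset fun y hy => ?_
  have h1 : z⁻¹ * y ∈ idComp H := by
    refine subset_idComp ((hSi Z hZ).image _ (continuous_mul_left z⁻¹).continuousOn)
      ⟨z, hz, by simp⟩ ?_ ⟨y, hy, rfl⟩
    rintro _ ⟨w, hw, rfl⟩
    exact H.mul_mem (H.inv_mem (hZH hz)) (hZH hw)
  rw [h, Subgroup.mem_bot, inv_mul_eq_one] at h1
  exact h1.symm

/-- The closure of a subgroup. -/
def closureSubgroup (H : Subgroup G) : Subgroup G where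
  carrier := closure (H : Set G)
  one_mem' := subset_closure H.one_mem
  mul_mem' := by
    intro a b ha hb
    have h1 : ∀ h ∈ H, ∀ y ∈ closure (H : Set G), h * y ∈ closure (H : Set G) :=
      fun h hh y hy => map_mem_closure (continuous_mul_left h) hy fun z hz => H.mul_mem hh hz
    have := map_mem_closure (continuous_mul_right b) ha (t := closure (H : Set G))
      fun z hz => h1 z hz b hb
    rwa [closure_closure] at this
  inv_mem' := by
    intro a ha
    exact map_mem_closure continuous_inv ha fun z hz => H.inv_mem hz

theorem le_closureSubgroup (H : Subgroup G) : H ≤ closureSubgroup H := subset_closure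

theorem isClosed_closureSubgroup (H : Subgroup G) : IsClosed (closureSubgroup H : Set G) :=
  isClosed_closure

theorem closureSubgroup_le {H K : Subgroup G} (h : H ≤ K) (hK : IsClosed (K : Set G)) :
    closureSubgroup H ≤ K :=
  closure_minimal h hK

/-- The closure of the identity component, as an irreducible closed set. -/
def idCompCloseds (H : Subgroup G) : IrreducibleCloseds G :=
  ⟨closure (idComp H), (isIrreducible_idComp H).closure, isClosed_closure⟩

/-- The length of the longest chain of irreducible closed subsets below the identity component. -/
noncomputable def rk (H : Subgroup G) : ℕ := (Order.height (idCompCloseds H)).toNat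

theorem exists_height_le (G : Type*) [Group G] [TopologicalSpace G] [ZariskiGroup G] :
    ∃ n : ℕ, ∀ Z : IrreducibleCloseds G, Order.height Z ≤ n := by
  obtain ⟨n, hn⟩ := dim_finite (G := G)
  refine ⟨n, fun Z => ?_⟩
  have := (Order.height_le_krullDim Z).trans hn
  exact_mod_cast this

theorem exists_rk_le (G : Type*) [Group G] [TopologicalSpace G] [ZariskiGroup G] :
    ∃ n : ℕ, ∀ H : Subgroup G, rk H ≤ n := by
  obtain ⟨n, hn⟩ := exists_height_le G
  exact ⟨n, fun H => ENat.toNat_le_of_le_natCast (hn _)⟩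

theorem rk_lt_rk {H K : Subgroup G} (hH : IsClosed (H : Set G)) (hK : IsClosed (K : Set G))
    (h : idComp H < idComp K) : rk H < rk K := by
  obtain ⟨n, hn⟩ := exists_height_le G
  have hfin : ∀ Z : IrreducibleCloseds G, Order.height Z < ⊤ :=
    fun Z => (hn Z).trans_lt (ENat.natCast_lt_top n)
  have hlt : idCompCloseds H < idCompCloseds K := by
    rw [← SetLike.coe_ssubset_coe]
    change closure (idComp H : Set G) ⊂ closure (idComp K : Set G)
    rw [(isClosed_idComp hH).closure_eq, (isClosed_idComp hK).closure_eq]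
    exact SetLike.coe_ssubset_coe.2 h
  have := Order.height_strictMono hlt (hfin _)
  rw [← ENat.natCast_toNat (hfin (idCompCloseds H)).ne,
    ← ENat.natCast_toNat (hfin (idCompCloseds K)).ne] at this
  exact_mod_cast this

end ZariskiGroup

end ZariskiGroups

section Gap

open ENNReal NNReal MulAction ZariskiGroup

variable {M : Type} [Group M]

/-- The total `ℓ¹`-variation of a function under the elements of `S`, up to a factor of two. -/
noncomputable def shiftVar (S : Finset M) {Ω : Type} [MulAction M Ω] (f : Ω → ℝ≥0∞) : ℝ≥0∞ :=
  ∑ s ∈ S, ∑' x, (f (s⁻¹ • x) - f x)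

/-- A uniform `ℓ¹`-spectral gap for all actions, on the set of points whose stabilizers satisfy
the predicate `P`. -/
def HasGap (S : Finset M) (P : Subgroup M → Prop) : Prop :=
  ∃ δ : ℝ≥0, 0 < δ ∧ ∀ (Ω : Type) [MulAction M Ω] (f : Ω → ℝ≥0∞), ∑' x, f x ≠ ∞ →
    (∀ x, f x ≠ 0 → P (stabilizer M x)) → δ * ∑' x, f x ≤ shiftVar S f

theorem tsum_shift_le (S : Finset M) {Ω : Type} [MulAction M Ω] (f : Ω → ℝ≥0∞) {s : M}
    (hs : s ∈ S) (A : Set Ω) :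
    ∑' x, A.indicator (fun x => f (s⁻¹ • x)) x ≤ ∑' x, A.indicator f x + shiftVar S f := by
  have h : ∑' x, (f (s⁻¹ • x) - f x) ≤ shiftVar S f :=
    Finset.single_le_sum (f := fun s => ∑' x, (f (s⁻¹ • x) - f x)) (fun _ _ => zero_le) hs
  refine le_trans ?_ (add_le_add le_rfl h)
  rw [← ENNReal.tsum_add]
  refine ENNReal.tsum_le_tsum fun x => ?_
  by_cases hx : x ∈ A
  · simp only [Set.indicator_of_mem hx]
    exact le_add_tsub
  · simp [Set.indicator_of_notMem hx]

theorem tsum_smul_eq {Ω : Type} [MulAction M Ω] (f : Ω → ℝ≥0∞) (s : M) :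
    ∑' x, f (s • x) = ∑' x, f x :=
  (MulAction.toPerm s).tsum_eq f

theorem shiftVar_prod_le (S : Finset M) {Ω : Type} [MulAction M Ω] (f : Ω → ℝ≥0∞) :
    shiftVar S (fun p : Ω × Ω => f p.1 * f p.2) ≤ 2 * (∑' x, f x) * shiftVar S f := by
  unfold shiftVar
  rw [Finset.mul_sum]
  refine Finset.sum_le_sum fun s _ => ?_
  calc ∑' p : Ω × Ω, (f (s⁻¹ • p).1 * f (s⁻¹ • p).2 - f p.1 * f p.2)
      ≤ ∑' p : Ω × Ω, ((f (s⁻¹ • p.1) - f p.1) * f (s⁻¹ • p.2) +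
          f p.1 * (f (s⁻¹ • p.2) - f p.2)) := by
        refine ENNReal.tsum_le_tsum fun p => ?_
        rw [tsub_le_iff_left]
        calc f (s⁻¹ • p.1) * f (s⁻¹ • p.2)
            ≤ (f p.1 + (f (s⁻¹ • p.1) - f p.1)) * f (s⁻¹ • p.2) := by
              gcongr; exact le_add_tsub
          _ = f p.1 * f (s⁻¹ • p.2) + (f (s⁻¹ • p.1) - f p.1) * f (s⁻¹ • p.2) := add_mul _ _ _
          _ ≤ f p.1 * (f p.2 + (f (s⁻¹ • p.2) - f p.2)) +
              (f (s⁻¹ • p.1) - f p.1) * f (s⁻¹ • p.2) := by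
              gcongr; exact le_add_tsub
          _ = _ := by ring
    _ = 2 * (∑' x, f x) * ∑' x, (f (s⁻¹ • x) - f x) := by
        rw [ENNReal.tsum_add, ENNReal.tsum_prod', ENNReal.tsum_prod']
        simp only [ENNReal.tsum_mul_left, ENNReal.tsum_mul_right]
        rw [tsum_smul_eq f s⁻¹]
        ring

theorem shiftVar_indicator_le (S : Finset M) {Ω : Type} [MulAction M Ω] (f : Ω → ℝ≥0∞)
    (A : Set Ω) (hA : ∀ (s : M) (x : Ω), x ∈ A → s • x ∈ A) :
    shiftVar S (A.indicator f) ≤ shiftVar S f := by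
  refine Finset.sum_le_sum fun s _ => ENNReal.tsum_le_tsum fun x => ?_
  by_cases hx : x ∈ A
  · rw [Set.indicator_of_mem hx, Set.indicator_of_mem (hA _ _ hx)]
  · rw [Set.indicator_of_notMem hx, Set.indicator_of_notMem fun h => hx ?_]
    · simp
    · simpa using hA s _ h

/-- Passing from the regular action to actions with finite stabilizers. -/
theorem hasGap_finite {S : Finset M} (h : HasGap S (fun H => H = ⊥)) :
    HasGap S (fun H => (H : Set M).Finite) := by
  obtain ⟨δ, hδ, h⟩ := h
  refine ⟨δ, hδ, fun Ω _ f hf hP => ?_⟩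
  have key : ∀ (F : Ω → ℝ≥0∞) (x : Ω), ∑' g : M, F (g • x) =
      ∑' y, (orbit M x).indicator F y * ((ENat.card (stabilizer M x) : ℕ∞) : ℝ≥0∞) := by
    intro F x
    rw [← (Equiv.sigmaFiberEquiv fun g : M => g • x).tsum_eq, ENNReal.tsum_sigma']
    refine tsum_congr fun y => ?_
    have h1 : ∀ g : {g : M // g • x = y}, F (((Equiv.sigmaFiberEquiv fun g : M => g • x)
        ⟨y, g⟩) • x) = F y := fun g => by
      change F ((g : M) • x) = F y
      rw [g.2]
    simp only [h1]
    by_cases hy : y ∈ orbit M x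
    · obtain ⟨g, rfl⟩ := hy
      rw [Set.indicator_of_mem (mem_orbit x g), ENNReal.tsum_const, mul_comm]
      congr 2
      refine ENat.card_congr ⟨fun a => ⟨g⁻¹ * a, ?_⟩, fun a => ⟨g * a, ?_⟩, fun a => ?_,
        fun a => ?_⟩
      · rw [mem_stabilizer_iff, mul_smul, a.2]; simp
      · rw [mul_smul, a.2]
      · simp
      · simp
    · have : IsEmpty {g : M // g • x = y} := Subtype.isEmpty_of_false fun g hg =>
        hy (hg ▸ mem_orbit x g)
      rw [Set.indicator_of_notMem hy]
      simp
  have orb : ∀ x : Ω, δ * ∑' y, (orbit M x).indicator f y ≤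
      ∑ s ∈ S, ∑' y, (orbit M x).indicator (fun y => f (s⁻¹ • y) - f y) y := by
    intro x
    by_cases hx : ∃ y ∈ orbit M x, f y ≠ 0
    · obtain ⟨y, hy, hfy⟩ := hx
      have hfin : (stabilizer M y : Set M).Finite := hP y hfy
      have : Finite (stabilizer M y) := hfin
      rw [← orbit_eq_iff.2 hy]
      set c : ℝ≥0∞ := ((ENat.card (stabilizer M y) : ℕ∞) : ℝ≥0∞) with hc
      have hcard : c = Nat.card (stabilizer M y) := by
        rw [hc, ENat.card_eq_coe_natCard]; simp
      have hc0 : c ≠ 0 := by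
        rw [hcard]; exact_mod_cast Nat.card_pos.ne'
      have hct : c ≠ ∞ := by
        rw [hcard]; exact ENNReal.natCast_ne_top _
      have h1 := h M (fun g => f (g • y)) ?_ (fun x _ => by
        refine (Subgroup.eq_bot_iff_forall _).2 fun g hg => ?_
        simpa using hg)
      · unfold shiftVar at h1
        simp only [smul_eq_mul, mul_smul] at h1
        rw [key] at h1
        have h2 : ∀ s : M, ∑' g : M, (f (s⁻¹ • g • y) - f (g • y)) =
            ∑' z, (orbit M y).indicator (fun z => f (s⁻¹ • z) - f z) z * c :=
          fun s => key (fun z => f (s⁻¹ • z) - f z) y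
        simp only [h2] at h1
        simp only [ENNReal.tsum_mul_right] at h1
        rw [← Finset.sum_mul, ← mul_assoc] at h1
        exact (ENNReal.mul_le_mul_iff_left hc0 hct).1 h1
      · rw [key, ENNReal.tsum_mul_right]
        refine ENNReal.mul_ne_top (ne_top_of_le_ne_top hf (ENNReal.tsum_le_tsum fun z => ?_)) hct
        exact Set.indicator_le_self _ _ _
    · push Not at hx
      have : ∑' y, (orbit M x).indicator f y = 0 := by
        rw [ENNReal.tsum_eq_zero]
        intro y
        rw [Set.indicator_apply_eq_zero]
        exact hx y
      rw [this, mul_zero]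
      exact zero_le
  have split : ∀ F : Ω → ℝ≥0∞, ∑' x, F x =
      ∑' q : Quotient (orbitRel M Ω), ∑' y, (orbit M q.out).indicator F y := by
    intro F
    rw [ENNReal.tsum_comm]
    refine tsum_congr fun y => ?_
    rw [tsum_eq_single (Quotient.mk (orbitRel M Ω) y)]
    · rw [Set.indicator_of_mem]
      have : (orbitRel M Ω) (Quotient.mk (orbitRel M Ω) y).out y :=
        Quotient.exact (s := orbitRel M Ω) (Quotient.out_eq _)
      exact (orbitRel M Ω).symm this
    · intro q hq
      rw [Set.indicator_of_notMem]
      intro hy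
      apply hq
      rw [← Quotient.out_eq q]
      exact (Quotient.sound (s := orbitRel M Ω) ((orbitRel M Ω).symm hy))
  unfold shiftVar
  rw [split f]
  have h2 : ∀ s : M, ∑' x, (f (s⁻¹ • x) - f x) = ∑' q : Quotient (orbitRel M Ω),
      ∑' y, (orbit M q.out).indicator (fun y => f (s⁻¹ • y) - f y) y := fun s => split _
  simp only [h2]
  rw [← ENNReal.tsum_mul_left, ← Summable.tsum_finsetSum (fun _ _ => ENNReal.summable)]
  exact ENNReal.tsum_le_tsum fun q => orb _

variable [TopologicalSpace M] [ZariskiGroup M]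

theorem gap_arith_pairs {m D a b : ℝ≥0∞} {δ : ℝ≥0} (hm : m ≠ ∞)
    (hlt : D < (min (δ / 8) (1 / 8) : ℝ≥0) * m) (h2 : δ * b ≤ 2 * m * D) (h4 : m * m = a + b)
    (h5 : a ≤ m * ((5 / 8 : ℝ≥0) * m)) : False := by
  have hD : D ≠ ∞ := hlt.ne_top
  have ha : a ≠ ∞ := ne_top_of_le_ne_top (ENNReal.mul_ne_top hm hm) (h4 ▸ le_self_add)
  have hb : b ≠ ∞ := ne_top_of_le_ne_top (ENNReal.mul_ne_top hm hm) (h4 ▸ le_add_self)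
  lift m to ℝ≥0 using hm
  lift D to ℝ≥0 using hD
  lift a to ℝ≥0 using ha
  lift b to ℝ≥0 using hb
  norm_cast at *
  have hlt' : (D : ℝ) < δ / 8 * m :=
    lt_of_lt_of_le (by exact_mod_cast hlt) (mul_le_mul_of_nonneg_right
      (by exact_mod_cast min_le_left _ _) m.2)
  have h2' : (δ : ℝ) * b ≤ 2 * m * D := by exact_mod_cast h2
  have h4' : (m : ℝ) * m = a + b := by exact_mod_cast h4
  have h5' : (a : ℝ) ≤ m * (5 / 8 * m) := by exact_mod_cast h5
  have hm0 : 0 < (m : ℝ) := by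
    rcases m.2.eq_or_lt with h | h
    · have : (m : ℝ) = 0 := h.symm
      rw [this, mul_zero] at hlt'
      exact absurd hlt' (not_lt.2 D.2)
    · exact h
  have h6 : (δ : ℝ) * (3 / 8 * (m * m)) ≤ δ * b := by
    refine mul_le_mul_of_nonneg_left ?_ δ.2
    linarith
  have h7 : (2 : ℝ) * m * D < 2 * m * (δ / 8 * m) := by
    exact mul_lt_mul_of_pos_left hlt' (by positivity)
  have h8 : 0 ≤ (δ : ℝ) * (m * m) := by positivity
  linarith

theorem gap_arith_fiber {m D a b : ℝ≥0∞} (hm : m ≠ ∞) (hlt : D < (1 / 8 : ℝ≥0) * m)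
    (hxf : (5 / 8 : ℝ≥0) * m < a) (h7 : a ≤ b + D) (h9 : a + b ≤ m) : False := by
  have hD : D ≠ ∞ := hlt.ne_top
  have ha : a ≠ ∞ := ne_top_of_le_ne_top hm (le_self_add.trans h9)
  have hb : b ≠ ∞ := ne_top_of_le_ne_top hm (le_add_self.trans h9)
  lift m to ℝ≥0 using hm
  lift D to ℝ≥0 using hD
  lift a to ℝ≥0 using ha
  lift b to ℝ≥0 using hb
  norm_cast at *
  have hlt' : (D : ℝ) < 1 / 8 * m := by exact_mod_cast hlt
  have hxf' : (5 / 8 : ℝ) * m < a := by exact_mod_cast hxf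
  have h7' : (a : ℝ) ≤ b + D := by exact_mod_cast h7
  have h9' : (a : ℝ) + b ≤ m := by exact_mod_cast h9
  linarith

theorem hasGap_succ {S : Finset M} (hS : ∀ H : Subgroup M, IsClosed (H : Set M) → ↑S ⊆ (H : Set M) →
      H = ⊤)
    (hM : ∀ N : Subgroup M, N.Normal → IsClosed (N : Set M) → IsIrreducible (N : Set M) →
      N ≠ ⊥ → N = ⊤) {j : ℕ}
    (h : HasGap S (fun H => IsClosed (H : Set M) ∧ H ≠ ⊤ ∧ (idComp H = ⊥ ∨ rk H < j))) :
    HasGap S (fun H => IsClosed (H : Set M) ∧ H ≠ ⊤ ∧ (idComp H = ⊥ ∨ rk H < j + 1)) := by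
  classical
  obtain ⟨δ, hδ, h⟩ := h
  refine ⟨min (δ / 8) (1 / 8), by positivity, fun Ω _ f hf hP => ?_⟩
  by_contra! hlt
  set m := ∑' x, f x with hm
  set D := shiftVar S f with hD
  let c : Ω → Subgroup M := fun x => idComp (stabilizer M x)
  have hc : ∀ (s : M) (x : Ω) (g : M), g ∈ c x → s * g * s⁻¹ ∈ c (s • x) := fun s x g hg =>
    conj_mem_idComp s (fun h hh => by
      rw [mem_stabilizer_iff] at hh ⊢
      simp [mul_smul, hh]) hg
  have hc' : ∀ (s : M) (x : Ω) (g : M), g ∈ c (s • x) ↔ s⁻¹ * g * s ∈ c x := fun s x g => by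
    constructor
    · intro hg
      simpa using hc s⁻¹ _ g hg
    · intro hg
      simpa [mul_assoc] using hc s _ _ hg
  have hceq : ∀ (s : M) (x y : Ω), c x = c y → c (s • x) = c (s • y) := fun s x y hxy => by
    ext g; rw [hc', hc', hxy]
  let A : Set (Ω × Ω) := {p | c p.1 = c p.2 ∧ c p.1 ≠ ⊥}
  have hA : ∀ (s : M) (p : Ω × Ω), p ∈ A → s • p ∈ A := by
    rintro s ⟨x, y⟩ ⟨h1, h2⟩
    refine ⟨hceq s _ _ h1, fun h3 => h2 ?_⟩
    rw [Subgroup.eq_bot_iff_forall] at h3 ⊢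
    intro g hg
    have := h3 _ (hc s x g hg)
    rwa [mul_inv_eq_one, mul_eq_left] at this
  have hAc : ∀ (s : M) (p : Ω × Ω), p ∈ Aᶜ → s • p ∈ Aᶜ := fun s p hp hsp => hp (by
    simpa using hA s⁻¹ _ hsp)
  let F : Ω × Ω → ℝ≥0∞ := fun p => f p.1 * f p.2
  have hFsum : ∑' p, F p = m * m := by
    rw [ENNReal.tsum_prod']
    simp only [F, ENNReal.tsum_mul_left, ENNReal.tsum_mul_right, hm]
  have hFfin : ∑' p, Aᶜ.indicator F p ≠ ∞ := by
    refine ne_top_of_le_ne_top (ENNReal.mul_ne_top hf hf) (hFsum ▸ ENNReal.tsum_le_tsum fun z => ?_)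
    exact Set.indicator_le_self _ _ _
  have h1 := h (Ω × Ω) (Aᶜ.indicator F) hFfin (by
    rintro ⟨x, y⟩ hxy
    have hmem : (x, y) ∈ Aᶜ := Set.mem_of_indicator_ne_zero hxy
    rw [Set.indicator_of_mem hmem] at hxy
    obtain ⟨hx, hy⟩ := ne_zero_and_ne_zero_of_mul hxy
    obtain ⟨hx1, hx2, hx3⟩ := hP x hx
    obtain ⟨hy1, hy2, hy3⟩ := hP y hy
    have hst : stabilizer M (x, y) = stabilizer M x ⊓ stabilizer M y := by
      ext g; simp [mem_stabilizer_iff, Prod.ext_iff]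
    have hcl : IsClosed (stabilizer M (x, y) : Set M) := by
      rw [hst]; exact hx1.inter hy1
    have hlx : idComp (stabilizer M (x, y)) ≤ c x := idComp_mono (hst ▸ inf_le_left)
    have hly : idComp (stabilizer M (x, y)) ≤ c y := idComp_mono (hst ▸ inf_le_right)
    refine ⟨hcl, fun htop => hx2 ?_, ?_⟩
    · rw [hst] at htop
      exact top_le_iff.1 (htop ▸ inf_le_left)
    · by_cases hxb : c x = ⊥
      · exact Or.inl (le_bot_iff.1 (hxb ▸ hlx))
      by_cases hyb : c y = ⊥
      · exact Or.inl (le_bot_iff.1 (hyb ▸ hly))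
      right
      have hxy' : c x ≠ c y := fun he => hmem ⟨he, hxb⟩
      have hx4 : rk (stabilizer M x) < j + 1 := hx3.resolve_left hxb
      have hy4 : rk (stabilizer M y) < j + 1 := hy3.resolve_left hyb
      rcases hlx.lt_or_eq with hl | hl
      · have := rk_lt_rk hcl hx1 hl
        omega
      · have hl' : idComp (stabilizer M (x, y)) < c y := lt_of_le_of_ne hly (hl ▸ hxy')
        have := rk_lt_rk hcl hy1 hl'
        omega)
  have h2 : δ * ∑' p, Aᶜ.indicator F p ≤ 2 * m * D :=
    h1.trans ((shiftVar_indicator_le S F _ hAc).trans (shiftVar_prod_le S f))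
  let fb : Subgroup M → ℝ≥0∞ := fun C => ∑' y, {y | c y = C}.indicator f y
  have h3 : ∑' p, A.indicator F p = ∑' x, {x | c x ≠ ⊥}.indicator (fun x => f x * fb (c x)) x := by
    rw [ENNReal.tsum_prod']
    refine tsum_congr fun x => ?_
    by_cases hx : c x = ⊥
    · rw [Set.indicator_of_notMem (by simpa using hx)]
      rw [ENNReal.tsum_eq_zero]
      intro y
      exact Set.indicator_of_notMem (fun h => h.2 hx) _
    · rw [Set.indicator_of_mem (by simpa using hx)]
      simp only [fb]
      rw [← ENNReal.tsum_mul_left]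
      refine tsum_congr fun y => ?_
      by_cases hy : c y = c x
      · rw [Set.indicator_of_mem (show (x, y) ∈ A from ⟨hy.symm, hx⟩),
          Set.indicator_of_mem (by simpa using hy)]
      · rw [Set.indicator_of_notMem (fun h => hy h.1.symm),
          Set.indicator_of_notMem (by simpa using hy), mul_zero]
  have h4 : m * m = ∑' p, A.indicator F p + ∑' p, Aᶜ.indicator F p := by
    rw [← hFsum, ← ENNReal.tsum_add]
    exact tsum_congr fun p => (Set.indicator_self_add_compl_apply _ _ _).symm
  have hfble : ∀ C, fb C ≤ m := fun C => ENNReal.tsum_le_tsum fun z => Set.indicator_le_self _ _ _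
  obtain ⟨x₀, hx0, hxb, hxf⟩ : ∃ x, f x ≠ 0 ∧ c x ≠ ⊥ ∧ (5 / 8 : ℝ≥0) * m < fb (c x) := by
    by_contra! hno
    have h5 : ∑' p, A.indicator F p ≤ m * ((5 / 8 : ℝ≥0) * m) := by
      rw [h3, hm, ← ENNReal.tsum_mul_right]
      refine ENNReal.tsum_le_tsum fun x => ?_
      by_cases hx : c x = ⊥
      · rw [Set.indicator_of_notMem (by simpa using hx)]; exact zero_le
      · rw [Set.indicator_of_mem (by simpa using hx)]
        by_cases hx0 : f x = 0
        · simp [hx0]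
        · gcongr; exact hno x hx0 hx
    exact gap_arith_pairs hf hlt h2 h4 h5
  have h6 : ∀ s ∈ S, ∀ g, g ∈ c x₀ ↔ s⁻¹ * g * s ∈ c x₀ := by
    intro s hs
    suffices hsx : c (s • x₀) = c x₀ by
      intro g; rw [← hc', hsx]
    by_contra hne
    have h7 := tsum_shift_le S f hs {y | c y = c (s • x₀)}
    have h8 : ∑' x, {y | c y = c (s • x₀)}.indicator (fun x => f (s⁻¹ • x)) x = fb (c x₀) := by
      rw [← tsum_smul_eq _ s]
      refine tsum_congr fun x => ?_
      by_cases hx : c x = c x₀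
      · rw [Set.indicator_of_mem (show x ∈ {y | c y = c x₀} from hx),
          Set.indicator_of_mem (show s • x ∈ {y | c y = c (s • x₀)} from hceq s _ _ hx)]
        simp
      · rw [Set.indicator_of_notMem (show x ∉ {y | c y = c x₀} from hx),
          Set.indicator_of_notMem]
        intro h
        apply hx
        simpa using hceq s⁻¹ _ _ h
    rw [h8] at h7
    have h9 : fb (c x₀) + fb (c (s • x₀)) ≤ m := by
      rw [hm, ← ENNReal.tsum_add]
      refine ENNReal.tsum_le_tsum fun y => ?_
      by_cases hy : c y = c x₀
      · rw [Set.indicator_of_mem (by simpa using hy), Set.indicator_of_notMem, add_zero]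
        intro h
        exact hne (h.symm.trans hy)
      · rw [Set.indicator_of_notMem (by simpa using hy), zero_add]
        exact Set.indicator_le_self _ _ _
    exact gap_arith_fiber hf (hlt.trans_le (by gcongr; exact min_le_right _ _)) hxf h7 h9
  let N : Subgroup M :=
    { carrier := {g | ∀ h ∈ c x₀, g * h * g⁻¹ ∈ c x₀ ∧ g⁻¹ * h * g ∈ c x₀}
      one_mem' := fun h hh => by simpa using hh
      mul_mem' := fun {a b} ha hb h hh => by
        constructor
        · simpa [mul_assoc] using (ha _ (hb h hh).1).1
        · simpa [mul_assoc] using (hb _ (ha h hh).2).2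
      inv_mem' := fun {a} ha h hh => by
        simpa using (ha h hh).symm }
  have hclC : IsClosed (c x₀ : Set M) := isClosed_idComp (hP x₀ hx0).1
  have hNcl : IsClosed (N : Set M) := by
    have : (N : Set M) = ⋂ h ∈ c x₀, ((fun g => g * h * g⁻¹) ⁻¹' (c x₀ : Set M) ∩
        (fun g => g⁻¹ * h * g) ⁻¹' (c x₀ : Set M)) := by
      ext g
      simp [N]
    rw [this]
    refine isClosed_biInter fun h _ => (hclC.preimage (continuous_conj_apply h)).inter
      (hclC.preimage ?_)
    exact ((continuous_conj_apply h).comp continuous_inv).congr fun g => by simp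
  have hNtop : N = ⊤ := hS N hNcl fun s hs h hh => by
    refine ⟨?_, (h6 s hs h).1 hh⟩
    rw [h6 s hs]
    simpa [mul_assoc] using hh
  have hnormal : (c x₀).Normal := ⟨fun h hh g =>
    ((hNtop ▸ Subgroup.mem_top g : g ∈ N) h hh).1⟩
  have htop := hM (c x₀) hnormal hclC (isIrreducible_idComp _) hxb
  exact (hP x₀ hx0).2.1 (top_le_iff.1 (htop ▸ idComp_le _))

theorem hasGap_of_proper {S : Finset M}
    (hS : ∀ H : Subgroup M, IsClosed (H : Set M) → ↑S ⊆ (H : Set M) → H = ⊤)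
    (hM : ∀ N : Subgroup M, N.Normal → IsClosed (N : Set M) → IsIrreducible (N : Set M) →
      N ≠ ⊥ → N = ⊤)
    (h : HasGap S (fun H => H = ⊥)) :
    HasGap S (fun H => IsClosed (H : Set M) ∧ H ≠ ⊤) := by
  have key : ∀ j : ℕ,
      HasGap S (fun H => IsClosed (H : Set M) ∧ H ≠ ⊤ ∧ (idComp H = ⊥ ∨ rk H < j)) := by
    intro j
    induction j with
    | zero =>
      obtain ⟨δ, hδ, h⟩ := hasGap_finite h
      exact ⟨δ, hδ, fun Ω _ f hf hP => h Ω f hf fun x hx => by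
        obtain ⟨h1, -, h2⟩ := hP x hx
        exact finite_of_idComp_eq_bot h1 (h2.resolve_right (by simp))⟩
    | succ j ih => exact hasGap_succ hS hM ih
  obtain ⟨n, hn⟩ := exists_rk_le M
  obtain ⟨δ, hδ, h⟩ := key (n + 1)
  exact ⟨δ, hδ, fun Ω _ f hf hP => h Ω f hf fun x hx =>
    ⟨(hP x hx).1, (hP x hx).2, Or.inr (Nat.lt_succ_of_le (hn _))⟩⟩

end Gap

section RandomWalk

open ENNReal NNReal MulAction

variable {M : Type} [Group M]

/-- The expectation of `φ` at the `k`-th step of the random walk driven by the uniform measure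
on `S`. -/
noncomputable def walkE (S : Finset M) : ℕ → (M → ℝ≥0) → ℝ≥0
  | 0, φ => φ 1
  | k + 1, φ => (S.card : ℝ≥0)⁻¹ * ∑ s ∈ S, walkE S k (fun u => φ (s * u))

theorem walkE_mono (S : Finset M) (k : ℕ) {φ ψ : M → ℝ≥0} (h : ∀ u, φ u ≤ ψ u) :
    walkE S k φ ≤ walkE S k ψ := by
  induction k generalizing φ ψ with
  | zero => exact h 1
  | succ k ih =>
    unfold walkE
    gcongr with s hs
    exact ih fun u => h _

theorem walkE_add (S : Finset M) (k : ℕ) (φ ψ : M → ℝ≥0) :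
    walkE S k (fun u => φ u + ψ u) = walkE S k φ + walkE S k ψ := by
  induction k generalizing φ ψ with
  | zero => rfl
  | succ k ih =>
    unfold walkE
    rw [← mul_add, ← Finset.sum_add_distrib]
    simp only [ih]

theorem walkE_const_mul (S : Finset M) (k : ℕ) (c : ℝ≥0) (φ : M → ℝ≥0) :
    walkE S k (fun u => c * φ u) = c * walkE S k φ := by
  induction k generalizing φ with
  | zero => rfl
  | succ k ih =>
    unfold walkE
    simp only [ih, ← Finset.mul_sum]
    ring

theorem walkE_zero (S : Finset M) (k : ℕ) : walkE S k (fun _ => 0) = 0 := by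
  simpa using walkE_const_mul S k 0 0

theorem walkE_const {S : Finset M} (hS : S.Nonempty) (k : ℕ) (c : ℝ≥0) :
    walkE S k (fun _ => c) = c := by
  induction k with
  | zero => rfl
  | succ k ih =>
    have : (S.card : ℝ≥0) ≠ 0 := by exact_mod_cast hS.card_ne_zero
    unfold walkE
    simp only [ih, Finset.sum_const, nsmul_eq_mul, inv_mul_cancel_left₀ this]

theorem walkE_sum {α : Type*} (S : Finset M) (k : ℕ) (A : Finset α) (φ : α → M → ℝ≥0) :
    walkE S k (fun u => ∑ a ∈ A, φ a u) = ∑ a ∈ A, walkE S k (φ a) := by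
  classical
  induction A using Finset.induction_on with
  | empty => simpa using walkE_zero S k
  | insert a A ha ih =>
    simp only [Finset.sum_insert ha, walkE_add, ih]

theorem walkE_walkE_comm (S : Finset M) (k l : ℕ) (φ : M → M → ℝ≥0) :
    walkE S k (fun u => walkE S l (fun v => φ u v)) =
      walkE S l (fun v => walkE S k (fun u => φ u v)) := by
  induction k generalizing φ with
  | zero => rfl
  | succ k ih =>
    simp only [walkE, ih, walkE_const_mul, walkE_sum]

theorem walkE_add_steps (S : Finset M) (k l : ℕ) (φ : M → ℝ≥0) :
    walkE S (k + l) φ = walkE S k (fun u => walkE S l (fun v => φ (u * v))) := by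
  induction k generalizing φ with
  | zero => simp [walkE]
  | succ k ih =>
    rw [Nat.succ_add]
    simp only [walkE, ih, mul_assoc]

theorem sq_walkE_le (S : Finset M) (k : ℕ) (φ : M → ℝ≥0) :
    walkE S k φ ^ 2 ≤ walkE S k (fun u => φ u ^ 2) := by
  induction k generalizing φ with
  | zero => exact le_rfl
  | succ k ih =>
    unfold walkE
    rcases S.eq_empty_or_nonempty with rfl | hS
    · simp
    have h0 : (S.card : ℝ≥0) ≠ 0 := by exact_mod_cast hS.card_ne_zero
    calc ((S.card : ℝ≥0)⁻¹ * ∑ s ∈ S, walkE S k (fun u => φ (s * u))) ^ 2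
        = ((S.card : ℝ≥0)⁻¹) ^ 2 * (∑ s ∈ S, walkE S k (fun u => φ (s * u))) ^ 2 := mul_pow _ _ _
      _ ≤ ((S.card : ℝ≥0)⁻¹) ^ 2 *
          (S.card * ∑ s ∈ S, walkE S k (fun u => φ (s * u)) ^ 2) := by
          gcongr
          exact sq_sum_le_card_mul_sum_sq
      _ = (S.card : ℝ≥0)⁻¹ * ∑ s ∈ S, walkE S k (fun u => φ (s * u)) ^ 2 := by
          rw [← mul_assoc, sq, mul_assoc (S.card : ℝ≥0)⁻¹, inv_mul_cancel₀ h0, mul_one]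
      _ ≤ _ := by gcongr with s; exact ih _

/-- If an event has positive probability, it contains a product of `k` elements of `S`. -/
theorem exists_of_walkE_lt_one {S : Finset M} (hS : S.Nonempty) {k : ℕ} {φ : M → ℝ≥0}
    (h : walkE S k φ < 1) : ∃ l : List M, (∀ a ∈ l, a ∈ S) ∧ l.length = k ∧ φ l.prod < 1 := by
  induction k generalizing φ with
  | zero => exact ⟨[], by simp, rfl, by simpa [walkE] using h⟩
  | succ k ih =>
    by_contra! hno
    refine h.not_ge ?_
    have h0 : (S.card : ℝ≥0) ≠ 0 := by exact_mod_cast hS.card_ne_zero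
    have h1 : ∀ s ∈ S, 1 ≤ walkE S k (fun u => φ (s * u)) := by
      intro s hs
      by_contra! hlt
      obtain ⟨l, hl, hlen, hφ⟩ := ih hlt
      refine (hno (s :: l) ?_ (by simp [hlen])).not_gt (by simpa using hφ)
      simpa using ⟨hs, hl⟩
    calc (1 : ℝ≥0) = (S.card : ℝ≥0)⁻¹ * ∑ s ∈ S, 1 := by simp [h0]
      _ ≤ _ := by
        unfold walkE
        gcongr with s hs
        exact h1 s hs

/-- The distribution of `g • x₀` after `k` steps. -/
noncomputable def walkDist {Ω : Type} [MulAction M Ω] (S : Finset M) (x₀ : Ω) : ℕ → Ω → ℝ≥0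
  | 0, y => by classical exact if y = x₀ then 1 else 0
  | k + 1, y => (S.card : ℝ≥0)⁻¹ * ∑ s ∈ S, walkDist S x₀ k (s⁻¹ • y)

theorem walkE_smul_eq_tsum {Ω : Type} [MulAction M Ω] (S : Finset M) (x₀ : Ω) (k : ℕ)
    (φ : Ω → ℝ≥0) :
    (walkE S k (fun g => φ (g • x₀)) : ℝ≥0∞) = ∑' y, (walkDist S x₀ k y * φ y : ℝ≥0∞) := by
  classical
  induction k generalizing φ with
  | zero =>
    rw [tsum_eq_single x₀]
    · simp [walkE, walkDist]
    · intro y hy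
      simp [walkDist, hy]
  | succ k ih =>
    have h1 : ∀ s : M, ∑' y, (walkDist S x₀ k (s⁻¹ • y) * φ y : ℝ≥0∞) =
        (walkE S k (fun u => φ ((s * u) • x₀)) : ℝ≥0∞) := by
      intro s
      rw [← tsum_smul_eq _ s]
      simp only [inv_smul_smul, mul_smul]
      rw [ih (fun y => φ (s • y))]
    simp only [walkE, walkDist, ENNReal.coe_mul, ENNReal.ofNNReal_finsetSum, ← h1]
    simp only [mul_assoc, Finset.sum_mul, ENNReal.tsum_mul_left]
    rw [Summable.tsum_finsetSum (fun _ _ => ENNReal.summable)]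

theorem walkDist_ne_zero {Ω : Type} [MulAction M Ω] {S : Finset M} {x₀ : Ω} {k : ℕ} {y : Ω}
    (h : walkDist S x₀ k y ≠ 0) : y ∈ orbit M x₀ := by
  classical
  induction k generalizing y with
  | zero =>
    have : y = x₀ := by
      by_contra hy
      exact h (by simp [walkDist, hy])
    rw [this]
    exact mem_orbit_self x₀
  | succ k ih =>
    unfold walkDist at h
    obtain ⟨s, -, hs⟩ := Finset.exists_ne_zero_of_sum_ne_zero (right_ne_zero_of_mul h)
    have := mem_orbit_of_mem_orbit s (ih hs)
    simpa using this

theorem sq_average_add_le {α : Type*} {S : Finset α} {a : α → ℝ} {o : α} (ho : o ∈ S)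
    {t : ℝ} (ht : 0 < t) :
    ((S.card : ℝ)⁻¹ * ∑ s ∈ S, a s) ^ 2 +
        t / (S.card : ℝ) ^ 2 * ∑ s ∈ S, max (a s ^ 2 - a o ^ 2) 0 ≤
      (S.card : ℝ)⁻¹ * ∑ s ∈ S, a s ^ 2 +
        t / (S.card : ℝ) ^ 2 * (t * ∑ s ∈ S, (a s ^ 2 + a o ^ 2)) := by
  have h1 : (1 : ℝ) ≤ S.card := by exact_mod_cast Finset.card_pos.2 ⟨o, ho⟩
  obtain ⟨c, hcS⟩ : ∃ c : ℝ, (S.card : ℝ) = c := ⟨_, rfl⟩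
  obtain ⟨A, hA⟩ : ∃ A : ℝ, (S.card : ℝ)⁻¹ * ∑ s ∈ S, a s = A := ⟨_, rfl⟩
  rw [hA, hcS]
  rw [hcS] at h1 hA
  have hc : 0 < c := by linarith
  have hsum : ∑ s ∈ S, a s = c * A := by rw [← hA, mul_inv_cancel_left₀ hc.ne']
  have hvar : ∑ s ∈ S, a s ^ 2 - c * A ^ 2 = ∑ s ∈ S, (a s - A) ^ 2 := by
    simp only [sub_sq, Finset.sum_add_distrib, Finset.sum_sub_distrib, ← Finset.sum_mul,
      ← Finset.mul_sum, Finset.sum_const, nsmul_eq_mul, hsum, hcS]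
    ring
  have hdev : ∑ s ∈ S, (a s - a o) ^ 2 = ∑ s ∈ S, (a s - A) ^ 2 + c * (a o - A) ^ 2 := by
    have : ∀ s, (a s - a o) ^ 2 = (a s - A) ^ 2 - 2 * (a o - A) * (a s - A) + (a o - A) ^ 2 :=
      fun s => by ring
    simp only [this, Finset.sum_add_distrib, Finset.sum_sub_distrib, ← Finset.mul_sum,
      Finset.sum_const, nsmul_eq_mul, hsum, hcS]
    ring
  have ho' : (a o - A) ^ 2 ≤ ∑ s ∈ S, (a s - A) ^ 2 :=
    Finset.single_le_sum (f := fun s => (a s - A) ^ 2) (fun _ _ => sq_nonneg _) ho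
  have hpt : ∀ s ∈ S, t * max (a s ^ 2 - a o ^ 2) 0 ≤
      (a s - a o) ^ 2 / 2 + t * (t * (a s ^ 2 + a o ^ 2)) := by
    intro s _
    rcases max_cases (a s ^ 2 - a o ^ 2) 0 with ⟨h, -⟩ | ⟨h, -⟩
    · rw [h]
      nlinarith [sq_nonneg ((a s - a o) - t * (a s + a o)), sq_nonneg (t * (a s - a o))]
    · rw [h, mul_zero]
      positivity
  have hsumpt := Finset.sum_le_sum hpt
  rw [Finset.sum_add_distrib, ← Finset.mul_sum, ← Finset.mul_sum, ← Finset.mul_sum,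
    ← Finset.sum_div, hdev] at hsumpt
  generalize ∑ s ∈ S, max (a s ^ 2 - a o ^ 2) 0 = B at *
  generalize ∑ s ∈ S, (a s - A) ^ 2 = V at *
  generalize ∑ s ∈ S, (a s ^ 2 + a o ^ 2) = F at *
  generalize ∑ s ∈ S, a s ^ 2 = Q at *
  have hV : 0 ≤ V := (sq_nonneg _).trans ho'
  have e1 : c⁻¹ * Q = A ^ 2 + c⁻¹ * V := by
    rw [← hvar]; field_simp; ring
  rw [e1, add_assoc]
  refine add_le_add le_rfl ?_
  have h2 : t / c ^ 2 * B = (t * B) / c ^ 2 := by ring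
  have h3 : c⁻¹ * V + t / c ^ 2 * (t * F) = (c * V + t * (t * F)) / c ^ 2 := by
    field_simp
  rw [h2, h3]
  gcongr
  nlinarith

theorem sq_average_add_le_coe {α : Type*} {S : Finset α} (a : α → ℝ≥0) {o : α} (ho : o ∈ S)
    {t : ℝ≥0} (ht : 0 < t) :
    (((S.card : ℝ≥0)⁻¹ * ∑ s ∈ S, a s : ℝ≥0) ^ 2 : ℝ≥0∞) +
        (t / (S.card : ℝ≥0) ^ 2 : ℝ≥0) * ∑ s ∈ S, ((a s ^ 2 : ℝ≥0∞) - (a o ^ 2 : ℝ≥0∞)) ≤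
      ((S.card : ℝ≥0)⁻¹ : ℝ≥0) * ∑ s ∈ S, (a s ^ 2 : ℝ≥0∞) +
        (t / (S.card : ℝ≥0) ^ 2 : ℝ≥0) *
          (t * ∑ s ∈ S, ((a s ^ 2 : ℝ≥0∞) + (a o ^ 2 : ℝ≥0∞))) := by
  have := sq_average_add_le (a := fun s => (a s : ℝ)) ho (t := t) ht
  have h2 : ((S.card : ℝ≥0)⁻¹ * ∑ s ∈ S, a s : ℝ≥0) ^ 2 +
        (t / (S.card : ℝ≥0) ^ 2 : ℝ≥0) * ∑ s ∈ S, (a s ^ 2 - a o ^ 2) ≤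
      ((S.card : ℝ≥0)⁻¹ : ℝ≥0) * ∑ s ∈ S, a s ^ 2 +
        (t / (S.card : ℝ≥0) ^ 2 : ℝ≥0) * (t * ∑ s ∈ S, (a s ^ 2 + a o ^ 2)) := by
    rw [← NNReal.coe_le_coe]
    simp only [NNReal.coe_add, NNReal.coe_mul, NNReal.coe_pow, NNReal.coe_sum, NNReal.coe_inv,
      NNReal.coe_div, NNReal.coe_natCast, NNReal.coe_sub_def]
    exact this
  exact_mod_cast h2

theorem contraction_arith {T m δ κ t c V : ℝ≥0∞} (hm : m ≠ ∞)
    (ht : t * c = δ / 4) (hgap : δ * m ≤ V) (hc : c⁻¹ * c = 1) (hκδ : κ * δ / 2 ≤ 1)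
    (h : T + κ * V ≤ c⁻¹ * (c * m) + κ * (t * (c * (m + m)))) :
    T ≤ (1 - κ * δ / 2) * m := by
  have e2 : κ * (t * (c * (m + m))) = κ * δ / 2 * m := by
    have : (4 : ℝ≥0∞)⁻¹ * 2 = 2⁻¹ := by
      rw [← ENNReal.toReal_eq_toReal_iff' (by finiteness) (by finiteness)]
      norm_num
    calc κ * (t * (c * (m + m))) = κ * (t * c) * (2 * m) := by ring
      _ = κ * δ * ((4 : ℝ≥0∞)⁻¹ * 2) * m := by rw [ht, div_eq_mul_inv]; ring
      _ = κ * δ / 2 * m := by rw [this, div_eq_mul_inv]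
  rw [e2, ← mul_assoc, hc, one_mul] at h
  have h3 : κ * δ * m = κ * δ / 2 * m + κ * δ / 2 * m := by
    rw [← add_mul, ENNReal.add_halves]
  have h4 : T + κ * δ / 2 * m + κ * δ / 2 * m ≤ m + κ * δ / 2 * m := by
    rw [add_assoc, ← h3, mul_assoc]
    exact le_trans (by gcongr) h
  have hfin : κ * δ / 2 * m ≠ ∞ := ENNReal.mul_ne_top (ne_top_of_le_ne_top one_ne_top hκδ) hm
  rw [ENNReal.add_le_add_iff_right hfin] at h4
  rw [ENNReal.sub_mul (fun _ _ => hm), one_mul]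
  exact ENNReal.le_sub_of_add_le_right hfin h4

theorem exists_norm_contraction {S : Finset M} (h1 : (1 : M) ∈ S) {P : Subgroup M → Prop}
    (h : HasGap S P) :
    ∃ ρ : ℝ≥0, ρ < 1 ∧ ∀ (Ω : Type) [MulAction M Ω] (ξ : Ω → ℝ≥0),
      ∑' x, (ξ x ^ 2 : ℝ≥0∞) ≠ ∞ → (∀ x, ξ x ≠ 0 → P (stabilizer M x)) →
      ∑' x, (((S.card : ℝ≥0)⁻¹ * ∑ s ∈ S, ξ (s⁻¹ • x) : ℝ≥0) ^ 2 : ℝ≥0∞) ≤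
        ρ * ∑' x, (ξ x ^ 2 : ℝ≥0∞) := by
  obtain ⟨δ', hδ', h'⟩ := h
  obtain ⟨δ, hδ, hδ1, h⟩ : ∃ δ : ℝ≥0, 0 < δ ∧ δ ≤ 1 ∧ ∀ (Ω : Type) [MulAction M Ω]
      (f : Ω → ℝ≥0∞), ∑' x, f x ≠ ∞ →
    (∀ x, f x ≠ 0 → P (stabilizer M x)) → δ * ∑' x, f x ≤ shiftVar S f :=
    ⟨min δ' 1, by positivity, min_le_right _ _, fun Ω _ f hf hP =>
      le_trans (by gcongr; exact min_le_left _ _) (h' Ω f hf hP)⟩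
  have hc1 : 1 ≤ (S.card : ℝ≥0) := by exact_mod_cast Finset.card_pos.2 ⟨1, h1⟩
  have hc : 0 < (S.card : ℝ≥0) := by positivity
  have ht0 : 0 < δ / (4 * S.card) := by positivity
  obtain ⟨t, ht⟩ : ∃ t : ℝ≥0, t = δ / (4 * S.card) := ⟨_, rfl⟩
  rw [← ht] at ht0
  have htc : t * S.card = δ / 4 := by
    rw [ht]; field_simp
  have ht1 : t ≤ 1 := by
    rw [ht]
    refine div_le_one_of_le₀ ?_ zero_le
    calc δ ≤ 1 := hδ1
      _ ≤ 4 * 1 := by norm_num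
      _ ≤ 4 * S.card := by gcongr
  obtain ⟨κ, hκ⟩ : ∃ κ : ℝ≥0, κ = t / S.card ^ 2 := ⟨_, rfl⟩
  have hκ0 : 0 < κ := by rw [hκ]; positivity
  have hκ1 : κ ≤ 1 := by
    rw [hκ]
    exact div_le_one_of_le₀ (ht1.trans (one_le_pow₀ hc1)) zero_le
  have hκδ : κ * δ / 2 ≤ 1 := by
    refine div_le_one_of_le₀ ?_ zero_le
    calc κ * δ ≤ 1 * 1 := by gcongr
      _ ≤ 2 := by norm_num
  refine ⟨1 - κ * δ / 2, tsub_lt_self one_pos (by positivity), fun Ω _ ξ hξ hP => ?_⟩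
  have hgap := h Ω (fun x => (ξ x ^ 2 : ℝ≥0∞)) hξ (fun x hx => hP x fun h0 => hx (by simp [h0]))
  have hsum := ENNReal.tsum_le_tsum fun x =>
    sq_average_add_le_coe (fun s => ξ (s⁻¹ • x)) h1 ht0
  rw [← hκ] at hsum
  have hshift : ∀ s : M, ∑' x, (ξ (s⁻¹ • x) ^ 2 : ℝ≥0∞) = ∑' x, (ξ x ^ 2 : ℝ≥0∞) :=
    fun s => tsum_smul_eq (fun x => (ξ x ^ 2 : ℝ≥0∞)) s⁻¹
  simp only [ENNReal.tsum_add, ENNReal.tsum_mul_left, inv_one, one_smul,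
    Summable.tsum_finsetSum (fun _ _ => ENNReal.summable), hshift, Finset.sum_const,
    nsmul_eq_mul] at hsum
  have hcoe : ((1 - κ * δ / 2 : ℝ≥0) : ℝ≥0∞) = 1 - (κ : ℝ≥0∞) * δ / 2 := by
    rw [ENNReal.coe_sub, ENNReal.coe_div two_ne_zero]
    norm_cast
  rw [hcoe]
  refine contraction_arith (c := S.card) (t := t) hξ ?_ hgap ?_ ?_ ?_
  · have := congrArg ((↑) : ℝ≥0 → ℝ≥0∞) htc
    rw [ENNReal.coe_div four_ne_zero] at this
    exact_mod_cast this
  · exact ENNReal.inv_mul_cancel (by exact_mod_cast hc.ne') (ENNReal.natCast_ne_top _)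
  · have := ENNReal.coe_le_coe.2 hκδ
    rw [ENNReal.coe_div two_ne_zero] at this
    exact_mod_cast this
  · rw [ENNReal.coe_inv hc.ne'] at hsum
    exact_mod_cast hsum

/-- Exponential decay of the collision probability in coset spaces. -/
theorem exists_walkE_coset_le {S : Finset M} (h1 : (1 : M) ∈ S) {P : Subgroup M → Prop}
    (h : HasGap S P) :
    ∃ ρ : ℝ≥0, ρ < 1 ∧ ∀ H : Subgroup M, (∀ g : M, P (H.map (MulAut.conj g).toMonoidHom)) →
      ∀ k (I : M → M → ℝ≥0), (∀ g g', I g g' ≤ 1) → (∀ g g', g'⁻¹ * g ∉ H → I g g' = 0) →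
      walkE S k (fun g => walkE S k (fun g' => I g g')) ≤ ρ ^ k := by
  classical
  obtain ⟨ρ, hρ, hcon⟩ := exists_norm_contraction h1 h
  refine ⟨ρ, hρ, fun H hH k I hI1 hI0 => ?_⟩
  set x₀ : M ⧸ H := ((1 : M) : M ⧸ H) with hx₀
  have hst : ∀ k y, walkDist S x₀ k y ≠ 0 → P (stabilizer M y) := by
    intro k y hy
    obtain ⟨g, rfl⟩ := walkDist_ne_zero hy
    have : stabilizer M (g • x₀) = H.map (MulAut.conj g).toMonoidHom := by
      rw [stabilizer_smul_eq_stabilizer_map_conj, hx₀, stabilizer_quotient]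
    change P (stabilizer M (g • x₀))
    rw [this]
    exact hH g
  have hnorm : ∀ k, ∑' y, (walkDist S x₀ k y ^ 2 : ℝ≥0∞) ≤ (ρ : ℝ≥0∞) ^ k := by
    intro k
    induction k with
    | zero =>
      rw [tsum_eq_single x₀]
      · simp [walkDist]
      · intro y hy
        simp [walkDist, hy]
    | succ k ih =>
      have := hcon (M ⧸ H) (walkDist S x₀ k) (ne_top_of_le_ne_top (by finiteness) ih) (hst k)
      rw [pow_succ']
      exact this.trans (by gcongr)
  have hdist : ∀ y, walkE S k (fun g => if g • x₀ = y then 1 else 0) = walkDist S x₀ k y := by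
    intro y
    have := walkE_smul_eq_tsum S x₀ k (fun z => if z = y then 1 else 0)
    rw [tsum_eq_single y (by intro z hz; simp [hz])] at this
    simpa using this
  have hle : walkE S k (fun g => walkE S k (fun g' => I g g')) ≤
      walkE S k (fun g => walkDist S x₀ k (g • x₀)) := by
    refine walkE_mono S k fun g => ?_
    rw [← hdist]
    refine walkE_mono S k fun g' => ?_
    by_cases hg : g'⁻¹ * g ∈ H
    · rw [if_pos]
      · exact hI1 g g'
      · rw [hx₀, Quotient.smul_mk, Quotient.smul_mk]
        simpa [QuotientGroup.eq] using hg
    · rw [hI0 g g' hg]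
      exact zero_le
  have := walkE_smul_eq_tsum S x₀ k (walkDist S x₀ k)
  have h2 : (walkE S k (fun g => walkDist S x₀ k (g • x₀)) : ℝ≥0∞) ≤ (ρ : ℝ≥0∞) ^ k := by
    rw [this]
    simpa [sq] using hnorm k
  refine hle.trans ?_
  exact_mod_cast h2

end RandomWalk

section DimensionTheory

open MvPolynomial

variable {k : Type*} [Field k]

/-- The variables other than one occurring in `g` remain independent modulo `g`. -/
theorem algebraicIndependent_mod_principal {j : ℕ} {g : MvPolynomial (Fin (j + 1)) k}
    (hg : g ≠ 0) {t : Fin (j + 1)} (ht : 0 < g.degreeOf t) (p : MvPolynomial (Fin j) k)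
    (hp : rename t.succAbove p ∈ Ideal.span {g}) : p = 0 := by
  by_contra hp0
  obtain ⟨q, hq⟩ := Ideal.mem_span_singleton.1 hp
  have hr : rename t.succAbove p ≠ 0 := by
    rwa [Ne, map_eq_zero_iff _ (rename_injective _ Fin.succAbove_right_injective)]
  have hq0 : q ≠ 0 := by
    rintro rfl
    exact hr (by rw [hq, mul_zero])
  have h1 : degreeOf t (rename t.succAbove p) = 0 := by
    by_contra h
    have : t ∈ (rename t.succAbove p).vars := by
      classical
      rw [degreeOf_def] at h
      rw [vars_def]
      exact Multiset.mem_toFinset.2 (Multiset.count_ne_zero.1 h)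
    have := vars_rename t.succAbove p this
    simp only [Finset.mem_image] at this
    obtain ⟨i, -, hi⟩ := this
    exact Fin.succAbove_ne t i hi
  rw [hq, degreeOf_mul_eq hg hq0] at h1
  omega

theorem isTranscendenceBasis_of_isIntegral {A : Type*} [CommRing A] [IsDomain A] [Algebra k A]
    {ι : Type*} {φ : MvPolynomial ι k →ₐ[k] A} (hφ : Function.Injective φ)
    (hint : φ.toRingHom.IsIntegral) : IsTranscendenceBasis k fun i => φ (X i) := by
  have he : (aeval fun i => φ (X i)) = φ := by
    ext i
    simp
  rw [isTranscendenceBasis_iff_algebraicIndependent_isAlgebraic]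
  refine ⟨?_, ⟨fun a => ?_⟩⟩
  · rw [AlgebraicIndependent, he]
    exact hφ
  · obtain ⟨p, hp, hpa⟩ := hint a
    have hmem : ∀ c, φ c ∈ Algebra.adjoin k (Set.range fun i => φ (X i)) := by
      intro c
      rw [Algebra.adjoin_range_eq_range_aeval, he]
      exact ⟨c, rfl⟩
    let ψ : MvPolynomial ι k →+* Algebra.adjoin k (Set.range fun i => φ (X i)) :=
      φ.toRingHom.codRestrict _ hmem
    refine IsIntegral.isAlgebraic ⟨p.map ψ, hp.map _, ?_⟩
    rw [Polynomial.eval₂_map]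
    exact hpa

theorem le_of_isTranscendenceBasis {A : Type*} [CommRing A] [IsDomain A] [Algebra k A]
    {ι κ : Type} [Fintype ι] [Fintype κ] {x : ι → A} {y : κ → A} (hx : AlgebraicIndependent k x)
    (hy : IsTranscendenceBasis k y) : Fintype.card ι ≤ Fintype.card κ := by
  have h1 := hx.lift_cardinalMk_le_trdeg
  rw [← hy.lift_cardinalMk_eq_trdeg] at h1
  simpa using h1

theorem exists_algebraicIndependent_quotient {A : Type*} [CommRing A] [IsDomain A] [Algebra k A]
    [Algebra.FiniteType k A] {q : A} {𝔮 : Ideal A}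
    (h𝔮 : 𝔮 ∈ (Ideal.span {q}).minimalPrimes) {j : ℕ} {x : Fin (j + 1) → A}
    (hx : AlgebraicIndependent k x) :
    ∃ y : Fin j → A, ∀ f : MvPolynomial (Fin j) k, aeval y f ∈ 𝔮 → f = 0 := by
  have hprime : 𝔮.IsPrime := h𝔮.1.1
  have : IsNoetherianRing A := Algebra.FiniteType.isNoetherianRing k A
  obtain ⟨s, φ, hφ, hint⟩ := exists_integral_inj_algHom_of_fg k A
  have hheight : 𝔮.height ≤ 1 := Ideal.height_le_one_of_isPrincipal_of_mem_minimalPrimes _ _ h𝔮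
  have hs := le_of_isTranscendenceBasis hx (isTranscendenceBasis_of_isIntegral hφ hint)
  simp only [Fintype.card_fin] at hs
  obtain ⟨s, rfl⟩ : ∃ s', s = s' + 1 := ⟨s - 1, by omega⟩
  set 𝔟 : Ideal (MvPolynomial (Fin (s + 1)) k) := 𝔮.comap φ with h𝔟
  have key : ∃ z : Fin s → Fin (s + 1), ∀ p : MvPolynomial (Fin s) k, rename z p ∈ 𝔟 → p = 0 := by
    by_cases hb : 𝔟 = ⊥
    · refine ⟨Fin.succ, fun p hp => ?_⟩
      rw [hb, Ideal.mem_bot] at hp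
      rwa [map_eq_zero_iff _ (rename_injective _ (Fin.succ_injective _))] at hp
    · have hbp : 𝔟.IsPrime := Ideal.comap_isPrime _ _
      obtain ⟨g, hgb, hg⟩ := hbp.exists_mem_prime_of_ne_bot hb
      have hbg : 𝔟 = Ideal.span {g} := by
        by_contra hne
        have hlt : Ideal.span {g} < 𝔟 :=
          lt_of_le_of_ne (by rwa [Ideal.span_singleton_le_iff_mem]) (Ne.symm hne)
        algebraize [φ.toRingHom]
        have hgp : (Ideal.span {g}).IsPrime := (Ideal.span_singleton_prime hg.ne_zero).2 hg
        have : FaithfulSMul (MvPolynomial (Fin (s + 1)) k) A :=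
          (faithfulSMul_iff_algebraMap_injective _ _).2 hφ
        have : 𝔮.LiesOver 𝔟 := ⟨rfl⟩
        obtain ⟨𝔭, h𝔭, hp, hl⟩ := Ideal.exists_ideal_lt_liesOver_of_lt 𝔮 hlt
        have h0 : (⊥ : Ideal A) < 𝔭 := by
          rw [bot_lt_iff_ne_bot]
          rintro rfl
          have : g ∈ (⊥ : Ideal A).under (MvPolynomial (Fin (s + 1)) k) := by
            rw [← hl.over]
            exact Ideal.mem_span_singleton_self g
          rw [Ideal.mem_comap, Ideal.mem_bot] at this
          exact hg.ne_zero ((map_eq_zero_iff φ hφ).1 this)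
        have e1 := Ideal.height_add_one_le_of_lt_of_isPrime h0
        have e2 := Ideal.height_add_one_le_of_lt_of_isPrime h𝔭
        rw [Ideal.height_bot, zero_add] at e1
        have : (2 : ℕ∞) ≤ 1 := by
          calc (2 : ℕ∞) = 1 + 1 := by norm_num
            _ ≤ 𝔭.height + 1 := by gcongr
            _ ≤ 1 := e2.trans hheight
        exact absurd this (by decide)
      obtain ⟨t, ht⟩ : ∃ t, 0 < g.degreeOf t := by
        by_contra! hcon
        have : g.totalDegree = 0 := by
          rw [totalDegree_eq_zero_iff]
          intro m hm i
          have := hcon i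
          have := degreeOf_le_iff.1 this m hm
          omega
        rw [totalDegree_eq_zero_iff_eq_C] at this
        refine hg.not_isUnit ?_
        rw [this]
        refine (isUnit_iff_ne_zero.2 fun h0 => hg.ne_zero ?_).map C
        rw [this, h0, C_0]
      exact ⟨t.succAbove, fun p hp => algebraicIndependent_mod_principal hg.ne_zero ht p
        (hbg ▸ hp)⟩
  obtain ⟨z, hz⟩ := key
  let ι : Fin j → Fin s := Fin.castLE (by omega)
  refine ⟨fun i => φ (X (z (ι i))), fun f hf => ?_⟩
  have h0 : rename ι f = 0 := by
    apply hz
    rw [h𝔟, Ideal.mem_comap]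
    have : aeval (fun i => φ (X (z (ι i)))) = (φ.comp (rename z)).comp (rename ι) := by
      ext i
      simp
    rw [this] at hf
    exact hf
  exact (map_eq_zero_iff _ (rename_injective _ (Fin.castLE_injective _))).1 h0

theorem exists_isTranscendenceBasis_coord {σ : Type*} (𝔮 : Ideal (MvPolynomial σ k))
    [𝔮.IsPrime] : ∃ t : Set σ, IsTranscendenceBasis k
      fun i : t => (Ideal.Quotient.mk 𝔮 (X (i : σ)) : MvPolynomial σ k ⧸ 𝔮) := by
  set s : Set (MvPolynomial σ k ⧸ 𝔮) := Set.range fun i => Ideal.Quotient.mk 𝔮 (X i) with hs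
  have hadj : Algebra.adjoin k s = ⊤ := by
    have : (aeval fun i => (Ideal.Quotient.mk 𝔮 (X i) : MvPolynomial σ k ⧸ 𝔮)) =
        Ideal.Quotient.mkₐ k 𝔮 := by
      ext i
      simp
    rw [hs, Algebra.adjoin_range_eq_range_aeval, this, AlgHom.range_eq_top]
    exact Ideal.Quotient.mkₐ_surjective k 𝔮
  have : Algebra.IsAlgebraic (Algebra.adjoin k s) (MvPolynomial σ k ⧸ 𝔮) := by
    rw [hadj]
    exact ⟨fun a => isAlgebraic_algebraMap (⟨a, trivial⟩ : (⊤ : Subalgebra k _))⟩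
  have := (faithfulSMul_iff_algebraMap_injective k (MvPolynomial σ k ⧸ 𝔮)).2
    (algebraMap k (MvPolynomial σ k ⧸ 𝔮)).injective
  obtain ⟨t, hts, ht⟩ := exists_isTranscendenceBasis_subset (R := k) s
  have hts' : ∀ a : t, ∃ i, (Ideal.Quotient.mk 𝔮 (X i) : MvPolynomial σ k ⧸ 𝔮) = a :=
    fun a => hts a.2
  choose f hf using hts'
  have hinj : Function.Injective f := fun a b hab => Subtype.ext (by rw [← hf a, ← hf b, hab])
  refine ⟨Set.range f, ?_⟩
  rw [← isTranscendenceBasis_equiv (Equiv.ofInjective f hinj)]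
  have : (Subtype.val : t → MvPolynomial σ k ⧸ 𝔮) =
      (fun i : Set.range f => Ideal.Quotient.mk 𝔮 (X (i : σ))) ∘ Equiv.ofInjective f hinj :=
    funext fun a => (hf a).symm
  rwa [← this]

theorem exists_algebraicIndependent_coord {σ : Type} [Finite σ] (𝔮 : Ideal (MvPolynomial σ k))
    [𝔮.IsPrime] {j : ℕ} {y : Fin j → MvPolynomial σ k}
    (hy : ∀ f : MvPolynomial (Fin j) k, aeval y f ∈ 𝔮 → f = 0) :
    ∃ e : Fin j → σ, AlgebraicIndependent k
      fun i => (Ideal.Quotient.mk 𝔮 (X (e i)) : MvPolynomial σ k ⧸ 𝔮) := by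
  obtain ⟨t, ht⟩ := exists_isTranscendenceBasis_coord 𝔮
  have := Fintype.ofFinite t
  have hy' : AlgebraicIndependent k fun i => (Ideal.Quotient.mk 𝔮 (y i) : MvPolynomial σ k ⧸ 𝔮) := by
    rw [algebraicIndependent_iff]
    intro f hf
    refine hy f (Ideal.Quotient.eq_zero_iff_mem.1 (Eq.trans ?_ hf))
    exact comp_aeval_apply y (Ideal.Quotient.mkₐ k 𝔮) f
  have h := le_of_isTranscendenceBasis hy' ht
  obtain ⟨f⟩ : Nonempty (Fin j ↪ t) := Function.Embedding.nonempty_of_card_le (by simpa using h)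
  exact ⟨fun i => f i, ht.1.comp f f.injective⟩

end DimensionTheory

section HilbertFunction

open MvPolynomial Module Filter

variable {k : Type*} [Field k] {σ : Type} [Finite σ]

/-- The affine Hilbert function of an ideal. -/
noncomputable def hilb (P : Ideal (MvPolynomial σ k)) (m : ℕ) : ℕ :=
  finrank k ((restrictTotalDegree σ k m).map (Ideal.Quotient.mkₐ k P).toLinearMap)

omit [Finite σ] in
theorem mk_mem_map_restrictTotalDegree {P : Ideal (MvPolynomial σ k)} {m : ℕ}
    {p : MvPolynomial σ k} (hp : p.totalDegree ≤ m) : Ideal.Quotient.mk P p ∈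
      (restrictTotalDegree σ k m).map (Ideal.Quotient.mkₐ k P).toLinearMap :=
  ⟨p, (mem_restrictTotalDegree _ _ _).2 hp, rfl⟩

theorem hilb_mono (P : Ideal (MvPolynomial σ k)) : Monotone (hilb P) := by
  intro a b hab
  refine Submodule.finrank_mono (Submodule.map_mono fun p hp => ?_)
  rw [mem_restrictTotalDegree] at *
  omega

theorem pow_le_hilb {P : Ideal (MvPolynomial σ k)} {j : ℕ} {e : Fin j → σ}
    (he : AlgebraicIndependent k
      fun i => (Ideal.Quotient.mk P (X (e i)) : MvPolynomial σ k ⧸ P)) (m : ℕ) :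
    m ^ j ≤ j ^ j * hilb P m := by
  have hlin : LinearIndependent k fun a : Fin j → Fin (m / j + 1) =>
      (⟨Ideal.Quotient.mk P (∏ i, X (e i) ^ (a i : ℕ)), mk_mem_map_restrictTotalDegree (by
        refine (totalDegree_finsetProd _ _).trans ?_
        calc ∑ i, (X (e i) ^ (a i : ℕ) : MvPolynomial σ k).totalDegree
            ≤ ∑ i : Fin j, m / j := Finset.sum_le_sum fun i _ => by
              rw [totalDegree_X_pow]
              exact Nat.lt_succ_iff.1 (a i).2
          _ ≤ m := by simpa using Nat.mul_div_le m j)⟩ :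
        (restrictTotalDegree σ k m).map (Ideal.Quotient.mkₐ k P).toLinearMap) := by
    refine LinearIndependent.of_comp (Submodule.subtype _) ?_
    have h1 := (basisMonomials (Fin j) k).linearIndependent.comp
      (fun a : Fin j → Fin (m / j + 1) => Finsupp.equivFunOnFinite.symm fun i => (a i : ℕ)) (by
        intro a b hab
        ext i
        simpa using DFunLike.congr_fun hab i)
    have h2 := h1.map' (aeval fun i =>
      (Ideal.Quotient.mk P (X (e i)) : MvPolynomial σ k ⧸ P)).toLinearMap
      (LinearMap.ker_eq_bot.2 he)
    convert! h2
    funext a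
    simp [aeval_monomial, Finsupp.prod_fintype, map_prod]
  have hcard := hlin.fintype_card_le_finrank
  simp only [Fintype.card_pi, Fintype.card_fin, Finset.prod_const, Finset.card_univ] at hcard
  calc m ^ j ≤ (j * (m / j + 1)) ^ j := by
        rcases Nat.eq_zero_or_pos j with rfl | hj
        · simp
        · exact Nat.pow_le_pow_left (Nat.lt_mul_div_succ m hj).le j
    _ = j ^ j * (m / j + 1) ^ j := mul_pow _ _ _
    _ ≤ j ^ j * hilb P m := Nat.mul_le_mul_left _ hcard

/-- Comparison of the Hilbert functions of the minimal primes over `P + (Q)` with the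
first difference of that of `P`. -/
theorem sum_hilb_le {P : Ideal (MvPolynomial σ k)} [P.IsPrime] {Q : MvPolynomial σ k} (hQ : Q ∉ P)
    {n : ℕ} (hn : Q.totalDegree ≤ n) {ι : Type*} [Fintype ι] (𝔮 : ι → Ideal (MvPolynomial σ k))
    (hprime : ∀ i, (𝔮 i).IsPrime) (hle : ∀ i, P ≤ 𝔮 i) (hQm : ∀ i, Q ∈ 𝔮 i)
    (hinc : ∀ i l, 𝔮 l ≤ 𝔮 i → l = i) :
    ∃ c, ∀ m, n ≤ m → ∑ i, hilb (𝔮 i) m + hilb P (m + c - n) ≤ hilb P (m + c) := by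
  classical
  have hx : ∀ i l, l ≠ i → ∃ x ∈ 𝔮 l, x ∉ 𝔮 i := fun i l hl =>
    Set.not_subset.1 fun h => hl (hinc i l h)
  choose! x hx1 hx2 using hx
  let e : ι → MvPolynomial σ k := fun i => ∏ l ∈ Finset.univ.erase i, x i l
  have he1 : ∀ i, e i ∉ 𝔮 i := by
    intro i hi
    obtain ⟨l, hl, hmem⟩ := (hprime i).prod_mem_iff.1 hi
    exact hx2 i l (Finset.ne_of_mem_erase hl) hmem
  have he2 : ∀ i l, l ≠ i → e i ∈ 𝔮 l := fun i l hl =>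
    Ideal.prod_mem _ (Finset.mem_erase.2 ⟨hl, Finset.mem_univ l⟩) (hx1 i l hl)
  refine ⟨Finset.univ.sup fun i => (e i).totalDegree, fun m hm => ?_⟩
  set c := Finset.univ.sup fun i => (e i).totalDegree with hc
  have hec : ∀ i, (e i).totalDegree ≤ c := fun i =>
    Finset.le_sup (f := fun i => (e i).totalDegree) (Finset.mem_univ i)
  let W := (restrictTotalDegree σ k (m + c)).map (Ideal.Quotient.mkₐ k P).toLinearMap
  let Ψ : (MvPolynomial σ k ⧸ P) →ₗ[k] (∀ i, MvPolynomial σ k ⧸ 𝔮 i) :=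
    LinearMap.pi fun i => (Ideal.Quotient.factorₐ k (hle i)).toLinearMap
  have hΨ : ∀ p i, Ψ (Ideal.Quotient.mk P p) i = Ideal.Quotient.mk (𝔮 i) p := fun p i => rfl
  have hrank := LinearMap.finrank_range_add_finrank_ker (Ψ.domRestrict W)
  change _ = hilb P (m + c) at hrank
  rw [← hrank]
  refine add_le_add ?_ ?_
  · have hp := hprime
    let V : ∀ i, Submodule k (MvPolynomial σ k ⧸ 𝔮 i) := fun i =>
      (restrictTotalDegree σ k m).map (Ideal.Quotient.mkₐ k (𝔮 i)).toLinearMap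
    let Θ : (∀ i, V i) →ₗ[k] (∀ i, MvPolynomial σ k ⧸ 𝔮 i) := LinearMap.pi fun i =>
      (LinearMap.mulLeft k (Ideal.Quotient.mk (𝔮 i) (e i))) ∘ₗ (V i).subtype ∘ₗ LinearMap.proj i
    have hΘ : Function.Injective Θ := by
      intro a b hab
      ext i
      have h := congrFun hab i
      change Ideal.Quotient.mk (𝔮 i) (e i) * (a i : _) = Ideal.Quotient.mk (𝔮 i) (e i) * (b i : _)
        at h
      exact mul_left_cancel₀ (fun h0 => he1 i (Ideal.Quotient.eq_zero_iff_mem.1 h0)) h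
    have hfree : ∀ i, Module.Free k (V i) := fun i => Module.Free.of_divisionRing k _
    calc ∑ i, hilb (𝔮 i) m = finrank k (∀ i, V i) := (finrank_pi_fintype k).symm
      _ = finrank k (LinearMap.range Θ) := (LinearMap.finrank_range_of_inj hΘ).symm
      _ ≤ _ := by
        refine Submodule.finrank_mono ?_
        rintro _ ⟨a, rfl⟩
        have ha : ∀ i, ∃ r : MvPolynomial σ k, r.totalDegree ≤ m ∧
            Ideal.Quotient.mk (𝔮 i) r = (a i : MvPolynomial σ k ⧸ 𝔮 i) := fun i => by
          obtain ⟨r, hr, hr'⟩ := (a i).2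
          exact ⟨r, (mem_restrictTotalDegree _ _ _).1 hr, hr'⟩
        choose r hr hra using ha
        have hmem : Ideal.Quotient.mk P (∑ i, e i * r i) ∈ W := by
          refine mk_mem_map_restrictTotalDegree (totalDegree_finsetSum_le fun i _ => ?_)
          refine (totalDegree_mul _ _).trans ?_
          have := hec i
          have := hr i
          omega
        refine ⟨⟨_, hmem⟩, funext fun i => ?_⟩
        change Ideal.Quotient.mk (𝔮 i) (∑ l, e l * r l) =
          Ideal.Quotient.mk (𝔮 i) (e i) * (a i : MvPolynomial σ k ⧸ 𝔮 i)
        rw [map_sum, Finset.sum_eq_single i, map_mul, hra]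
        · intro l _ hl
          exact Ideal.Quotient.eq_zero_iff_mem.2 (Ideal.mul_mem_right _ _ (he2 l i hl.symm))
        · simp
  · let N := (restrictTotalDegree σ k (m + c - n)).map (Ideal.Quotient.mkₐ k P).toLinearMap
    have hQinj : Function.Injective (LinearMap.mulLeft k (Ideal.Quotient.mk P Q)) := fun a b hab =>
      mul_left_cancel₀ (fun h0 => hQ (Ideal.Quotient.eq_zero_iff_mem.1 h0)) hab
    have hNW : N.map (LinearMap.mulLeft k (Ideal.Quotient.mk P Q)) ≤ W := by
      rintro _ ⟨_, ⟨r, hr, rfl⟩, rfl⟩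
      have hr' := (mem_restrictTotalDegree _ _ _).1 hr
      refine mk_mem_map_restrictTotalDegree (p := Q * r) ((totalDegree_mul _ _).trans ?_)
      omega
    calc hilb P (m + c - n) = finrank k N := rfl
      _ = finrank k (N.map (LinearMap.mulLeft k (Ideal.Quotient.mk P Q))) :=
        (Submodule.equivMapOfInjective _ hQinj N).finrank_eq
      _ = finrank k ((N.map (LinearMap.mulLeft k (Ideal.Quotient.mk P Q))).comap W.subtype) :=
        (Submodule.comapSubtypeEquivOfLe hNW).symm.finrank_eq
      _ ≤ _ := by
        refine Submodule.finrank_mono ?_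
        rintro ⟨_, _⟩ ⟨_, ⟨r, -, rfl⟩, rfl⟩
        rw [LinearMap.mem_ker]
        funext i
        change Ideal.Quotient.mk (𝔮 i) (Q * r) = 0
        exact Ideal.Quotient.eq_zero_iff_mem.2 (Ideal.mul_mem_right _ _ (hQm i))

end HilbertFunction

section Bezout

open MvPolynomial Module Filter

theorem exists_diff_le {h : ℕ → ℕ} {Δ n L t j : ℕ} (hn : 1 ≤ n) (hL : 2 * n ≤ L)
    (ht : t = L / (2 * n)) (hh : h L ≤ Δ * L ^ (j + 1)) :
    ∃ i < t, h (L - i * n) ≤ h (L - (i + 1) * n) + 4 * n * Δ * L ^ j := by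
  by_contra! hcon
  have hsum : ∀ i ≤ t, h (L - i * n) + i * (4 * n * Δ * L ^ j + 1) ≤ h L := by
    intro i
    induction i with
    | zero => simp
    | succ i ih =>
      intro hi
      have h1 := ih (by omega)
      have h2 := hcon i (by omega)
      have h3 : (i + 1) * (4 * n * Δ * L ^ j + 1) =
        i * (4 * n * Δ * L ^ j + 1) + (4 * n * Δ * L ^ j + 1) := by ring
      omega
  have h1 := hsum t le_rfl
  have ht1 : 1 ≤ t := by
    rw [ht]
    exact Nat.div_pos hL (by omega)
  have ht2 : L ≤ t * (4 * n) := by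
    have h3 : L < 2 * n * (t + 1) := by
      rw [ht]
      exact Nat.lt_mul_div_succ L (by omega)
    nlinarith
  have h4 : Δ * L ^ (j + 1) ≤ t * (4 * n * Δ * L ^ j) := by
    calc Δ * L ^ (j + 1) = L * (Δ * L ^ j) := by ring
      _ ≤ t * (4 * n) * (Δ * L ^ j) := Nat.mul_le_mul_right _ ht2
      _ = _ := by ring
  rw [mul_add] at h1
  omega

theorem frequently_diff_le {h : ℕ → ℕ} {Δ n j : ℕ} (hn : 1 ≤ n)
    (hh : ∃ᶠ m in atTop, h m ≤ Δ * m ^ (j + 1)) (c : ℕ) :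
    ∃ᶠ m in atTop, h (m + c) ≤ h (m + c - n) + 4 ^ (j + 1) * (n * Δ) * m ^ j := by
  rw [frequently_atTop] at hh ⊢
  intro N
  obtain ⟨L, hL, hL'⟩ := hh (4 * N + 4 * c + 2 * n)
  obtain ⟨i, hi, hi'⟩ := exists_diff_le (t := L / (2 * n)) hn (by omega) rfl hL'
  have hin : 2 * (i * n) ≤ L := by
    have h1 := Nat.mul_div_le L (2 * n)
    have h2 : 2 * (i * n) ≤ 2 * n * (L / (2 * n)) := by nlinarith
    omega
  refine ⟨L - i * n - c, by omega, ?_⟩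
  have e1 : L - i * n - c + c = L - i * n := by omega
  rw [e1]
  have e2 : L - i * n - n = L - (i + 1) * n := by rw [add_mul, one_mul]; omega
  rw [e2]
  refine hi'.trans (Nat.add_le_add_left ?_ _)
  calc 4 * n * Δ * L ^ j ≤ 4 * n * Δ * (4 * (L - i * n - c)) ^ j := by
        gcongr
        omega
    _ = 4 ^ (j + 1) * (n * Δ) * (L - i * n - c) ^ j := by
        rw [mul_pow, pow_succ]
        ring

variable {k : Type*} [Field k] {σ : Type} [Finite σ]

/-- Prime ideals of dimension at least `j` and degree at most (a constant times) `Δ`, in terms of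
the Hilbert function. -/
structure HilbClass (P : Ideal (MvPolynomial σ k)) (j Δ : ℕ) : Prop where
  isPrime : P.IsPrime
  exists_coord : ∃ e : Fin j → σ, AlgebraicIndependent k
    fun i => (Ideal.Quotient.mk P (X (e i)) : MvPolynomial σ k ⧸ P)
  frequently_le : ∃ᶠ m in atTop, hilb P m ≤ Δ * m ^ j

theorem exists_coord_of_mem_minimalPrimes {P : Ideal (MvPolynomial σ k)} [P.IsPrime] {j : ℕ}
    {e : Fin (j + 1) → σ} (he : AlgebraicIndependent k
      fun i => (Ideal.Quotient.mk P (X (e i)) : MvPolynomial σ k ⧸ P))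
    {Q : MvPolynomial σ k} {𝔮 : Ideal (MvPolynomial σ k)}
    (hmin : 𝔮 ∈ (P ⊔ Ideal.span {Q}).minimalPrimes) :
    ∃ e : Fin j → σ, AlgebraicIndependent k
      fun i => (Ideal.Quotient.mk 𝔮 (X (e i)) : MvPolynomial σ k ⧸ 𝔮) := by
  have hcomap : P ⊔ Ideal.span {Q} =
      (Ideal.span {Ideal.Quotient.mk P Q}).comap (Ideal.Quotient.mk P) := by
    rw [← Set.image_singleton, ← Ideal.map_span,
      Ideal.comap_map_of_surjective _ Ideal.Quotient.mk_surjective, sup_comm]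
    congr 1
    exact (Ideal.mk_ker (I := P)).symm
  have hmin' := hmin
  rw [hcomap] at hmin'
  obtain ⟨𝔮', h𝔮', rfl⟩ := Ideal.exists_minimalPrimes_comap_eq _ _ hmin'
  obtain ⟨y, hy⟩ := exists_algebraicIndependent_quotient (k := k) h𝔮' he
  have hp𝔮 := hmin.1.1
  choose p hp using fun i => Ideal.Quotient.mk_surjective (y i)
  refine exists_algebraicIndependent_coord (y := p) _ fun f hf => hy f ?_
  rw [Ideal.mem_comap] at hf
  have : aeval y f = Ideal.Quotient.mk P (aeval p f) := by
    rw [← funext hp]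
    exact (comp_aeval_apply p (Ideal.Quotient.mkₐ k P) f).symm
  rwa [this]

/-- The constant in the Bezout type estimate `HilbClass.bezout`. -/
def bezoutConst (j : ℕ) : ℕ := j ^ j * 4 ^ (j + 1)

theorem HilbClass.bezout {P : Ideal (MvPolynomial σ k)} {j Δ : ℕ} (h : HilbClass P (j + 1) Δ)
    {Q : MvPolynomial σ k} (hQ : Q ∉ P) {n : ℕ} (hn : 1 ≤ n) (hQn : Q.totalDegree ≤ n) :
    ∃ T : Finset (Ideal (MvPolynomial σ k)), T.card ≤ bezoutConst j * (n * Δ) ∧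
      (∀ 𝔮 ∈ T, P ≤ 𝔮 ∧ Q ∈ 𝔮 ∧ HilbClass 𝔮 j (bezoutConst j * (n * Δ))) ∧
      ∀ x : σ → k, (∀ p ∈ P, eval x p = 0) → eval x Q = 0 → ∃ 𝔮 ∈ T, ∀ p ∈ 𝔮, eval x p = 0 := by
  have hP := h.isPrime
  have hfin : (P ⊔ Ideal.span {Q}).minimalPrimes.Finite :=
    Ideal.finite_minimalPrimes_of_isNoetherianRing _ _
  set T := hfin.toFinset with hT
  have hTmem : ∀ 𝔮, 𝔮 ∈ T ↔ 𝔮 ∈ (P ⊔ Ideal.span {Q}).minimalPrimes := fun 𝔮 => hfin.mem_toFinset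
  have hprime : ∀ 𝔮 ∈ T, 𝔮.IsPrime := fun 𝔮 h𝔮 => ((hTmem 𝔮).1 h𝔮).1.1
  have hPle : ∀ 𝔮 ∈ T, P ≤ 𝔮 := fun 𝔮 h𝔮 => le_sup_left.trans ((hTmem 𝔮).1 h𝔮).1.2
  have hQmem : ∀ 𝔮 ∈ T, Q ∈ 𝔮 := fun 𝔮 h𝔮 =>
    ((hTmem 𝔮).1 h𝔮).1.2 (Ideal.mem_sup_right (Ideal.mem_span_singleton_self Q))
  have hcoord : ∀ 𝔮 ∈ T, ∃ e : Fin j → σ, AlgebraicIndependent k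
      fun i => (Ideal.Quotient.mk 𝔮 (X (e i)) : MvPolynomial σ k ⧸ 𝔮) := by
    intro 𝔮 h𝔮
    obtain ⟨e, he⟩ := h.exists_coord
    exact exists_coord_of_mem_minimalPrimes he ((hTmem 𝔮).1 h𝔮)
  obtain ⟨c, hc⟩ := sum_hilb_le (ι := T) hQ hQn (fun 𝔮 : T => (𝔮 : Ideal (MvPolynomial σ k)))
    (fun 𝔮 : T => hprime 𝔮 𝔮.2) (fun 𝔮 : T => hPle 𝔮 𝔮.2)
    (fun 𝔮 : T => hQmem 𝔮 𝔮.2)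
    (fun (𝔮 : T) (𝔩 : T) hle =>
      Subtype.ext (le_antisymm hle (((hTmem 𝔮).1 𝔮.2).2 ((hTmem 𝔩).1 𝔩.2).1 hle)))
  have hfreq : ∃ᶠ m in atTop, 1 ≤ m ∧
      ∑ 𝔮 ∈ T, hilb 𝔮 m ≤ 4 ^ (j + 1) * (n * Δ) * m ^ j := by
    refine ((frequently_diff_le hn h.frequently_le c).and_eventually
      (eventually_ge_atTop n)).mono fun m hm => ⟨hn.trans hm.2, ?_⟩
    have h1 := hc m hm.2
    have h2 := hm.1
    rw [Finset.sum_coe_sort T fun 𝔮 => hilb 𝔮 m] at h1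
    omega
  have hj : 1 ≤ j ^ j := Nat.pos_of_ne_zero (by
    rcases Nat.eq_zero_or_pos j with rfl | h
    · simp
    · positivity)
  refine ⟨T, ?_, fun 𝔮 h𝔮 => ⟨hPle 𝔮 h𝔮, hQmem 𝔮 h𝔮, hprime 𝔮 h𝔮, hcoord 𝔮 h𝔮, ?_⟩, fun x hx hxQ => ?_⟩
  · obtain ⟨m, hm1, hm⟩ := hfreq.exists
    refine Nat.le_of_mul_le_mul_right ?_ (pow_pos (Nat.lt_of_lt_of_le Nat.zero_lt_one hm1) j)
    calc T.card * m ^ j = ∑ 𝔮 ∈ T, m ^ j := by simp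
      _ ≤ ∑ 𝔮 ∈ T, j ^ j * hilb 𝔮 m := Finset.sum_le_sum fun 𝔮 h𝔮 => by
          obtain ⟨e, he⟩ := hcoord 𝔮 h𝔮
          exact pow_le_hilb he m
      _ = j ^ j * ∑ 𝔮 ∈ T, hilb 𝔮 m := (Finset.mul_sum _ _ _).symm
      _ ≤ j ^ j * (4 ^ (j + 1) * (n * Δ) * m ^ j) := Nat.mul_le_mul_left _ hm
      _ = bezoutConst j * (n * Δ) * m ^ j := by rw [bezoutConst]; ring
  · refine hfreq.mono fun m hm => ?_
    calc hilb 𝔮 m ≤ ∑ 𝔮 ∈ T, hilb 𝔮 m :=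
          Finset.single_le_sum (f := fun 𝔮 => hilb 𝔮 m) (fun _ _ => Nat.zero_le _) h𝔮
      _ ≤ 4 ^ (j + 1) * (n * Δ) * m ^ j := hm.2
      _ ≤ j ^ j * (4 ^ (j + 1) * (n * Δ) * m ^ j) := Nat.le_mul_of_pos_left _ hj
      _ = _ := by rw [bezoutConst]; ring
  · have hker : (RingHom.ker (eval x)).IsPrime := RingHom.ker_isPrime _
    have hle : P ⊔ Ideal.span {Q} ≤ RingHom.ker (eval x) :=
      sup_le (fun p hp => hx p hp) ((Ideal.span_singleton_le_iff_mem _).2 hxQ)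
    obtain ⟨𝔮, h𝔮, hle'⟩ := Ideal.exists_minimalPrimes_le hle
    exact ⟨𝔮, (hTmem 𝔮).2 h𝔮, fun p hp => hle' hp⟩

end Bezout

section HilbertPolynomialBounds

open MvPolynomial Module Filter

variable {k : Type*} [Field k] {σ : Type} [Finite σ]

omit [Finite σ] in
theorem exists_hilb_le_of_span {P : Ideal (MvPolynomial σ k)} {D r c : ℕ}
    (φ : MvPolynomial (Fin D) k →ₐ[k] (MvPolynomial σ k ⧸ P)) (a : Fin r → MvPolynomial σ k ⧸ P)
    (b₁ : Fin r → MvPolynomial (Fin D) k) (hb₁ : ∀ l, (b₁ l).totalDegree ≤ c)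
    (h1 : ∑ l, φ (b₁ l) * a l = 1) (q : σ → Fin r → Fin r → MvPolynomial (Fin D) k)
    (hq : ∀ i l l', (q i l l').totalDegree ≤ c)
    (hmul : ∀ i l, Ideal.Quotient.mk P (X i) * a l = ∑ l', φ (q i l l') * a l') (m : ℕ) :
    hilb P m ≤ (c * (m + 1) + 1) ^ D * r := by
  let U : ℕ → Submodule k (MvPolynomial σ k ⧸ P) := fun N =>
    Submodule.span k {x | ∃ l b, totalDegree b ≤ N ∧ x = φ b * a l}
  have hU : Monotone U := fun N N' hN => Submodule.span_mono
    fun x ⟨l, b, hb, hx⟩ => ⟨l, b, hb.trans hN, hx⟩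
  have hXU : ∀ N i x, x ∈ U N → Ideal.Quotient.mk P (X i) * x ∈ U (N + c) := by
    intro N i x hx
    induction hx using Submodule.span_induction with
    | mem x hx =>
      obtain ⟨l, b, hb, rfl⟩ := hx
      rw [mul_left_comm, hmul, Finset.mul_sum]
      refine Submodule.sum_mem _ fun l' _ => Submodule.subset_span ⟨l', b * q i l l', ?_, ?_⟩
      · exact (totalDegree_mul _ _).trans (add_le_add hb (hq i l l'))
      · rw [map_mul, mul_assoc]
    | zero => simp
    | add x y _ _ hx hy => rw [mul_add]; exact add_mem hx hy
    | smul t x _ hx => rw [mul_smul_comm]; exact Submodule.smul_mem _ _ hx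
  have hmon : ∀ n (s : σ →₀ ℕ), s.degree = n →
      Ideal.Quotient.mk P (monomial s 1) ∈ U (c * (n + 1)) := by
    intro n
    induction n with
    | zero =>
      intro s hs
      rw [Finsupp.degree_eq_zero_iff] at hs
      subst hs
      rw [monomial_zero', map_one, map_one, ← h1]
      exact Submodule.sum_mem _ fun l _ => Submodule.subset_span ⟨l, b₁ l, by simpa using hb₁ l, rfl⟩
    | succ n ih =>
      intro s hs
      have hs0 : s ≠ 0 := by
        rintro rfl
        simp at hs
      obtain ⟨i, hi⟩ := Finsupp.ne_iff.1 hs0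
      have hle : Finsupp.single i 1 ≤ s := by
        rw [Finsupp.single_le_iff]
        exact Nat.one_le_iff_ne_zero.2 hi
      have hsplit : s = Finsupp.single i 1 + (s - Finsupp.single i 1) :=
        (add_tsub_cancel_of_le hle).symm
      have hdeg : (s - Finsupp.single i 1).degree = n := by
        have := congrArg Finsupp.degree hsplit
        rw [map_add, Finsupp.degree_single, hs] at this
        omega
      rw [hsplit, show (monomial (Finsupp.single i 1 + (s - Finsupp.single i 1)) (1 : k)) =
        X i * monomial (s - Finsupp.single i 1) 1 by rw [X, monomial_mul, one_mul], map_mul]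
      have := hXU _ i _ (ih _ hdeg)
      rwa [show c * (n + 1) + c = c * (n + 1 + 1) by ring] at this
  have himage : (restrictTotalDegree σ k m).map (Ideal.Quotient.mkₐ k P).toLinearMap ≤
      U (c * (m + 1)) := by
    rintro _ ⟨p, hp, rfl⟩
    have hp' : p.totalDegree ≤ m := (mem_restrictTotalDegree _ _ _).1 hp
    rw [AlgHom.toLinearMap_apply, as_sum p, map_sum]
    refine Submodule.sum_mem _ fun s hs => ?_
    rw [show monomial s (coeff s p) = coeff s p • monomial s (1 : k) by
      rw [smul_monomial, smul_eq_mul, mul_one], map_smul]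
    refine Submodule.smul_mem _ _ (hU ?_ (hmon _ s rfl))
    have := le_totalDegree hs
    have h2 : s.degree ≤ m := by
      refine le_trans ?_ hp'
      rw [Finsupp.degree_apply]
      exact this
    gcongr
  set N := c * (m + 1) with hN
  have hUspan : U N ≤ Submodule.span k (Set.range fun z : (Fin D → Fin (N + 1)) × Fin r =>
      φ (∏ i, X i ^ (z.1 i : ℕ)) * a z.2) := by
    refine Submodule.span_le.2 ?_
    rintro _ ⟨l, b, hb, rfl⟩
    rw [SetLike.mem_coe, as_sum b, map_sum, Finset.sum_mul]
    refine Submodule.sum_mem _ fun s hs => ?_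
    have hsN : ∀ i, s i < N + 1 := fun i => by
      have h1 := le_totalDegree hs
      have h2 : s i ≤ s.sum fun _ e => e := by
        rw [Finsupp.sum_fintype _ _ (fun _ => rfl)]
        exact Finset.single_le_sum (f := fun i => s i) (fun _ _ => Nat.zero_le _) (Finset.mem_univ i)
      omega
    rw [show monomial s (coeff s b) = coeff s b • ∏ i, X i ^ s i by
      rw [monomial_eq, Finsupp.prod_fintype _ _ (fun _ => pow_zero _), smul_eq_C_mul], map_smul,
      smul_mul_assoc]
    exact Submodule.smul_mem _ _ (Submodule.subset_span ⟨⟨fun i => ⟨s i, hsN i⟩, l⟩, rfl⟩)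
  have : Module.Finite k (Submodule.span k (Set.range fun z : (Fin D → Fin (N + 1)) × Fin r =>
      φ (∏ i, X i ^ (z.1 i : ℕ)) * a z.2)) := Module.Finite.span_of_finite k (Set.finite_range _)
  calc hilb P m ≤ _ := Submodule.finrank_mono (himage.trans hUspan)
    _ ≤ _ := finrank_range_le_card _
    _ = _ := by simp

theorem _root_.AlgHom.Finite.exists_fin_sum {A B : Type*} [CommRing A] [CommRing B] [Algebra k A]
    [Algebra k B] {φ : B →ₐ[k] A} (h : φ.Finite) :
    ∃ (r : ℕ) (a : Fin r → A), ∀ x, ∃ b : Fin r → B, x = ∑ l, φ (b l) * a l := by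
  algebraize [φ.toRingHom]
  have hfin' : Module.Finite B A := h
  obtain ⟨r, a, ha⟩ := Module.Finite.exists_fin (R := B) (M := A)
  refine ⟨r, a, fun x => ?_⟩
  have hx : x ∈ Submodule.span B (Set.range a) := by rw [ha]; trivial
  obtain ⟨b, hb⟩ := (Submodule.mem_span_range_iff_exists_fun _).1 hx
  exact ⟨b, by rw [← hb]; rfl⟩

theorem _root_.Transcendental.linearIndependent_pow' {A : Type*} [CommRing A] [Algebra k A] {x : A}
    (hx : Transcendental k x) : LinearIndependent k fun n : ℕ => x ^ n := by
  have h1 := (Polynomial.basisMonomials k).linearIndependent.map' (Polynomial.aeval x).toLinearMap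
    (LinearMap.ker_eq_bot.2 (transcendental_iff_injective.1 hx))
  have h2 : (Polynomial.aeval x).toLinearMap ∘ Polynomial.basisMonomials k =
      fun n : ℕ => x ^ n := by
    ext n
    simp
  rwa [h2] at h1

theorem exists_hilbClass (P : Ideal (MvPolynomial σ k)) [P.IsPrime] :
    ∃ D Δ, HilbClass P D Δ := by
  obtain ⟨D, φ, hφ, hfin⟩ := exists_finite_inj_algHom_of_fg k (MvPolynomial σ k ⧸ P)
  obtain ⟨y, hy⟩ : ∃ y : Fin D → MvPolynomial σ k, ∀ i, Ideal.Quotient.mk P (y i) = φ (X i) :=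
    ⟨fun i => (Ideal.Quotient.mk_surjective (φ (X i))).choose,
      fun i => (Ideal.Quotient.mk_surjective (φ (X i))).choose_spec⟩
  have hy' : ∀ f, Ideal.Quotient.mk P (aeval y f) = φ f := by
    intro f
    have : (Ideal.Quotient.mkₐ k P).comp (aeval y) = φ := by
      ext i
      simpa using hy i
    exact DFunLike.congr_fun this f
  have hcoord := exists_algebraicIndependent_coord P (y := y) fun f hf => by
    rw [← Ideal.Quotient.eq_zero_iff_mem, hy'] at hf
    exact (map_eq_zero_iff φ hφ).1 hf
  obtain ⟨r, a, hrep⟩ := hfin.exists_fin_sum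
  obtain ⟨b₁, hb₁⟩ := hrep 1
  choose q hq using fun i l => hrep (Ideal.Quotient.mk P (X i) * a l)
  have := Fintype.ofFinite σ
  obtain ⟨c, hc1, hc2⟩ : ∃ c, (∀ l, (b₁ l).totalDegree ≤ c) ∧
      ∀ i l l', (q i l l').totalDegree ≤ c := by
    refine ⟨(∑ l, (b₁ l).totalDegree) + ∑ z : σ × Fin r × Fin r, (q z.1 z.2.1 z.2.2).totalDegree,
      fun l => ?_, fun i l l' => ?_⟩
    · exact le_add_right (Finset.single_le_sum (f := fun l => (b₁ l).totalDegree)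
        (fun _ _ => Nat.zero_le _) (Finset.mem_univ l))
    · exact le_add_left (Finset.single_le_sum
        (f := fun z : σ × Fin r × Fin r => (q z.1 z.2.1 z.2.2).totalDegree)
        (fun _ _ => Nat.zero_le _) (Finset.mem_univ (i, l, l')))
  refine ⟨D, (2 * c + 1) ^ D * r, inferInstance, hcoord, Eventually.frequently ?_⟩
  filter_upwards [eventually_ge_atTop 1] with m hm
  calc hilb P m ≤ (c * (m + 1) + 1) ^ D * r :=
        exists_hilb_le_of_span φ a b₁ hc1 hb₁.symm q hc2 hq m
    _ ≤ ((2 * c + 1) * m) ^ D * r := by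
        gcongr
        nlinarith
    _ = _ := by
      rw [mul_pow]
      ring

/-- Over an algebraically closed field a prime of dimension zero has at most one zero. -/
theorem HilbClass.subsingleton_zeros [IsAlgClosed k] {P : Ideal (MvPolynomial σ k)} {Δ : ℕ}
    (h : HilbClass P 0 Δ) {x y : σ → k} (hx : ∀ p ∈ P, eval x p = 0)
    (hy : ∀ p ∈ P, eval y p = 0) : x = y := by
  have := h.isPrime
  have hbd : ∀ m, hilb P m ≤ Δ := by
    intro m
    obtain ⟨m', hm', hle⟩ := (frequently_atTop.1 h.frequently_le) m
    exact (hilb_mono P hm').trans (by simpa using hle)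
  have hint : Algebra.IsIntegral k (MvPolynomial σ k ⧸ P) := by
    refine ⟨fun z => ?_⟩
    obtain ⟨p, rfl⟩ := Ideal.Quotient.mk_surjective z
    by_contra hz
    have htr : Transcendental k (Ideal.Quotient.mk P p) := by
      rwa [← isAlgebraic_iff_isIntegral] at hz
    have hlin : LinearIndependent k fun n : ℕ => (Ideal.Quotient.mk P p) ^ n := htr.linearIndependent_pow'
    set m := Δ * p.totalDegree
    have hmem : ∀ i : Fin (Δ + 1), (Ideal.Quotient.mk P p) ^ (i : ℕ) ∈
        (restrictTotalDegree σ k m).map (Ideal.Quotient.mkₐ k P).toLinearMap := fun i => by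
      rw [← map_pow]
      refine mk_mem_map_restrictTotalDegree ((totalDegree_pow _ _).trans ?_)
      exact Nat.mul_le_mul_right _ (Nat.lt_succ_iff.1 i.2)
    have hlin' : LinearIndependent k fun i : Fin (Δ + 1) =>
        (⟨_, hmem i⟩ :
          (restrictTotalDegree σ k m).map (Ideal.Quotient.mkₐ k P).toLinearMap) := by
      refine LinearIndependent.of_comp (Submodule.subtype _) ?_
      exact hlin.comp _ Fin.val_injective
    have h1 := hlin'.fintype_card_le_finrank
    rw [Fintype.card_fin] at h1
    have h2 : Δ + 1 ≤ hilb P m := h1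
    have := hbd m
    omega
  have hbij := IsAlgClosed.algebraMap_bijective_of_isIntegral (k := k) (K := MvPolynomial σ k ⧸ P)
  ext i
  obtain ⟨c, hc⟩ := hbij.2 (Ideal.Quotient.mk P (X i))
  have hmem : X i - C c ∈ P := by
    rw [← Ideal.Quotient.eq_zero_iff_mem, map_sub, ← hc, sub_eq_zero]
    rfl
  have e1 := hx _ hmem
  have e2 := hy _ hmem
  simp only [map_sub, eval_X, eval_C] at e1 e2
  rw [sub_eq_zero.1 e1, sub_eq_zero.1 e2]

end HilbertPolynomialBounds

section SecondMoment

open MvPolynomial Topology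
open scoped NNReal

variable {M : Type} [Group M] [TopologicalSpace M] [ZariskiGroup M] {σ : Type} [Finite σ]
  {K : Type*} [Field K]

/-- The elements of a group whose coordinates are zeros of a given ideal. -/
def zerosIn (c : M → σ → K) (P : Ideal (MvPolynomial σ K)) : Set M :=
  {u | ∀ p ∈ P, eval (c u) p = 0}

/-- The random walk has an exponentially small chance to collide modulo a proper closed subgroup. -/
def CollisionBound (S : Finset M) (ρ : ℝ≥0) : Prop :=
  ∀ H : Subgroup M, IsClosed (H : Set M) → H ≠ ⊤ → ∀ k (I : M → M → ℝ≥0), (∀ g g', I g g' ≤ 1) →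
    (∀ g g', g'⁻¹ * g ∉ H → I g g' = 0) → walkE S k (fun g => walkE S k (fun g' => I g g')) ≤ ρ ^ k

/-- Right translation acts on regular functions without increasing degrees. -/
def TranslatesPolynomials (c : M → σ → K) : Prop :=
  ∀ (h : M) (Q : MvPolynomial σ K), ∃ Q' : MvPolynomial σ K, Q'.totalDegree ≤ Q.totalDegree ∧
    ∀ u, eval (c u) Q' = eval (c (u * h)) Q

omit [Finite σ] in
/-- The pairs of translates of the zero set of `P` that have no large intersection are those that
do not differ by an element of a closed proper subgroup. -/
theorem exists_subgroup_of_zerosIn {c : M → σ → K} (hc : TranslatesPolynomials c)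
    (hclosed : ∀ Q : MvPolynomial σ K, IsClosed {u | eval (c u) Q = 0})
    (𝔭 : Ideal (MvPolynomial σ K)) {n : ℕ}
    (hn : ∃ P ∈ 𝔭, P.totalDegree ≤ n ∧ ∃ u, eval (c u) P ≠ 0) (hne : (zerosIn c 𝔭).Nonempty) :
    ∃ H : Subgroup M, IsClosed (H : Set M) ∧ H ≠ ⊤ ∧ ∀ h ∉ H,
      ∃ Q ∉ 𝔭, Q.totalDegree ≤ n ∧
        ((∀ u ∈ zerosIn c 𝔭, u * h ∈ zerosIn c 𝔭 → eval (c u) Q = 0) ∨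
          (∀ u ∈ zerosIn c 𝔭, u * h ∈ zerosIn c 𝔭 → eval (c (u * h)) Q = 0)) := by
  set Y : Set M := {y | ∀ p ∈ 𝔭, p.totalDegree ≤ n → eval (c y) p = 0} with hY
  have hYclosed : IsClosed Y := by
    have : Y = ⋂ p ∈ 𝔭, ⋂ _ : p.totalDegree ≤ n, {u | eval (c u) p = 0} := by
      ext y
      simp [hY]
    rw [this]
    exact isClosed_biInter fun p _ => isClosed_iInter fun _ => hclosed p
  let H : Subgroup M :=
    { carrier := {h | ∀ y ∈ Y, y * h ∈ Y ∧ y * h⁻¹ ∈ Y}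
      one_mem' := fun y hy => by simpa using hy
      mul_mem' := fun {a b} ha hb y hy => ⟨by
        rw [← mul_assoc]
        exact (hb _ (ha y hy).1).1, by
        rw [_root_.mul_inv_rev, ← mul_assoc]
        exact (ha _ (hb y hy).2).2⟩
      inv_mem' := fun {a} ha y hy => ⟨(ha y hy).2, by simpa using (ha y hy).1⟩ }
  refine ⟨H, ?_, ?_, ?_⟩
  · have : (H : Set M) = ⋂ y ∈ Y, (y * ·) ⁻¹' Y ∩ (fun h => y * h⁻¹) ⁻¹' Y := by
      ext h
      simp [H]
    rw [this]
    exact isClosed_biInter fun y _ => (hYclosed.preimage (ZariskiGroup.continuous_mul_left y)).inter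
      (hYclosed.preimage ((ZariskiGroup.continuous_mul_left y).comp ZariskiGroup.continuous_inv))
  · intro htop
    obtain ⟨y, hy⟩ := hne
    obtain ⟨P, hP, hPn, u, hu⟩ := hn
    have hmem : y⁻¹ * u ∈ H := by
      rw [htop]
      trivial
    have := (hmem y fun p hp _ => hy p hp).1 P hP hPn
    rw [mul_inv_cancel_left] at this
    exact hu this
  · intro h hh
    have hh' : ¬ ∀ y ∈ Y, y * h ∈ Y ∧ y * h⁻¹ ∈ Y := hh
    push Not at hh'
    obtain ⟨y, hy, hyh⟩ := hh'
    by_cases h1 : y * h ∈ Y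
    · have h2 : y * h⁻¹ ∉ Y := hyh h1
      simp only [hY, Set.mem_ofPred_eq, not_forall] at h2
      obtain ⟨Q₀, hQ₀, hdeg, hval⟩ := h2
      obtain ⟨Q, hQdeg, hQ⟩ := hc h⁻¹ Q₀
      refine ⟨Q, fun hmem => hval ?_, hQdeg.trans hdeg, Or.inr fun u hu _ => ?_⟩
      · rw [← hQ]
        exact hy Q hmem (hQdeg.trans hdeg)
      · rw [hQ, mul_inv_cancel_right]
        exact hu _ hQ₀
    · simp only [hY, Set.mem_ofPred_eq, not_forall] at h1
      obtain ⟨Q₀, hQ₀, hdeg, hval⟩ := h1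
      obtain ⟨Q, hQdeg, hQ⟩ := hc h Q₀
      refine ⟨Q, fun hmem => hval ?_, hQdeg.trans hdeg, Or.inl fun u _ hu => ?_⟩
      · rw [← hQ]
        exact hy Q hmem (hQdeg.trans hdeg)
      · rw [hQ]
        exact hu _ hQ₀

omit [Finite σ] in
open Classical in
theorem sq_walkE_zerosIn_le {c : M → σ → K} (hc : TranslatesPolynomials c)
    (hclosed : ∀ Q : MvPolynomial σ K, IsClosed {u | eval (c u) Q = 0})
    {S : Finset M} (hS : S.Nonempty) {ρ : ℝ≥0} (hρ : CollisionBound S ρ)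
    {𝔭 : Ideal (MvPolynomial σ K)} {n N : ℕ}
    (hn : ∃ P ∈ 𝔭, P.totalDegree ≤ n ∧ ∃ u, eval (c u) P ≠ 0) {a k : ℕ} {θ : ℝ≥0}
    (hθ : ∀ Q ∉ 𝔭, Q.totalDegree ≤ n → ∃ T : Finset (Ideal (MvPolynomial σ K)), T.card ≤ N ∧
      (∀ 𝔮 ∈ T, ∀ g, walkE S a (fun u => (zerosIn c 𝔮).indicator 1 (u * g)) ≤ θ) ∧
      ∀ u ∈ zerosIn c 𝔭, eval (c u) Q = 0 → ∃ 𝔮 ∈ T, u ∈ zerosIn c 𝔮) (g₀ : M) :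
    walkE S (a + k) (fun u => (zerosIn c 𝔭).indicator 1 (u * g₀)) ^ 2 ≤ ρ ^ k + N * θ := by
  rcases (zerosIn c 𝔭).eq_empty_or_nonempty with hempty | hne
  · simp [hempty, walkE_zero]
  obtain ⟨H, hHc, hHtop, hH⟩ := exists_subgroup_of_zerosIn hc hclosed 𝔭 hn hne
  set Z := zerosIn c 𝔭 with hZ
  let H' : Subgroup M := H.comap (MulAut.conj g₀⁻¹).toMonoidHom
  have hmemH' : ∀ x, x ∈ H' ↔ g₀⁻¹ * x * g₀ ∈ H := fun x => by
    simp [H', Subgroup.mem_comap]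
  have hH'c : IsClosed (H' : Set M) := by
    have := hHc.preimage (ZariskiGroup.continuous_conj g₀⁻¹)
    convert this using 1
    ext x
    exact Iff.rfl
  have hH'top : H' ≠ ⊤ := by
    intro h
    refine hHtop (eq_top_iff.2 fun x _ => ?_)
    have : g₀ * x * g₀⁻¹ ∈ H' := by rw [h]; trivial
    rw [hmemH'] at this
    simpa [mul_assoc] using this
  let I : M → M → ℝ≥0 := fun v v' => if v'⁻¹ * v ∈ H' then 1 else 0
  have hI := hρ H' hH'c hH'top k I (fun g g' => by dsimp only [I]; split_ifs <;> simp)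
    (fun g g' h => by simp [I, h])
  have hpair : ∀ v v', v'⁻¹ * v ∉ H' →
      walkE S a (fun u => Z.indicator 1 (u * (v * g₀)) * Z.indicator 1 (u * (v' * g₀))) ≤
        N * θ := by
    intro v v' hvv
    rw [hmemH'] at hvv
    obtain ⟨Q, hQ, hQn, hQZ⟩ := hH _ hvv
    obtain ⟨T, hT, hTθ, hTZ⟩ := hθ Q hQ hQn
    obtain ⟨g, hg⟩ : ∃ g, ∀ u, u * (v * g₀) ∈ Z → u * (v' * g₀) ∈ Z →
        ∃ 𝔮 ∈ T, u * g ∈ zerosIn c 𝔮 := by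
      have hrel : ∀ u, u * (v' * g₀) * (g₀⁻¹ * (v'⁻¹ * v) * g₀) = u * (v * g₀) := fun u => by group
      rcases hQZ with h | h
      · refine ⟨v' * g₀, fun u h1 h2 => hTZ _ h2 (h _ h2 ?_)⟩
        rwa [hrel]
      · refine ⟨v * g₀, fun u h1 h2 => hTZ _ h1 ?_⟩
        have := h _ h2 (by rwa [hrel])
        rwa [hrel] at this
    calc _ ≤ walkE S a (fun u => ∑ 𝔮 ∈ T, (zerosIn c 𝔮).indicator 1 (u * g)) := by
          refine walkE_mono _ _ fun u => ?_
          by_cases h1 : u * (v * g₀) ∈ Z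
          · by_cases h2 : u * (v' * g₀) ∈ Z
            · obtain ⟨𝔮, h𝔮, hu⟩ := hg u h1 h2
              rw [Set.indicator_of_mem h1, Set.indicator_of_mem h2]
              calc (1 : ℝ≥0) * 1 = (zerosIn c 𝔮).indicator 1 (u * g) := by
                    rw [Set.indicator_of_mem hu, Pi.one_apply, mul_one]
                _ ≤ _ := Finset.single_le_sum
                    (f := fun 𝔮 => (zerosIn c 𝔮).indicator (1 : M → ℝ≥0) (u * g))
                    (fun _ _ => zero_le) h𝔮
            · simp [Set.indicator_of_notMem h2]
          · simp [Set.indicator_of_notMem h1]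
      _ = ∑ 𝔮 ∈ T, walkE S a (fun u => (zerosIn c 𝔮).indicator 1 (u * g)) := walkE_sum _ _ _ _
      _ ≤ ∑ 𝔮 ∈ T, θ := Finset.sum_le_sum fun 𝔮 h𝔮 => hTθ 𝔮 h𝔮 g
      _ ≤ N * θ := by
          rw [Finset.sum_const, nsmul_eq_mul]
          gcongr
  have hone : ∀ x, Z.indicator (1 : M → ℝ≥0) x ≤ 1 := fun x =>
    Set.indicator_le_self' (fun _ _ => zero_le) x
  calc walkE S (a + k) (fun u => Z.indicator 1 (u * g₀)) ^ 2
      ≤ walkE S a (fun u => walkE S k (fun v => Z.indicator 1 (u * (v * g₀))) ^ 2) := by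
        rw [walkE_add_steps]
        simp only [mul_assoc]
        exact sq_walkE_le _ _ _
    _ = walkE S a (fun u => walkE S k (fun v => walkE S k (fun v' =>
          Z.indicator 1 (u * (v * g₀)) * Z.indicator 1 (u * (v' * g₀))))) := by
        congr 1
        funext u
        simp only [walkE_const_mul]
        rw [sq, ← walkE_const_mul]
        congr 1
        funext v
        rw [mul_comm]
    _ = walkE S k (fun v => walkE S k (fun v' => walkE S a (fun u =>
          Z.indicator 1 (u * (v * g₀)) * Z.indicator 1 (u * (v' * g₀))))) := by
        rw [walkE_walkE_comm]
        congr 1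
        funext v
        rw [walkE_walkE_comm]
    _ ≤ walkE S k (fun v => walkE S k (fun v' => I v v' + N * θ)) := by
        refine walkE_mono _ _ fun v => walkE_mono _ _ fun v' => ?_
        by_cases h : v'⁻¹ * v ∈ H'
        · refine le_add_right ?_
          simp only [I, h, if_true]
          calc _ ≤ walkE S a (fun _ => 1) := walkE_mono _ _ fun u =>
                mul_le_one₀ (hone _) zero_le (hone _)
            _ = 1 := walkE_const hS _ _
        · exact le_add_left (hpair v v' h)
    _ ≤ ρ ^ k + N * θ := by
        simp only [walkE_add, walkE_const hS]
        gcongr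

omit [TopologicalSpace M] [ZariskiGroup M] in
theorem add_pow_le_two_pow_mul (a b : ℝ≥0) (p : ℕ) : (a + b) ^ p ≤ 2 ^ p * (a ^ p + b ^ p) := by
  rcases le_total a b with h | h
  · calc (a + b) ^ p ≤ (2 * b) ^ p := by gcongr; rw [two_mul]; gcongr
      _ ≤ _ := by rw [mul_pow]; gcongr; exact le_add_self
  · calc (a + b) ^ p ≤ (2 * a) ^ p := by gcongr; rw [two_mul]; gcongr
      _ ≤ _ := by rw [mul_pow]; gcongr; exact le_self_add

theorem exists_walkE_zerosIn_le [IsAlgClosed K] {c : M → σ → K} (hinj : Function.Injective c)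
    (hc : TranslatesPolynomials c) [Nontrivial M]
    (hclosed : ∀ Q : MvPolynomial σ K, IsClosed {u | eval (c u) Q = 0})
    {S : Finset M} (hS : S.Nonempty) {ρ : ℝ≥0} (hρ1 : ρ < 1) (hρ : CollisionBound S ρ) (j : ℕ) :
    ∃ (A : ℝ≥0) (e : ℕ), 1 ≤ A ∧ ∀ n Δ, 1 ≤ n → 1 ≤ Δ → ∀ 𝔭 : Ideal (MvPolynomial σ K),
      HilbClass 𝔭 j Δ → (∃ P ∈ 𝔭, P.totalDegree ≤ n ∧ ∃ u, eval (c u) P ≠ 0) → ∀ k g₀,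
      walkE S ((j + 1) * k) (fun u => (zerosIn c 𝔭).indicator 1 (u * g₀)) ^ 2 ^ (j + 1) ≤
        A * (n * Δ) ^ e * ρ ^ k := by
  induction j with
  | zero =>
    refine ⟨1, 0, le_rfl, fun n Δ hn hΔ 𝔭 h𝔭 hP k g₀ => ?_⟩
    set Z := zerosIn c 𝔭 with hZ
    have hsub : ∀ x ∈ Z, ∀ y ∈ Z, x = y := fun x hx y hy => hinj (h𝔭.subsingleton_zeros hx hy)
    have hbot := hρ ⊥ (by rw [Subgroup.coe_bot]; exact isClosed_singleton) bot_ne_top k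
      (fun v v' => Z.indicator 1 (v * g₀) * Z.indicator 1 (v' * g₀))
      (fun v v' => mul_le_one₀ (Set.indicator_le_self' (fun _ _ => zero_le) _) zero_le
        (Set.indicator_le_self' (fun _ _ => zero_le) _)) (fun v v' hvv => by
        by_cases h1 : v * g₀ ∈ Z
        · by_cases h2 : v' * g₀ ∈ Z
          · have := mul_right_cancel (hsub _ h1 _ h2)
            exact absurd (by simp [this]) hvv
          · simp [Set.indicator_of_notMem h2]
        · simp [Set.indicator_of_notMem h1])
    simp only [walkE_const_mul] at hbot
    have e1 : ∀ x : ℝ≥0, (fun v => Z.indicator 1 (v * g₀) * x) =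
        fun v => x * Z.indicator 1 (v * g₀) := fun x => by
      funext v
      rw [mul_comm]
    rw [e1, walkE_const_mul] at hbot
    simpa [sq] using hbot
  | succ j ih =>
    obtain ⟨A, e, hA, ih⟩ := ih
    have hB : 1 ≤ bezoutConst j := by
      unfold bezoutConst
      rcases Nat.eq_zero_or_pos j with rfl | hj
      · norm_num
      · exact Nat.succ_le_of_lt (by positivity)
    set B := bezoutConst j with hBdef
    set p := 2 ^ (j + 1) with hp
    have hp0 : p ≠ 0 := by positivity
    refine ⟨2 ^ p * (1 + B ^ p * (A * B ^ e)), p + 2 * e, ?_, fun n Δ hn hΔ 𝔭 h𝔭 hP k g₀ => ?_⟩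
    · exact one_le_mul_of_one_le_of_one_le (one_le_pow₀ one_le_two) le_self_add
    set N := B * (n * Δ) with hN
    have hN1 : 1 ≤ N := Nat.succ_le_of_lt (by positivity)
    set R : ℝ≥0 := A * (n * N) ^ e * ρ ^ k with hR
    obtain ⟨θ, hθ⟩ : ∃ θ : ℝ≥0, θ ^ p = R :=
      ⟨R ^ ((p : ℝ)⁻¹), NNReal.rpow_inv_natCast_pow R hp0⟩
    have hsq := sq_walkE_zerosIn_le (N := N) (a := (j + 1) * k) (k := k) (θ := θ) hc hclosed hS hρ
      hP (fun Q hQ hQn => by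
        obtain ⟨T, hT, hT1, hT2⟩ := h𝔭.bezout hQ hn hQn
        refine ⟨T, hT, fun 𝔮 h𝔮 g => ?_, fun u hu hQu => hT2 _ hu hQu⟩
        obtain ⟨P, hP, hPn, hPu⟩ := hP
        have := ih n N hn hN1 𝔮 (hT1 𝔮 h𝔮).2.2 ⟨P, (hT1 𝔮 h𝔮).1 hP, hPn, hPu⟩ k g
        rw [← hR, ← hθ] at this
        exact (pow_le_pow_iff_left₀ zero_le zero_le hp0).1 this) g₀
    have hk : (j + 1) * k + k = (j + 1 + 1) * k := by ring
    rw [hk] at hsq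
    have hx1 : (1 : ℝ≥0) ≤ n * Δ := by
      have : 1 ≤ n * Δ := Nat.succ_le_of_lt (by positivity)
      exact_mod_cast this
    rw [pow_succ' 2 (j + 1), pow_mul]
    calc _ ≤ (ρ ^ k + N * θ) ^ p := by gcongr
      _ ≤ 2 ^ p * ((ρ ^ k) ^ p + (N * θ) ^ p) := add_pow_le_two_pow_mul _ _ _
      _ = 2 ^ p * ((ρ ^ k) ^ p + N ^ p * (A * (n * N) ^ e * ρ ^ k)) := by
        rw [mul_pow (N : ℝ≥0), hθ]
      _ ≤ 2 ^ p * ((n * Δ : ℝ≥0) ^ (p + 2 * e) * ρ ^ k +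
          B ^ p * (A * B ^ e) * ((n * Δ : ℝ≥0) ^ (p + 2 * e) * ρ ^ k)) := by
        gcongr 2 ^ p * (?_ + ?_)
        · calc (ρ ^ k) ^ p ≤ ρ ^ k := by
                exact pow_le_of_le_one zero_le (pow_le_one₀ zero_le hρ1.le) hp0
            _ ≤ _ := le_mul_of_one_le_left zero_le (one_le_pow₀ hx1)
        · have h1 : (n : ℝ≥0) * N ≤ B * (n * Δ) ^ 2 := by
            rw [hN]
            push_cast
            calc (n : ℝ≥0) * (B * (n * Δ)) = B * (n * 1 * (n * Δ)) := by ring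
              _ ≤ B * (n * Δ * (n * Δ)) := by
                gcongr
                exact_mod_cast hΔ
              _ = _ := by ring
          calc (N : ℝ≥0) ^ p * (A * (n * N) ^ e * ρ ^ k)
              ≤ (N : ℝ≥0) ^ p * (A * (B * (n * Δ) ^ 2) ^ e * ρ ^ k) := by gcongr
            _ = _ := by
              rw [hN]
              push_cast
              ring
      _ = _ := by ring

omit [Finite σ] in
theorem HilbClass.mono {P : Ideal (MvPolynomial σ K)} {j Δ Δ' : ℕ} (h : HilbClass P j Δ)
    (hΔ : Δ ≤ Δ') : HilbClass P j Δ' :=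
  ⟨h.isPrime, h.exists_coord, h.frequently_le.mono fun m hm => hm.trans (by gcongr)⟩

theorem exists_walkE_zero_le [IsAlgClosed K] {c : M → σ → K} (hinj : Function.Injective c)
    (hc : TranslatesPolynomials c) [Nontrivial M]
    (hclosed : ∀ Q : MvPolynomial σ K, IsClosed {u | eval (c u) Q = 0})
    (hirr : ∀ P Q : MvPolynomial σ K, (∀ u, eval (c u) (P * Q) = 0) →
      (∀ u, eval (c u) P = 0) ∨ ∀ u, eval (c u) Q = 0)
    {S : Finset M} (hS : S.Nonempty) {ρ : ℝ≥0} (hρ1 : ρ < 1) (hρ : CollisionBound S ρ) :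
    ∃ (A : ℝ≥0) (e p L : ℕ), 1 ≤ A ∧ ∀ n, 1 ≤ n → ∀ P : MvPolynomial σ K, P.totalDegree ≤ n →
      (∃ u, eval (c u) P ≠ 0) → ∀ k,
      walkE S (L * k) ({u | eval (c u) P = 0}.indicator 1) ^ p ≤ A * n ^ e * ρ ^ k := by
  let I : Ideal (MvPolynomial σ K) :=
    { carrier := {p | ∀ u, eval (c u) p = 0}
      add_mem' := fun ha hb u => by rw [map_add, ha u, hb u, add_zero]
      zero_mem' := fun u => map_zero _
      smul_mem' := fun a b hb u => by rw [smul_eq_mul, map_mul, hb u, mul_zero] }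
  have hI : I.IsPrime := by
    refine ⟨fun h => ?_, fun {P Q} h => hirr P Q h⟩
    have : (1 : MvPolynomial σ K) ∈ I := by rw [h]; trivial
    simpa using this 1
  obtain ⟨D, Δ, hD⟩ := exists_hilbClass I
  replace hD := hD.mono (Nat.le_add_right Δ 1)
  set Δ' := Δ + 1
  rcases D with _ | j
  · obtain ⟨x, y, hxy⟩ := exists_pair_ne M
    exact absurd (hinj (hD.subsingleton_zeros (fun p hp => hp x) fun p hp => hp y)) hxy
  obtain ⟨A, e, hA, h⟩ := exists_walkE_zerosIn_le hinj hc hclosed hS hρ1 hρ j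
  set B := bezoutConst j with hB
  have hB1 : 1 ≤ B := by
    rw [hB]
    unfold bezoutConst
    rcases Nat.eq_zero_or_pos j with rfl | hj
    · norm_num
    · exact Nat.succ_le_of_lt (by positivity)
  set p := 2 ^ (j + 1) with hp
  refine ⟨(B * Δ') ^ p * (A * (B * Δ') ^ e), p + 2 * e, p, j + 1, ?_, fun n hn P hPn hP k => ?_⟩
  · have : (1 : ℝ≥0) ≤ B * Δ' := by
      have : 1 ≤ B * Δ' := Nat.succ_le_of_lt (by positivity)
      exact_mod_cast this
    exact one_le_mul_of_one_le_of_one_le (one_le_pow₀ this)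
      (one_le_mul_of_one_le_of_one_le hA (one_le_pow₀ this))
  · obtain ⟨T, hT, hT1, hT2⟩ := hD.bezout (Q := P) (fun hmem => by
      obtain ⟨u, hu⟩ := hP
      exact hu (hmem u)) hn hPn
    rw [← hB] at hT hT1
    set N := B * (n * Δ') with hN
    have hN1 : 1 ≤ N := Nat.succ_le_of_lt (by positivity)
    set R : ℝ≥0 := A * (n * N) ^ e * ρ ^ k with hR
    obtain ⟨θ, hθ⟩ : ∃ θ : ℝ≥0, θ ^ p = R :=
      ⟨R ^ ((p : ℝ)⁻¹), NNReal.rpow_inv_natCast_pow R (by positivity)⟩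
    have hle : walkE S ((j + 1) * k) ({u | eval (c u) P = 0}.indicator 1) ≤ N * θ := by
      calc _ ≤ walkE S ((j + 1) * k) (fun u => ∑ 𝔮 ∈ T, (zerosIn c 𝔮).indicator 1 (u * 1)) := by
            refine walkE_mono _ _ fun u => ?_
            by_cases h1 : eval (c u) P = 0
            · obtain ⟨𝔮, h𝔮, hu⟩ := hT2 (c u) (fun p hp => hp u) h1
              replace hu : u ∈ zerosIn c 𝔮 := hu
              rw [Set.indicator_of_mem (by exact h1), mul_one]
              calc (1 : ℝ≥0) = (zerosIn c 𝔮).indicator 1 u := by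
                    rw [Set.indicator_of_mem hu, Pi.one_apply]
                _ ≤ _ := Finset.single_le_sum
                    (f := fun 𝔮 => (zerosIn c 𝔮).indicator (1 : M → ℝ≥0) u)
                    (fun _ _ => zero_le) h𝔮
            · rw [Set.indicator_of_notMem (by exact h1)]
              exact zero_le
        _ = ∑ 𝔮 ∈ T, walkE S ((j + 1) * k) (fun u => (zerosIn c 𝔮).indicator 1 (u * 1)) :=
            walkE_sum _ _ _ _
        _ ≤ ∑ 𝔮 ∈ T, θ := Finset.sum_le_sum fun 𝔮 h𝔮 => by
            have := h n N hn hN1 𝔮 (hT1 𝔮 h𝔮).2.2 ⟨P, (hT1 𝔮 h𝔮).2.1, hPn, hP⟩ k 1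
            rw [← hR, ← hθ] at this
            exact (pow_le_pow_iff_left₀ zero_le zero_le (by positivity)).1 this
        _ ≤ N * θ := by
            rw [Finset.sum_const, nsmul_eq_mul]
            gcongr
    calc _ ≤ (N * θ) ^ p := by gcongr
      _ = (N : ℝ≥0) ^ p * (A * (n * N) ^ e * ρ ^ k) := by rw [mul_pow, hθ]
      _ = _ := by
        rw [hN]
        push_cast
        ring

/-- A random word of linear length avoids exponentially many hypersurfaces of linear degree. -/
theorem exists_prod_eval_ne_zero [IsAlgClosed K] {c : M → σ → K} (hinj : Function.Injective c)
    (hc : TranslatesPolynomials c) [Nontrivial M]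
    (hclosed : ∀ Q : MvPolynomial σ K, IsClosed {u | eval (c u) Q = 0})
    (hirr : ∀ P Q : MvPolynomial σ K, (∀ u, eval (c u) (P * Q) = 0) →
      (∀ u, eval (c u) P = 0) ∨ ∀ u, eval (c u) Q = 0)
    {S : Finset M} (hS : S.Nonempty) {ρ : ℝ≥0} (hρ1 : ρ < 1) (hρ : CollisionBound S ρ) (b : ℕ) :
    ∃ C : ℕ, ∀ n, 1 ≤ n → ∀ F : Finset (MvPolynomial σ K), F.card ≤ b ^ n →
      (∀ P ∈ F, P.totalDegree ≤ n) → (∀ P ∈ F, ∃ u, eval (c u) P ≠ 0) →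
      ∃ l : List M, (∀ a ∈ l, a ∈ S) ∧ l.length = C * n ∧ ∀ P ∈ F, eval (c l.prod) P ≠ 0 := by
  obtain ⟨A, e, p, L, hA, h⟩ := exists_walkE_zero_le hinj hc hclosed hirr hS hρ1 hρ
  set b' : ℝ≥0 := b + 1 with hb'
  obtain ⟨k, hk⟩ : ∃ k : ℕ, b' ^ p * A * 2 ^ e * ρ ^ k < 1 := by
    have := (NNReal.tendsto_pow_atTop_nhds_zero_of_lt_one hρ1).const_mul (b' ^ p * A * 2 ^ e)
    rw [mul_zero] at this
    exact (this.eventually_lt_const zero_lt_one).exists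
  refine ⟨L * k, fun n hn F hF hdeg hne => ?_⟩
  have hn0 : n ≠ 0 := by omega
  have hsmall : ∀ P ∈ F, b' ^ n *
      walkE S (L * (k * n)) ({u | eval (c u) P = 0}.indicator 1) < 1 := by
    intro P hP
    by_contra! hcon
    have h1 := h n hn P (hdeg P hP) (hne P hP) (k * n)
    have h2 : (1 : ℝ≥0) ≤ (b' ^ p * A * 2 ^ e * ρ ^ k) ^ n := by
      calc (1 : ℝ≥0) ≤ (b' ^ n *
            walkE S (L * (k * n)) ({u | eval (c u) P = 0}.indicator 1)) ^ p := one_le_pow₀ hcon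
        _ = b' ^ (n * p) * walkE S (L * (k * n)) ({u | eval (c u) P = 0}.indicator 1) ^ p := by
          rw [mul_pow, ← pow_mul]
        _ ≤ b' ^ (n * p) * (A ^ n * (2 ^ n) ^ e * ρ ^ (k * n)) := by
          gcongr
          refine h1.trans ?_
          gcongr
          · exact le_self_pow₀ hA hn0
          · exact_mod_cast Nat.lt_two_pow_self.le
        _ = _ := by
          simp only [mul_pow, ← pow_mul]
          ring
    exact absurd h2 (not_le.2 (pow_lt_one₀ zero_le hk hn0))
  have hsum : walkE S (L * (k * n))
      (fun u => ∑ P ∈ F, {u | eval (c u) P = 0}.indicator 1 u) < 1 := by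
    rw [walkE_sum]
    rcases F.eq_empty_or_nonempty with rfl | hFne
    · simp
    · have hb0 : 0 < b' ^ n := by positivity
      calc ∑ P ∈ F, walkE S (L * (k * n)) ({u | eval (c u) P = 0}.indicator 1)
          < ∑ P ∈ F, (b' ^ n)⁻¹ := Finset.sum_lt_sum_of_nonempty hFne fun P hP => by
            rw [← mul_one (b' ^ n)⁻¹, lt_inv_mul_iff₀ hb0]
            exact hsmall P hP
        _ ≤ b' ^ n * (b' ^ n)⁻¹ := by
          rw [Finset.sum_const, nsmul_eq_mul]
          gcongr
          calc (F.card : ℝ≥0) ≤ (b : ℝ≥0) ^ n := by exact_mod_cast hF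
            _ ≤ b' ^ n := by
              gcongr
              exact le_self_add
        _ = 1 := mul_inv_cancel₀ hb0.ne'
  obtain ⟨l, hl, hlen, hlt⟩ := exists_of_walkE_lt_one hS hsum
  refine ⟨l, hl, by rw [hlen]; ring, fun P hP h0 => ?_⟩
  refine absurd hlt (not_lt.2 ?_)
  calc (1 : ℝ≥0) = {u | eval (c u) P = 0}.indicator 1 l.prod := by
        rw [Set.indicator_of_mem (by exact h0), Pi.one_apply]
    _ ≤ _ := Finset.single_le_sum
        (f := fun P => {u | eval (c u) P = 0}.indicator (1 : M → ℝ≥0) l.prod)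
        (fun _ _ => zero_le) hP

end SecondMoment

section ZariskiTopology

open MvPolynomial Topology TopologicalSpace

/-- The indices of the entries of an invertible matrix and of its inverse. -/
abbrev EntryIndex (d : ℕ) : Type := Bool × Fin d × Fin d

variable {G : Type} [Group G] {d : ℕ} {K : Type} [Field K] (x : G →* GL (Fin d) K)

/-- The entries of the matrices of `g` and `g⁻¹`. -/
def entries (g : G) : EntryIndex d → K := fun i =>
  (x (cond i.1 g g⁻¹) : Matrix (Fin d) (Fin d) K) i.2.1 i.2.2

/-- The point of the spectrum of the ring of polynomials given by a group element. -/
noncomputable def specPoint (g : G) : PrimeSpectrum (MvPolynomial (EntryIndex d) K) :=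
  ⟨RingHom.ker (eval (entries x g)), RingHom.ker_isPrime _⟩

/-- The Zariski topology of a linear group. -/
noncomputable abbrev zariskiTopology : TopologicalSpace G :=
  TopologicalSpace.induced (specPoint x) inferInstance

theorem isClosed_zariski_iff {Z : Set G} : IsClosed[zariskiTopology x] Z ↔
    ∃ s : Set (MvPolynomial (EntryIndex d) K), Z = {g | ∀ p ∈ s, eval (entries x g) p = 0} := by
  rw [isClosed_induced_iff]
  constructor
  · rintro ⟨t, ht, rfl⟩
    obtain ⟨s, rfl⟩ := (PrimeSpectrum.isClosed_iff_zeroLocus t).1 ht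
    exact ⟨s, rfl⟩
  · rintro ⟨s, rfl⟩
    exact ⟨PrimeSpectrum.zeroLocus s, PrimeSpectrum.isClosed_zeroLocus s, rfl⟩

theorem isClosed_zariski_zeros (Q : MvPolynomial (EntryIndex d) K) :
    IsClosed[zariskiTopology x] {g | eval (entries x g) Q = 0} :=
  (isClosed_zariski_iff x).2 ⟨{Q}, by simp⟩

theorem entries_injective {x : G →* GL (Fin d) K} (hx : Function.Injective x) :
    Function.Injective (entries x) := by
  intro g h hgh
  refine hx (Units.ext ?_)
  ext i j
  exact congrFun hgh (true, i, j)

variable {x}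

theorem eval_bind₁_entries {f : G → G} {q : EntryIndex d → MvPolynomial (EntryIndex d) K}
    (hq : ∀ u i, eval (entries x u) (q i) = entries x (f u) i) (Q : MvPolynomial (EntryIndex d) K)
    (u : G) : eval (entries x u) (bind₁ q Q) = eval (entries x (f u)) Q := by
  rw [← coe_aeval_eq_eval, ← coe_aeval_eq_eval]
  simp only [RingHom.coe_coe]
  rw [aeval_bind₁]
  congr 2
  funext i
  rw [← hq]
  rfl

theorem continuous_zariski {f : G → G} (q : EntryIndex d → MvPolynomial (EntryIndex d) K)
    (hq : ∀ u i, eval (entries x u) (q i) = entries x (f u) i) :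
    Continuous[zariskiTopology x, zariskiTopology x] f := by
  let _ := zariskiTopology x
  rw [continuous_iff_isClosed]
  intro Z hZ
  obtain ⟨s, rfl⟩ := (isClosed_zariski_iff x).1 hZ
  refine (isClosed_zariski_iff x).2 ⟨bind₁ q '' s, ?_⟩
  ext u
  simp [eval_bind₁_entries hq]

/-- The polynomials expressing the entries of `u * h` in terms of those of `u`. -/
noncomputable def mulRightPoly (x : G →* GL (Fin d) K) (h : G) :
    EntryIndex d → MvPolynomial (EntryIndex d) K := fun i =>
  if i.1 then ∑ l, X (true, i.2.1, l) * C ((x h : Matrix (Fin d) (Fin d) K) l i.2.2)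
  else ∑ l, C ((x h⁻¹ : Matrix (Fin d) (Fin d) K) i.2.1 l) * X (false, l, i.2.2)

theorem eval_mulRightPoly (h u : G) (i : EntryIndex d) :
    eval (entries x u) (mulRightPoly x h i) = entries x (u * h) i := by
  obtain ⟨b, i, j⟩ := i
  cases b <;> simp [mulRightPoly, entries, Matrix.mul_apply]

theorem totalDegree_mulRightPoly (h : G) (i : EntryIndex d) :
    (mulRightPoly x h i).totalDegree ≤ 1 := by
  obtain ⟨b, i, j⟩ := i
  have hX : ∀ l, (X l : MvPolynomial (EntryIndex d) K).totalDegree = 1 := totalDegree_X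
  cases b <;> simp only [mulRightPoly, if_true, Bool.false_eq_true, if_false] <;>
    refine totalDegree_finsetSum_le fun l _ => (totalDegree_mul _ _).trans ?_ <;>
    simp [hX]

theorem totalDegree_bind₁_le {σ : Type*} {q : σ → MvPolynomial σ K}
    (hq : ∀ i, (q i).totalDegree ≤ 1) (Q : MvPolynomial σ K) :
    (bind₁ q Q).totalDegree ≤ Q.totalDegree := by
  rw [bind₁, aeval_def, eval₂_eq]
  refine totalDegree_finsetSum_le fun s hs => (totalDegree_mul _ _).trans ?_
  rw [algebraMap_eq, totalDegree_C, zero_add]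
  refine (totalDegree_finsetProd _ _).trans ((Finset.sum_le_sum fun i _ =>
    (totalDegree_pow _ _).trans (Nat.mul_le_mul_left _ (hq i))).trans ?_)
  simp only [mul_one]
  exact le_totalDegree hs

theorem translatesPolynomials_entries (x : G →* GL (Fin d) K) :
    TranslatesPolynomials (entries x) := fun h Q =>
  ⟨bind₁ (mulRightPoly x h) Q, totalDegree_bind₁_le (totalDegree_mulRightPoly h) Q,
    eval_bind₁_entries (eval_mulRightPoly h) Q⟩

theorem continuous_zariski_inv (x : G →* GL (Fin d) K) :
    Continuous[zariskiTopology x, zariskiTopology x] fun g : G => g⁻¹ := by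
  refine continuous_zariski (fun i => X (!i.1, i.2.1, i.2.2)) fun u i => ?_
  obtain ⟨b, i, j⟩ := i
  cases b <;> simp [entries]

theorem zariskiGroup (hx : Function.Injective x) : @ZariskiGroup G _ (zariskiTopology x) := by
  let _ := zariskiTopology x
  have hind : IsInducing (specPoint x) := ⟨rfl⟩
  have hright : ∀ h : G, Continuous (· * h) := fun h => continuous_zariski _ (eval_mulRightPoly h)
  have hinv : Continuous fun g : G => g⁻¹ := continuous_zariski_inv x
  refine ⟨⟨fun g => ?_⟩, hind.noetherianSpace, fun g => ?_, hright, hinv, fun c => ?_, ?_⟩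
  · refine (isClosed_zariski_iff x).2 ⟨Set.range fun i => X i - C (entries x g i), ?_⟩
    ext u
    rw [Set.mem_singleton_iff, ← (entries_injective hx).eq_iff, funext_iff]
    simp only [Set.mem_ofPred_eq, Set.forall_mem_range, map_sub, eval_X, eval_C, sub_eq_zero]
  · have := hinv.comp ((hright g⁻¹).comp hinv)
    convert this using 2 with u
    simp
  · refine continuous_zariski (fun i => ∑ l, ∑ m, X (true, i.2.1, l) *
      C ((x (cond i.1 c c⁻¹) : Matrix (Fin d) (Fin d) K) l m) * X (false, m, i.2.2)) fun u i => ?_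
    obtain ⟨b, i, j⟩ := i
    have : cond b (u * c * u⁻¹) (u * c * u⁻¹)⁻¹ = u * cond b c c⁻¹ * u⁻¹ := by
      cases b <;> simp [mul_assoc]
    simp only [entries, this, map_sum, map_mul, eval_X, eval_C, Units.val_mul, Matrix.mul_apply,
      Finset.sum_mul, cond_true, cond_false]
    rw [Finset.sum_comm]
  · refine ⟨Fintype.card (EntryIndex d), hind.topologicalKrullDim_le.trans ?_⟩
    rw [PrimeSpectrum.topologicalKrullDim_eq_ringKrullDim,
      MvPolynomial.ringKrullDim_of_isNoetherianRing, ringKrullDim_eq_zero_of_field, zero_add]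
    simp

end ZariskiTopology

section DominatedSplitting

open Polynomial Module

variable {K V : Type*} [Field K] [AddCommGroup V] [Module K V] [FiniteDimensional K V]
  (v : AbsoluteValue K ℝ)

/-- The `ℓ¹`-norm of a vector with respect to a fixed basis and an absolute value. -/
noncomputable def absNorm (x : V) : ℝ := ∑ i, v ((finBasis K V).repr x i)

theorem absNorm_nonneg (x : V) : 0 ≤ absNorm v x :=
  Finset.sum_nonneg fun _ _ => v.nonneg _

theorem absNorm_add_le (x y : V) : absNorm v (x + y) ≤ absNorm v x + absNorm v y := by
  simp only [absNorm, ← Finset.sum_add_distrib, map_add, Finsupp.add_apply]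
  exact Finset.sum_le_sum fun _ _ => v.add_le _ _

@[simp] theorem absNorm_zero : absNorm v (0 : V) = 0 := by simp [absNorm]

theorem absNorm_smul (c : K) (x : V) : absNorm v (c • x) = v c * absNorm v x := by
  simp [absNorm, Finset.mul_sum]

theorem absNorm_sum_le {ι : Type*} (s : Finset ι) (f : ι → V) :
    absNorm v (∑ i ∈ s, f i) ≤ ∑ i ∈ s, absNorm v (f i) :=
  Finset.le_sum_of_subadditive _ (absNorm_zero v).le (absNorm_add_le v) s f

theorem absNorm_pos {x : V} (hx : x ≠ 0) : 0 < absNorm v x := by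
  refine lt_of_le_of_ne (absNorm_nonneg v x) fun h => hx ?_
  have := (Finset.sum_eq_zero_iff_of_nonneg fun i _ => v.nonneg _).1 h.symm
  refine (finBasis K V).repr.map_eq_zero_iff.1 (Finsupp.ext fun i => ?_)
  exact v.eq_zero.1 (this i (Finset.mem_univ i))

theorem exists_absNorm_apply_le (T : End K V) :
    ∃ C : ℝ, 0 < C ∧ ∀ x, absNorm v (T x) ≤ C * absNorm v x := by
  refine ⟨1 + ∑ i, absNorm v (T (finBasis K V i)), ?_, fun x => ?_⟩
  · have := Finset.sum_nonneg fun i (_ : i ∈ Finset.univ) =>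
      absNorm_nonneg v (T (finBasis K V i))
    linarith
  conv_lhs => rw [← (finBasis K V).sum_repr x, map_sum]
  refine (absNorm_sum_le v _ _).trans ?_
  rw [absNorm, Finset.mul_sum]
  refine Finset.sum_le_sum fun i _ => ?_
  rw [map_smul, absNorm_smul, mul_comm]
  refine mul_le_mul_of_nonneg_right ?_ (v.nonneg _)
  have := Finset.single_le_sum (f := fun i => absNorm v (T (finBasis K V i)))
    (fun i _ => absNorm_nonneg v _) (Finset.mem_univ i)
  linarith

theorem exists_absNorm_pow_le (T : End K V) {R : ℝ} (hR : 0 < R) (s : Multiset K)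
    (hs : ∀ a ∈ s, v a < R) :
    ∃ C : ℝ, 0 < C ∧ ∀ k w, aeval T (s.map fun a => X - Polynomial.C a).prod w = 0 →
      absNorm v ((T ^ k) w) ≤ C * R ^ k * absNorm v w := by
  induction s using Multiset.induction with
  | empty =>
    refine ⟨1, one_pos, fun k w hw => ?_⟩
    have : w = 0 := by simpa using hw
    simp [this]
  | cons a s ih =>
    obtain ⟨C, hC, h⟩ := ih fun b hb => hs b (Multiset.mem_cons_of_mem hb)
    obtain ⟨C', hC', h'⟩ := exists_absNorm_apply_le v (T - algebraMap K (End K V) a)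
    have ha : 0 < R - v a := sub_pos.2 (hs a (Multiset.mem_cons_self a s))
    set D := max 1 (C * C' / (R - v a)) with hD
    have hD0 : 0 < D := lt_of_lt_of_le one_pos (le_max_left _ _)
    have hD1 : C * C' ≤ D * (R - v a) := (div_le_iff₀ ha).1 (le_max_right _ _)
    refine ⟨D, hD0, fun k w hw => ?_⟩
    have hu : aeval T (s.map fun a => X - Polynomial.C a).prod
        ((T - algebraMap K (End K V) a) w) = 0 := by
      rw [Multiset.map_cons, Multiset.prod_cons, mul_comm, map_mul] at hw
      simpa using hw
    induction k with
    | zero =>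
      have : 1 ≤ D := le_max_left _ _
      simpa using le_mul_of_one_le_left (absNorm_nonneg v w) this
    | succ k ihk =>
      have e : (T ^ (k + 1)) w = (T ^ k) ((T - algebraMap K (End K V) a) w) + a • (T ^ k) w := by
        simp [pow_succ, Module.algebraMap_end_apply]
      have hRk : 0 < R ^ k := pow_pos hR k
      rw [e]
      refine (absNorm_add_le v _ _).trans ?_
      rw [absNorm_smul]
      have h1 : absNorm v ((T ^ k) ((T - algebraMap K (End K V) a) w)) ≤
          C * R ^ k * (C' * absNorm v w) :=
        (h k _ hu).trans (mul_le_mul_of_nonneg_left (h' w) (by positivity))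
      have h2 := mul_le_mul_of_nonneg_left ihk (v.nonneg a)
      have h3 := mul_le_mul_of_nonneg_right hD1
        (mul_nonneg hRk.le (absNorm_nonneg v w))
      calc _ ≤ C * R ^ k * (C' * absNorm v w) + v a * (D * R ^ k * absNorm v w) :=
            add_le_add h1 h2
        _ ≤ D * R ^ (k + 1) * absNorm v w := by rw [pow_succ]; linarith

omit [FiniteDimensional K V] in
theorem aeval_inv_apply_eq_zero {T T' : End K V} (hT : T' * T = 1) (s : Multiset K)
    (hs : ∀ a ∈ s, a ≠ 0) (w : V) (hw : aeval T (s.map fun a => X - Polynomial.C a).prod w = 0) :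
    aeval T' ((s.map fun a => a⁻¹).map fun a => X - Polynomial.C a).prod w = 0 := by
  induction s using Multiset.induction generalizing w with
  | empty => simpa using hw
  | cons a s ih =>
    have hu : aeval T (s.map fun a => X - Polynomial.C a).prod
        ((T - algebraMap K (End K V) a) w) = 0 := by
      rw [Multiset.map_cons, Multiset.prod_cons, mul_comm, map_mul] at hw
      simpa using hw
    have h := ih (fun b hb => hs b (Multiset.mem_cons_of_mem hb)) _ hu
    have ha : a ≠ 0 := hs a (Multiset.mem_cons_self a s)
    have e : T' - algebraMap K (End K V) a⁻¹ =
        (aeval T' (Polynomial.C (-a⁻¹) * X)) * (T - algebraMap K (End K V) a) := by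
      have : T' * algebraMap K (End K V) a = algebraMap K (End K V) a * T' :=
        (Algebra.commutes a T').symm
      simp only [map_mul, aeval_C, aeval_X, mul_assoc, mul_sub, hT, this]
      simp [← mul_assoc, ← map_mul, ha]
      abel
    rw [Multiset.map_cons, Multiset.map_cons, Multiset.prod_cons, mul_comm, map_mul]
    have : aeval T' (X - Polynomial.C a⁻¹) = T' - algebraMap K (End K V) a⁻¹ := by simp
    rw [this, e, ← mul_assoc, ← map_mul, mul_comm _ (Polynomial.C (-a⁻¹) * X), map_mul,
      mul_assoc, Module.End.mul_apply, Module.End.mul_apply, h, map_zero]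

theorem exists_dominated_splitting [IsAlgClosed K] {T T' : End K V} (hT : T' * T = 1)
    {l m : K} (hl : T.HasEigenvalue l) (hm : T.HasEigenvalue m) (hlm : v l < v m) :
    ∃ A B : End K V, A + B = 1 ∧ A ≠ 0 ∧ B ≠ 0 ∧ ∀ ε : ℝ, 0 < ε → ∃ k : ℕ, ∀ x ≠ 0,
      ε * absNorm v (B x) ≤ absNorm v (A x) →
        absNorm v (B ((T' ^ k) x)) < ε * absNorm v (A ((T' ^ k) x)) := by
  classical
  have hT2 : T * T' = 1 := mul_eq_one_comm.1 hT
  set r := v l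
  set sA := T.charpoly.roots.filter fun a => v a ≤ r with hsA
  set sB := T.charpoly.roots.filter fun a => ¬ v a ≤ r with hsB
  set pA := (sA.map fun a => X - Polynomial.C a).prod with hpA
  set pB := (sB.map fun a => X - Polynomial.C a).prod with hpB
  have hprod : pA * pB = T.charpoly := by
    rw [hpA, hpB, ← Multiset.prod_add, ← Multiset.map_add, Multiset.filter_add_not]
    have := (IsAlgClosed.splits T.charpoly).eq_prod_roots
    rw [T.charpoly_monic.leadingCoeff, map_one, one_mul] at this
    exact this.symm
  have hzA : ∀ x, pA.eval x = 0 → v x ≤ r := by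
    intro x hx
    rw [hpA, eval_multiset_prod, Multiset.prod_eq_zero_iff] at hx
    simp only [Multiset.map_map, Multiset.mem_map] at hx
    obtain ⟨a, ha, hax⟩ := hx
    have : x = a := by simpa [sub_eq_zero] using hax
    exact this ▸ (Multiset.mem_filter.1 ha).2
  have hzB : ∀ x, pB.eval x = 0 → ¬ v x ≤ r := by
    intro x hx
    rw [hpB, eval_multiset_prod, Multiset.prod_eq_zero_iff] at hx
    simp only [Multiset.map_map, Multiset.mem_map] at hx
    obtain ⟨a, ha, hax⟩ := hx
    have : x = a := by simpa [sub_eq_zero] using hax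
    exact this ▸ (Multiset.mem_filter.1 ha).2
  have hcop : IsCoprime pA pB := by
    rw [isCoprime_iff_aeval_ne_zero_of_isAlgClosed K K]
    intro x
    by_contra! h
    simp only [coe_aeval_eq_eval] at h
    exact hzB x h.2 (hzA x h.1)
  obtain ⟨u, w, huw⟩ := hcop
  set A := aeval T (w * pB) with hA
  set B := aeval T (u * pA) with hB
  have hAB : A + B = 1 := by rw [hA, hB, ← map_add, add_comm, huw, map_one]
  have hkA : ∀ x, aeval T pA (A x) = 0 := by
    intro x
    rw [← Module.End.mul_apply, hA, ← map_mul, mul_left_comm, hprod, map_mul,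
      LinearMap.aeval_self_charpoly, mul_zero, LinearMap.zero_apply]
  have hkB : ∀ x, aeval T pB (B x) = 0 := by
    intro x
    rw [← Module.End.mul_apply, hB, ← map_mul, mul_left_comm, mul_comm pB, hprod, map_mul,
      LinearMap.aeval_self_charpoly, mul_zero, LinearMap.zero_apply]
  have heig : ∀ {y : K}, T.HasEigenvalue y → ∀ {p : K[X]}, aeval T p = 0 → p.eval y = 0 := by
    intro y hy p hp
    obtain ⟨e, he⟩ := hy.exists_hasEigenvector
    have := Module.End.aeval_apply_of_hasEigenvector (p := p) he
    rw [hp, LinearMap.zero_apply] at this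
    exact (smul_eq_zero.1 this.symm).resolve_right he.2
  have hA0 : A ≠ 0 := by
    intro h
    rw [h, zero_add] at hAB
    refine hzB l (heig hl ?_) le_rfl
    exact LinearMap.ext fun x => by simpa [hAB] using hkB x
  have hB0 : B ≠ 0 := by
    intro h
    rw [h, add_zero] at hAB
    refine (hzA m (heig hm ?_)).not_gt hlm
    exact LinearMap.ext fun x => by simpa [hAB] using hkA x
  have hcomA : ∀ k x, A ((T' ^ k) x) = (T' ^ k) (A x) := by
    have h1 : Commute A T' := by
      have h2 : A * T = T * A :=
        (Algebra.commute_of_mem_adjoin_self (aeval_mem_adjoin_singleton K T)).eq.symm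
      calc A * T' = T' * T * A * T' := by rw [hT, one_mul]
        _ = T' * (A * T) * T' := by rw [h2]; simp only [mul_assoc]
        _ = T' * A := by rw [mul_assoc, mul_assoc, hT2, mul_one]
    exact fun k x => LinearMap.congr_fun (h1.pow_right k).eq x
  have hcomB : ∀ k x, B ((T' ^ k) x) = (T' ^ k) (B x) := by
    intro k x
    have : B = 1 - A := by rw [← hAB]; abel
    simp [this, hcomA]
  obtain ⟨R, hrR, hRB⟩ : ∃ R, r < R ∧ ∀ b ∈ sB, R < v b := by
    have h1 : ∀ᶠ R in nhdsWithin r (Set.Ioi r), ∀ b ∈ sB.toFinset, R < v b := by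
      rw [Filter.eventually_all_finset]
      intro b hb
      have : r < v b := not_le.1 (Multiset.mem_filter.1 (Multiset.mem_toFinset.1 hb)).2
      exact (eventually_lt_nhds this).filter_mono nhdsWithin_le_nhds
    obtain ⟨R, h, hR⟩ := (h1.and self_mem_nhdsWithin).exists
    exact ⟨R, hR, fun b hb => h b (Multiset.mem_toFinset.2 hb)⟩
  obtain ⟨R', hRR', hRB'⟩ : ∃ R', R < R' ∧ ∀ b ∈ sB, R' < v b := by
    have h1 : ∀ᶠ R' in nhdsWithin R (Set.Ioi R), ∀ b ∈ sB.toFinset, R' < v b := by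
      rw [Filter.eventually_all_finset]
      intro b hb
      exact (eventually_lt_nhds (hRB b (Multiset.mem_toFinset.1 hb))).filter_mono
        nhdsWithin_le_nhds
    obtain ⟨R', h, hR⟩ := (h1.and self_mem_nhdsWithin).exists
    exact ⟨R', hR, fun b hb => h b (Multiset.mem_toFinset.2 hb)⟩
  have hR0 : 0 < R := (v.nonneg l).trans_lt hrR
  have hR0' : 0 < R' := hR0.trans hRR'
  obtain ⟨C, hC, hCA⟩ := exists_absNorm_pow_le v T hR0 sA
    fun a ha => (Multiset.mem_filter.1 ha).2.trans_lt hrR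
  have hB0' : ∀ a ∈ sB, a ≠ 0 := by
    rintro a ha rfl
    have := hRB' _ ha
    rw [map_zero] at this
    linarith
  obtain ⟨C', hC', hCB⟩ := exists_absNorm_pow_le v T' (inv_pos.2 hR0') (sB.map fun a => a⁻¹) (by
    intro a ha
    obtain ⟨b, hb, rfl⟩ := Multiset.mem_map.1 ha
    rw [map_inv₀]
    exact inv_strictAnti₀ hR0' (hRB' b hb))
  refine ⟨A, B, hAB, hA0, hB0, fun ε hε => ?_⟩
  have hq : R / R' < 1 := (div_lt_one hR0').2 hRR'
  obtain ⟨k, hk⟩ := exists_pow_lt_of_lt_one (show 0 < ε * ε / (C * C') by positivity) hq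
  refine ⟨k, fun x hx hU => ?_⟩
  have hTk : ∀ y, (T ^ k) ((T' ^ k) y) = y := by
    intro y
    have : Commute T T' := by rw [Commute, SemiconjBy, hT, hT2]
    rw [← Module.End.mul_apply, ← this.mul_pow, hT2, one_pow, Module.End.one_apply]
  have hAx : A x ≠ 0 := by
    intro h
    rw [h, absNorm_zero] at hU
    have hBx : B x = 0 := by
      by_contra hne
      nlinarith [absNorm_pos v hne]
    apply hx
    have := LinearMap.congr_fun hAB x
    simpa [h, hBx] using this.symm
  have hne : A ((T' ^ k) x) ≠ 0 := by
    intro h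
    rw [hcomA] at h
    exact hAx (by rw [← hTk (A x), h, map_zero])
  have h1 := hCB k (B x) (aeval_inv_apply_eq_zero hT sB hB0' _ (hkB x))
  have h2 := hCA k (A ((T' ^ k) x)) (hkA _)
  rw [hcomA, hTk, ← hcomA] at h2
  rw [hcomB]
  have hpos := absNorm_pos v hne
  set α := absNorm v (A ((T' ^ k) x))
  set β := absNorm v (B x)
  have h3 : ε * β ≤ C * R ^ k * α := hU.trans h2
  rw [div_pow, div_lt_div_iff₀ (by positivity) (by positivity)] at hk
  refine h1.trans_lt ?_
  rw [inv_pow, ← div_eq_mul_inv, div_mul_eq_mul_div, div_lt_iff₀ (by positivity)]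
  have h4 := mul_le_mul_of_nonneg_left h3 hC'.le
  have h5 := mul_lt_mul_of_pos_right hk hpos
  refine lt_of_mul_lt_mul_left ?_ hε.le
  linarith

end DominatedSplitting

section PingPong

open Module ENNReal NNReal MulAction

/-- An algebra of functions behaving like the coordinate ring of an irreducible affine group
defined over a finitely generated ring. -/
structure IsRegularAlgebra {M K : Type*} [Group M] [Field K] (𝓐 : Subalgebra K (M → K)) :
    Prop where
  eq_zero_or : ∀ f ∈ 𝓐, ∀ g ∈ 𝓐, f * g = 0 → f = 0 ∨ g = 0
  exists_adjoin : ∀ f ∈ 𝓐, ∃ s : Finset K, ∀ u, f u ∈ Algebra.adjoin ℤ (s : Set K)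
  comp_inv : ∀ f ∈ 𝓐, (fun u => f u⁻¹) ∈ 𝓐
  comp_mul_right : ∀ f ∈ 𝓐, ∀ h, (fun u => f (u * h)) ∈ 𝓐

/-- A representation all of whose matrix coefficients are regular. -/
def IsRegularRep {M K V : Type*} [Group M] [Field K] [AddCommGroup V] [Module K V]
    (𝓐 : Subalgebra K (M → K)) (ρ : M →* End K V) : Prop :=
  ∀ (φ : Dual K V) (w : V), (fun g => φ (ρ g w)) ∈ 𝓐

/-- Irreducibility of a representation. -/
def IsIrredRep {M K V : Type*} [Group M] [Field K] [AddCommGroup V] [Module K V]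
    (ρ : M →* End K V) : Prop :=
  Nontrivial V ∧ ∀ W : Submodule K V, (∀ g, ∀ w ∈ W, ρ g w ∈ W) → W = ⊥ ∨ W = ⊤

theorem IsRegularAlgebra.exists_forall_ne_zero {M K : Type*} [Group M] [Field K]
    {𝓐 : Subalgebra K (M → K)} (h𝓐 : IsRegularAlgebra 𝓐) {ι : Type*} (s : Finset ι)
    (f : ι → M → K) (hf : ∀ i ∈ s, f i ∈ 𝓐) (h0 : ∀ i ∈ s, f i ≠ 0) :
    ∃ u, ∀ i ∈ s, f i u ≠ 0 := by
  classical
  have h : ∏ i ∈ s, f i ∈ 𝓐 ∧ ∏ i ∈ s, f i ≠ 0 := by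
    induction s using Finset.induction with
    | empty => exact ⟨by simp, by simp⟩
    | insert a s ha ih =>
      obtain ⟨h1, h2⟩ := ih (fun i hi => hf i (Finset.mem_insert_of_mem hi))
        fun i hi => h0 i (Finset.mem_insert_of_mem hi)
      have h3 := hf a (Finset.mem_insert_self a s)
      rw [Finset.prod_insert ha]
      exact ⟨mul_mem h3 h1, fun h => (h𝓐.eq_zero_or _ h3 _ h1 h).elim
        (h0 a (Finset.mem_insert_self a s)) h2⟩
  obtain ⟨u, hu⟩ := Function.ne_iff.1 h.2
  refine ⟨u, fun i hi => ?_⟩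
  rw [Finset.prod_apply] at hu
  exact Finset.prod_ne_zero_iff.1 hu i hi

variable {M : Type} [Group M] {K V : Type*} [Field K] [AddCommGroup V] [Module K V]

theorem IsIrredRep.exists_apply_ne_zero {ρ : M →* End K V} (hρ : IsIrredRep ρ) {A : End K V}
    (hA : A ≠ 0) {w : V} (hw : w ≠ 0) : ∃ g, A (ρ g w) ≠ 0 := by
  by_contra! h
  have := hρ.2 (Submodule.span K (Set.range fun g => ρ g w)) (by
    intro g x hx
    induction hx using Submodule.span_induction with
    | mem x hx =>
      obtain ⟨g', rfl⟩ := hx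
      exact Submodule.subset_span ⟨g * g', by simp⟩
    | zero => simp
    | add x y _ _ hx hy => rw [map_add]; exact add_mem hx hy
    | smul c x _ hx => rw [map_smul]; exact Submodule.smul_mem _ c hx)
  rcases this with h1 | h1
  · have : ρ 1 w ∈ Submodule.span K (Set.range fun g => ρ g w) :=
      Submodule.subset_span ⟨1, rfl⟩
    rw [h1] at this
    exact hw (by simpa using this)
  · refine hA (LinearMap.ext fun x => ?_)
    have hx : x ∈ Submodule.span K (Set.range fun g => ρ g w) := by rw [h1]; trivial
    have hle : Submodule.span K (Set.range fun g => ρ g w) ≤ LinearMap.ker A := by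
      rw [Submodule.span_le]
      rintro _ ⟨g, rfl⟩
      exact h g
    exact hle hx

variable [FiniteDimensional K V]

theorem exists_transversal {𝓐 : Subalgebra K (M → K)} (h𝓐 : IsRegularAlgebra 𝓐)
    {ρ : M →* End K V} (hreg : IsRegularRep 𝓐 ρ) (hρ : IsIrredRep ρ) (P : Bool → End K V)
    (hP : ∀ b, P b ≠ 0) (m : ℕ) :
    ∃ l : Finset M, ∀ c : M → Bool,
      finrank K ↥(⨅ k : l, LinearMap.ker (P (c k) * ρ k)) ≤ finrank K V - m := by
  classical
  induction m with
  | zero => exact ⟨∅, fun c => Submodule.finrank_le _⟩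
  | succ m ih =>
    obtain ⟨l, hl⟩ := ih
    set W : (l → Bool) → Submodule K V := fun c => ⨅ k : l, LinearMap.ker (P (c k) * ρ k)
    obtain ⟨k, hk⟩ : ∃ k : M, ∀ c b, W c ≠ ⊥ → ¬ W c ≤ LinearMap.ker (P b * ρ k) := by
      have h1 : ∀ c b, W c ≠ ⊥ → ∃ (φ : Dual K V) (w : V), w ∈ W c ∧
          (fun g => φ (P b (ρ g w))) ≠ 0 := by
        intro c b hc
        obtain ⟨w, hw, hw0⟩ := Submodule.exists_mem_ne_zero_of_ne_bot hc
        obtain ⟨g, hg⟩ := hρ.exists_apply_ne_zero (hP b) hw0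
        by_contra! hcon
        refine hg ((Module.forall_dual_apply_eq_zero_iff K _).1 fun φ => ?_)
        exact congrFun (hcon φ w hw) g
      choose! φ w hw hφ using h1
      obtain ⟨k, hk⟩ := h𝓐.exists_forall_ne_zero
        (Finset.univ.filter fun p : (l → Bool) × Bool => W p.1 ≠ ⊥)
        (fun p g => φ p.1 p.2 (P p.2 (ρ g (w p.1 p.2))))
        (fun p _ => hreg ((φ p.1 p.2).comp (P p.2)) _)
        (fun p hp => hφ _ _ (Finset.mem_filter.1 hp).2)
      refine ⟨k, fun c b hc hle => hk (c, b) (by simpa using hc) ?_⟩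
      have : P b (ρ k (w c b)) = 0 := hle (hw c b hc)
      simp [this]
    refine ⟨insert k l, fun c => ?_⟩
    have h2 := hl c
    have hle : (⨅ j : ↥(insert k l), LinearMap.ker (P (c j) * ρ j)) ≤
        W (fun j => c j) ⊓ LinearMap.ker (P (c k) * ρ k) :=
      le_inf (le_iInf fun j => iInf_le_of_le ⟨j, Finset.mem_insert_of_mem j.2⟩ le_rfl)
        (iInf_le_of_le ⟨k, Finset.mem_insert_self k l⟩ le_rfl)
    refine (Submodule.finrank_mono hle).trans ?_
    by_cases hb : W (fun j => c j) = ⊥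
    · rw [hb, bot_inf_eq, finrank_bot]; exact Nat.zero_le _
    · have hlt := Submodule.finrank_lt_finrank_of_lt
        (lt_of_le_of_ne inf_le_left fun h => hk _ (c k) hb (inf_eq_left.1 h))
      have : finrank K ↥(W fun j => c j) ≤ finrank K V - m := h2
      omega

theorem exists_covering {𝓐 : Subalgebra K (M → K)} (h𝓐 : IsRegularAlgebra 𝓐)
    {ρ : M →* End K V} (hreg : IsRegularRep 𝓐 ρ) (hρ : IsIrredRep ρ) (v : AbsoluteValue K ℝ)
    {A B : End K V} (hA : A ≠ 0) (hB : B ≠ 0) :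
    ∃ (l : Finset M) (ε : ℝ), 0 < ε ∧ ε ≤ 1 ∧ ∀ x ≠ 0, ∃ k ∈ l,
      ε * absNorm v (B (ρ k x)) ≤ absNorm v (A (ρ k x)) ∧
      ε * absNorm v (A (ρ k x)) ≤ absNorm v (B (ρ k x)) := by
  classical
  set P : Bool → End K V := fun b => if b then A else B with hPdef
  obtain ⟨l, hl⟩ := exists_transversal h𝓐 hreg hρ P (by rintro (_ | _) <;> simp [P, hA, hB])
    (finrank K V)
  have h1 : ∀ c : l → Bool, ∃ C : ℝ, 0 < C ∧ ∀ x,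
      absNorm v x ≤ C * ∑ k : l, absNorm v (P (c k) (ρ k x)) := by
    intro c
    have hc := hl fun k => if h : k ∈ l then c ⟨k, h⟩ else true
    simp only [Finset.coe_mem, dite_true, Subtype.coe_eta, Nat.sub_self, Nat.le_zero,
      Submodule.finrank_eq_zero] at hc
    set Φ : V →ₗ[K] (l → V) := LinearMap.pi fun k : l => P (c k) * ρ k
    have hΦ : LinearMap.ker Φ = ⊥ := by rw [LinearMap.ker_pi]; exact hc
    obtain ⟨L, hL⟩ := Φ.exists_leftInverse_of_injective hΦ
    choose D hD0 hD using fun k : l =>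
      exists_absNorm_apply_le v (L ∘ₗ LinearMap.single K (fun _ : l => V) k)
    refine ⟨1 + ∑ k, D k, by have := Finset.sum_nonneg fun k (_ : k ∈ Finset.univ) => (hD0 k).le; linarith, fun x => ?_⟩
    have hx : x = ∑ k : l, (L ∘ₗ LinearMap.single K (fun _ : l => V) k) (P (c k) (ρ k x)) := by
      conv_lhs => rw [← LinearMap.id_apply (R := K) x, ← hL, LinearMap.comp_apply]
      simp only [LinearMap.comp_apply, ← map_sum]
      congr 1
      exact (Finset.univ_sum_single (Φ x)).symm
    conv_lhs => rw [hx]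
    refine (absNorm_sum_le v _ _).trans ?_
    rw [Finset.mul_sum]
    refine Finset.sum_le_sum fun k _ => (hD k _).trans ?_
    refine mul_le_mul_of_nonneg_right ?_ (absNorm_nonneg v _)
    have := Finset.single_le_sum (f := D) (fun k _ => (hD0 k).le) (Finset.mem_univ k)
    linarith
  choose C hC0 hC using h1
  choose D hD0 hD using fun p : l × Bool => exists_absNorm_apply_le v (P p.2 * ρ p.1)
  set c₀ := 1 + ∑ c, C c
  set d₀ := 1 + ∑ p, D p
  have hc₁ : 1 ≤ c₀ := by
    have := Finset.sum_nonneg fun k (_ : k ∈ Finset.univ) => (hC0 k).le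
    simp only [c₀]; linarith
  have hd₁ : 1 ≤ d₀ := by
    have := Finset.sum_nonneg fun k (_ : k ∈ Finset.univ) => (hD0 k).le
    simp only [d₀]; linarith
  have hc₀ : 0 < c₀ := by linarith
  have hd₀ : 0 < d₀ := by linarith
  have hCc : ∀ c, C c ≤ c₀ := fun c => by
    have := Finset.single_le_sum (f := C) (fun k _ => (hC0 k).le) (Finset.mem_univ c)
    simp only [c₀]; linarith
  have hDd : ∀ c, D c ≤ d₀ := fun c => by
    have := Finset.single_le_sum (f := D) (fun k _ => (hD0 k).le) (Finset.mem_univ c)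
    simp only [d₀]; linarith
  refine ⟨l, (c₀ * d₀ * (l.card + 1))⁻¹, by positivity,
    inv_le_one_of_one_le₀ (one_le_mul_of_one_le_of_one_le
      (one_le_mul_of_one_le_of_one_le hc₁ hd₁) (by simp)), fun x hx => ?_⟩
  set ε := (c₀ * d₀ * (l.card + 1))⁻¹ with hε
  have hε0 : 0 < ε := by positivity
  have hε1 : c₀ * d₀ * (l.card + 1) * ε = 1 := mul_inv_cancel₀ (by positivity)
  by_contra! hcon
  have h2 : ∀ k : l, ∃ b : Bool, absNorm v (P b (ρ k x)) ≤ ε * (d₀ * absNorm v x) := by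
    intro k
    have hle : ∀ b : Bool, absNorm v (P b (ρ k x)) ≤ d₀ * absNorm v x := fun b =>
      (hD (k, b) x).trans (mul_le_mul_of_nonneg_right (hDd _) (absNorm_nonneg v x))
    by_cases h : ε * absNorm v (B (ρ k x)) ≤ absNorm v (A (ρ k x))
    · refine ⟨false, ?_⟩
      have := hcon k k.2 h
      have h3 := mul_le_mul_of_nonneg_left (hle true) hε0.le
      simp only [P, if_true, Bool.false_eq_true, if_false] at h3 ⊢
      linarith
    · refine ⟨true, ?_⟩
      have h3 := mul_le_mul_of_nonneg_left (hle false) hε0.le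
      simp only [P, if_true, Bool.false_eq_true, if_false] at h3 ⊢
      linarith
  choose c hc using h2
  have h3 := hC c x
  have h4 : ∑ k : l, absNorm v (P (c k) (ρ k x)) ≤ l.card * (ε * (d₀ * absNorm v x)) := by
    refine (Finset.sum_le_sum fun k _ => hc k).trans ?_
    simp
  have hpos := absNorm_pos v hx
  have h5 : C c * ∑ k : l, absNorm v (P (c k) (ρ k x)) ≤
      c₀ * (l.card * (ε * (d₀ * absNorm v x))) :=
    mul_le_mul (hCc c) h4 (Finset.sum_nonneg fun _ _ => absNorm_nonneg v _) hc₀.le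
  have h6 : 0 < c₀ * d₀ * ε * absNorm v x := by positivity
  have h7 : c₀ * d₀ * (l.card + 1) * ε * absNorm v x = absNorm v x := by rw [hε1, one_mul]
  nlinarith

theorem tsum_diff_le {Ω : Type} [MulAction M Ω] {f : Ω → ℝ≥0∞} (hf : ∑' x, f x ≠ ∞) (t : M)
    {U U' : Set Ω} (hU : U' ⊆ U) (ht : ∀ x ∈ U, f x ≠ 0 → t • x ∈ U') :
    ∑' x, (U \ U').indicator f x ≤ ∑' x, (f (t⁻¹ • x) - f x) := by
  have h1 : ∑' x, U.indicator f x ≤ ∑' x, U'.indicator f x + ∑' x, (f (t⁻¹ • x) - f x) := by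
    rw [← tsum_smul_eq _ t⁻¹, ← ENNReal.tsum_add]
    refine ENNReal.tsum_le_tsum fun x => ?_
    by_cases hx : t⁻¹ • x ∈ U
    · rw [Set.indicator_of_mem hx]
      by_cases h0 : f (t⁻¹ • x) = 0
      · rw [h0]; exact zero_le
      have := ht _ hx h0
      rw [smul_inv_smul] at this
      rw [Set.indicator_of_mem this]
      exact le_add_tsub
    · rw [Set.indicator_of_notMem hx]; exact zero_le
  have h2 : ∑' x, U.indicator f x = ∑' x, U'.indicator f x + ∑' x, (U \ U').indicator f x := by
    rw [← ENNReal.tsum_add]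
    refine tsum_congr fun x => ?_
    by_cases h : x ∈ U'
    · simp [h, hU h]
    · by_cases h' : x ∈ U <;> simp [h, h']
  rw [h2] at h1
  refine (ENNReal.add_le_add_iff_left ?_).1 h1
  exact ne_top_of_le_ne_top hf (ENNReal.tsum_le_tsum fun x => Set.indicator_le_self _ _ x)

omit [FiniteDimensional K V] in
theorem exists_equivariant {Ω : Type} [MulAction M Ω] (ρ : M →* End K V) [Nontrivial V] :
    ∃ Φ : Ω → V, (∀ x, Φ x ≠ 0) ∧ ∀ x, stabilizer M x = ⊥ → ∀ g, Φ (g • x) = ρ g (Φ x) := by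
  obtain ⟨e, he⟩ := exists_ne (0 : V)
  set o : Ω → Ω := fun x => (Quotient.mk (orbitRel M Ω) x).out
  have ho : ∀ x, ∃ g : M, g • o x = x := fun x =>
    (orbitRel M Ω).symm (Quotient.mk_out (s := orbitRel M Ω) x)
  choose γ hγ using ho
  refine ⟨fun x => ρ (γ x) e, fun x h => he ?_, fun x hx g => ?_⟩
  · have : ρ (γ x)⁻¹ (ρ (γ x) e) = e := by
      rw [← Module.End.mul_apply, ← map_mul, inv_mul_cancel, map_one, Module.End.one_apply]
    rw [← this, show ρ (γ x) e = 0 from h, map_zero]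
  · have hox : o (g • x) = o x := by
      simp only [o]
      congr 1
      exact Quotient.sound (s := orbitRel M Ω) ⟨g, rfl⟩
    have h1 : (g * γ x) • o x = γ (g • x) • o x := by
      rw [← hox, hγ (g • x), hox, mul_smul, hγ]
    have h2 : stabilizer M (o x) = ⊥ := by
      have : stabilizer M (γ x • o x) = ⊥ := by rw [hγ]; exact hx
      rw [stabilizer_smul_eq_stabilizer_map_conj] at this
      exact (Subgroup.map_eq_bot_iff_of_injective _ (MulAut.conj (γ x)).injective).1 this
    have h3 : (γ (g • x))⁻¹ * (g * γ x) ∈ stabilizer M (o x) := by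
      rw [mem_stabilizer_iff, mul_smul, h1, inv_smul_smul]
    rw [h2, Subgroup.mem_bot, inv_mul_eq_one] at h3
    simp only [h3, map_mul, Module.End.mul_apply]

theorem hasGap_of_hasEigenvalue [IsAlgClosed K] {𝓐 : Subalgebra K (M → K)}
    (h𝓐 : IsRegularAlgebra 𝓐) {ρ : M →* End K V} (hreg : IsRegularRep 𝓐 ρ) (hρ : IsIrredRep ρ)
    (v : AbsoluteValue K ℝ) {a : M} {l m : K} (hl : (ρ a).HasEigenvalue l)
    (hm : (ρ a).HasEigenvalue m) (hlm : v l < v m) : ∃ S : Finset M, HasGap S (fun H => H = ⊥) := by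
  classical
  have := hρ.1
  obtain ⟨A, B, -, hA, hB, hAB⟩ := exists_dominated_splitting v (T' := ρ a⁻¹)
    (by rw [← map_mul, inv_mul_cancel, map_one]) hl hm hlm
  obtain ⟨s, ε, hε, hε1, hs⟩ := exists_covering h𝓐 hreg hρ v hA hB
  obtain ⟨k, hk⟩ := hAB ε hε
  set t := a⁻¹ ^ k
  have hρt : ∀ x, (ρ a⁻¹ ^ k) x = ρ t x := fun x => by rw [← map_pow]
  simp only [hρt] at hk
  set S : Finset M := s.image fun h => h⁻¹ * t * h
  refine ⟨S, (s.card + 1 : ℝ≥0)⁻¹, by positivity, fun Ω _ f hf hst => ?_⟩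
  obtain ⟨Φ, hΦ0, hΦ⟩ := exists_equivariant (Ω := Ω) ρ
  set U : M → Set Ω := fun h =>
    {x | ε * absNorm v (B (ρ h (Φ x))) ≤ absNorm v (A (ρ h (Φ x)))}
  set U' : M → Set Ω := fun h => U h ∩
    {x | absNorm v (B (ρ h (Φ x))) < ε * absNorm v (A (ρ h (Φ x)))}
  have hUt : ∀ h, ∀ x ∈ U h, f x ≠ 0 → (h⁻¹ * t * h) • x ∈ U' h := by
    intro h x hx hfx
    have e : ρ h (Φ ((h⁻¹ * t * h) • x)) = ρ t (ρ h (Φ x)) := by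
      rw [hΦ x (hst x hfx)]
      simp only [← Module.End.mul_apply, ← map_mul]
      group
    have hne : ρ h (Φ x) ≠ 0 := by
      intro h0
      have : ρ h⁻¹ (ρ h (Φ x)) = Φ x := by
        rw [← Module.End.mul_apply, ← map_mul, inv_mul_cancel, map_one, Module.End.one_apply]
      exact hΦ0 x (by rw [← this, h0, map_zero])
    have hlt := hk _ hne hx
    rw [← e] at hlt
    refine ⟨?_, hlt⟩
    have h1 := mul_le_mul_of_nonneg_left hlt.le hε.le
    have h2 := mul_le_of_le_one_left (absNorm_nonneg v (A (ρ h (Φ ((h⁻¹ * t * h) • x))))) hε1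
    have h3 := mul_le_mul_of_nonneg_left h2 hε.le
    exact h1.trans (h3.trans h2)
  have hcov : ∀ x, f x ≤ ∑ h ∈ s, (U h \ U' h).indicator f x := by
    intro x
    obtain ⟨h, hh, h1, h2⟩ := hs _ (hΦ0 x)
    refine le_trans ?_ (Finset.single_le_sum (f := fun h => (U h \ U' h).indicator f x)
      (fun _ _ => zero_le) hh)
    have : x ∈ U h \ U' h := ⟨h1, fun h3 => h3.2.not_ge h2⟩
    simp [this]
  have hbound : ∑' x, f x ≤ s.card * shiftVar S f := by
    calc ∑' x, f x ≤ ∑' x, ∑ h ∈ s, (U h \ U' h).indicator f x := ENNReal.tsum_le_tsum hcov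
      _ = ∑ h ∈ s, ∑' x, (U h \ U' h).indicator f x :=
        Summable.tsum_finsetSum fun _ _ => ENNReal.summable
      _ ≤ ∑ h ∈ s, shiftVar S f := by
        refine Finset.sum_le_sum fun h hh => (tsum_diff_le hf (h⁻¹ * t * h)
          Set.inter_subset_left (hUt h)).trans ?_
        exact Finset.single_le_sum (f := fun s => ∑' x, (f (s⁻¹ • x) - f x))
          (fun _ _ => zero_le) (Finset.mem_image_of_mem _ hh)
      _ = s.card * shiftVar S f := by simp
  have hc : ((s.card + 1 : ℝ≥0) : ℝ≥0∞) ≠ 0 := by simp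
  rw [ENNReal.coe_inv (by positivity)]
  refine (ENNReal.inv_mul_le_iff hc ENNReal.coe_ne_top).2 (hbound.trans ?_)
  gcongr
  simp

end PingPong

section AbsoluteValues

open Cardinal Polynomial

theorem exists_ringEquiv_algebraMap (R : Type) {K L : Type} [CommRing R] [Nontrivial R]
    [Countable R] [Field K] [Field L] [IsAlgClosed K] [IsAlgClosed L] [Algebra R K] [Algebra R L]
    [FaithfulSMul R K] [FaithfulSMul R L] (hK : ℵ₀ < #K) (hKL : #K = #L) :
    ∃ σ : K ≃+* L, ∀ r, σ (algebraMap R K r) = algebraMap R L r := by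
  obtain ⟨s, hs⟩ := exists_isTranscendenceBasis R K
  obtain ⟨t, ht⟩ := exists_isTranscendenceBasis R L
  have hc : #s = #t := by
    have h1 := IsAlgClosed.cardinal_eq_cardinal_transcendence_basis_of_aleph0_lt' _ hs
      (Cardinal.mk_le_aleph0_iff.2 inferInstance) hK
    have h2 := IsAlgClosed.cardinal_eq_cardinal_transcendence_basis_of_aleph0_lt' _ ht
      (Cardinal.mk_le_aleph0_iff.2 inferInstance) (hKL ▸ hK)
    rw [← h1, ← h2, hKL]
  obtain ⟨e⟩ := Cardinal.eq.1 hc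
  let := IsAlgClosed.isAlgClosure_of_transcendence_basis _ hs
  let := IsAlgClosed.isAlgClosure_of_transcendence_basis _ ht
  let E : Algebra.adjoin R (Set.range ((↑) : s → K)) ≃ₐ[R]
      Algebra.adjoin R (Set.range ((↑) : t → L)) :=
    hs.1.aevalEquiv.symm.trans ((MvPolynomial.renameEquiv R e).trans ht.1.aevalEquiv)
  refine ⟨IsAlgClosure.equivOfEquiv K L E.toRingEquiv, fun r => ?_⟩
  rw [IsScalarTower.algebraMap_apply R (Algebra.adjoin R (Set.range ((↑) : s → K))) K,
    IsAlgClosure.equivOfEquiv_algebraMap,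
    IsScalarTower.algebraMap_apply R (Algebra.adjoin R (Set.range ((↑) : t → L))) L]
  congr 1
  exact E.commutes r

theorem exists_ringEquiv_of_ringHom {R K L : Type} [CommRing R] [Nontrivial R]
    [Countable R] [Field K] [Field L] [IsAlgClosed K] [IsAlgClosed L] (i : R →+* K) (j : R →+* L)
    (hi : Function.Injective i) (hj : Function.Injective j) (hK : ℵ₀ < #K) (hKL : #K = #L) :
    ∃ σ : K ≃+* L, ∀ r, σ (i r) = j r := by
  let := i.toAlgebra
  let := j.toAlgebra
  have : FaithfulSMul R K := (faithfulSMul_iff_algebraMap_injective R K).2 hi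
  have : FaithfulSMul R L := (faithfulSMul_iff_algebraMap_injective R L).2 hj
  exact exists_ringEquiv_algebraMap R hK hKL

instance countable_ratPolynomial : Countable ℚ[X] :=
  Cardinal.mk_le_aleph0_iff.1 (Polynomial.cardinalMk_le_max.trans (by simp))

theorem aleph0_lt_mk_complex : ℵ₀ < #ℂ := by
  rw [Cardinal.mk_complex]; exact aleph0_lt_continuum

theorem mk_padicAlgCl (p : ℕ) [Fact p.Prime] : #(PadicAlgCl p) = 𝔠 := by
  have h1 : #ℚ_[p] = 𝔠 := by
    refine le_antisymm ?_ (continuum_le_cardinal_of_nontriviallyNormedField _)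
    calc #ℚ_[p] ≤ #(PadicSeq p) := Cardinal.mk_quotient_le
      _ ≤ #(ℕ → ℚ) := Cardinal.mk_subtype_le _
      _ ≤ 𝔠 := by simp
  refine le_antisymm ?_ ?_
  · refine (Algebra.IsAlgebraic.cardinalMk_le_max ℚ_[p] (PadicAlgCl p)).trans ?_
    rw [h1, max_eq_left aleph0_le_continuum]
  · rw [← h1]
    exact Cardinal.mk_le_of_injective (algebraMap ℚ_[p] (PadicAlgCl p)).injective

theorem isInt_of_forall_norm_padic_le_one {q : ℚ}
    (h : ∀ (p : ℕ) [Fact p.Prime], ‖(q : ℚ_[p])‖ ≤ 1) : ∃ z : ℤ, (z : ℚ) = q := by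
  by_cases hq : q.den = 1
  · exact ⟨q.num, Rat.coe_int_num_of_den_eq_one hq⟩
  · obtain ⟨p, hp, hpd⟩ := Nat.exists_prime_and_dvd hq
    have := Fact.mk hp
    have h1 : ‖(q.num : ℚ_[p])‖ < 1 := by
      have e : (q.num : ℚ_[p]) = q * (q.den : ℚ_[p]) := by
        exact_mod_cast congrArg (Rat.cast : ℚ → ℚ_[p]) (Rat.mul_den_eq_num q).symm
      rw [e, norm_mul]
      have h2 : ‖(q.den : ℚ_[p])‖ < 1 := by
        have := (Padic.norm_intCast_lt_one_iff (p := p) (k := q.den)).2 (by exact_mod_cast hpd)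
        simpa using this
      exact mul_lt_one_of_nonneg_of_lt_one_right (h p) (norm_nonneg _) h2
    rw [Padic.norm_intCast_lt_one_iff] at h1
    have := Nat.dvd_gcd (Int.natCast_dvd.1 h1) hpd
    rw [q.reduced.gcd_eq_one] at this
    exact absurd (Nat.dvd_one.1 this) hp.one_lt.ne'

/-- The elements of `ℂ` all of whose absolute values are at most `B`, and whose nonarchimedean
absolute values are at most `1`. -/
def IsAbsBounded (B : ℝ) (t : ℂ) : Prop :=
  ∀ v : AbsoluteValue ℂ ℝ, v t ≤ B ∧ (IsNonarchimedean v → v t ≤ 1)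

theorem IsAbsBounded.norm_map_le {B : ℝ} {t : ℂ} (h : IsAbsBounded B t) {L : Type}
    [NormedField L] (σ : ℂ →+* L) : ‖σ t‖ ≤ B :=
  (h ((NormedField.toAbsoluteValue L).comp σ.injective)).1

theorem IsAbsBounded.isAlgebraic {B : ℝ} {t : ℂ} (h : IsAbsBounded B t) : IsAlgebraic ℚ t := by
  by_contra htr
  have htr : Transcendental ℚ t := htr
  have ht : t ≠ 0 := by rintro rfl; exact htr isAlgebraic_zero
  obtain ⟨N, hN⟩ := exists_nat_gt (B / ‖t‖)
  have hB : 0 ≤ B := (norm_nonneg _).trans (h.norm_map_le (RingHom.id ℂ))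
  have hN0 : (N : ℚ) ≠ 0 := by
    have : (0 : ℝ) < N := (div_nonneg hB (norm_nonneg t)).trans_lt hN
    exact_mod_cast this.ne'
  have htr' : Transcendental ℚ ((N : ℚ) • t) := by
    intro h'
    apply htr
    have := h'.smul (R := ℚ) ((N : ℚ)⁻¹)
    rwa [inv_smul_smul₀ hN0] at this
  obtain ⟨σ, hσ⟩ := exists_ringEquiv_of_ringHom (aeval t : ℚ[X] →ₐ[ℚ] ℂ).toRingHom
    (aeval ((N : ℚ) • t) : ℚ[X] →ₐ[ℚ] ℂ).toRingHom (transcendental_iff_injective.1 htr)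
    (transcendental_iff_injective.1 htr') aleph0_lt_mk_complex rfl
  have h1 : σ t = (N : ℚ) • t := by simpa using hσ X
  have h2 := h.norm_map_le σ.toRingHom
  have h3 : ‖(N : ℚ) • t‖ = N * ‖t‖ := by
    rw [Rat.smul_def, norm_mul]; simp
  change ‖σ t‖ ≤ B at h2
  rw [h1, h3] at h2
  rw [div_lt_iff₀ (norm_pos_iff.2 ht)] at hN
  linarith

theorem IsAbsBounded.of_aeval_minpoly {B : ℝ} {t : ℂ} (h : IsAbsBounded B t) {t' : ℂ}
    (ht' : aeval t' (minpoly ℚ t) = 0) : IsAbsBounded B t' := by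
  have hint := h.isAlgebraic.isIntegral
  have hirr := Fact.mk (minpoly.irreducible hint)
  have : Countable (AdjoinRoot (minpoly ℚ t)) := AdjoinRoot.mk_surjective.countable
  obtain ⟨σ, hσ⟩ := exists_ringEquiv_of_ringHom
    (AdjoinRoot.lift (algebraMap ℚ ℂ) t (minpoly.aeval ℚ t) : AdjoinRoot (minpoly ℚ t) →+* ℂ)
    (AdjoinRoot.lift (algebraMap ℚ ℂ) t' ht' : AdjoinRoot (minpoly ℚ t) →+* ℂ)
    (RingHom.injective _) (RingHom.injective _) aleph0_lt_mk_complex rfl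
  have h1 : σ t = t' := by
    have e := hσ (AdjoinRoot.root _)
    have e1 : AdjoinRoot.lift (algebraMap ℚ ℂ) t (minpoly.aeval ℚ t)
      (AdjoinRoot.root (minpoly ℚ t)) = t := AdjoinRoot.lift_root (minpoly.aeval ℚ t)
    have e2 : AdjoinRoot.lift (algebraMap ℚ ℂ) t' ht' (AdjoinRoot.root (minpoly ℚ t)) = t' :=
      AdjoinRoot.lift_root ht'
    exact (congrArg σ e1.symm).trans (e.trans e2)
  intro v
  have := h (v.comp (f := σ.toRingHom) σ.injective)
  rw [← h1]
  exact ⟨this.1, fun hv => this.2 fun x y => by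
    have := hv (σ x) (σ y)
    rw [← map_add] at this
    exact this⟩

theorem IsAbsBounded.isIntegral {B : ℝ} {t : ℂ} (h : IsAbsBounded B t) : IsIntegral ℤ t := by
  have hint := h.isAlgebraic.isIntegral
  have hc : ∀ n, ∃ z : ℤ, (z : ℚ) = (minpoly ℚ t).coeff n := by
    intro n
    refine isInt_of_forall_norm_padic_le_one fun p _ => ?_
    obtain ⟨e⟩ := IsAlgClosed.ringEquiv_of_equiv_of_charZero (K := ℂ) (L := PadicAlgCl p)
      aleph0_lt_mk_complex (Cardinal.eq.1 (by rw [mk_padicAlgCl, Cardinal.mk_complex]))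
    let v : AbsoluteValue ℂ ℝ :=
      (NormedField.toAbsoluteValue (PadicAlgCl p)).comp (f := e.toRingHom) e.injective
    have hv : IsNonarchimedean v := fun x y => by
      have := PadicAlgCl.isNonarchimedean p (e x) (e y)
      rw [← map_add] at this
      exact this
    let O : Subring ℂ :=
      { carrier := {x | v x ≤ 1}
        mul_mem' := fun {a b} ha hb => by
          simp only [Set.mem_ofPred_eq, map_mul] at *
          exact mul_le_one₀ ha (v.nonneg _) hb
        one_mem' := by simp
        add_mem' := fun {a b} ha hb => (hv a b).trans (max_le ha hb)
        zero_mem' := by simp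
        neg_mem' := fun {a} ha => by simpa using ha }
    have hmem : (minpoly ℚ t).map (algebraMap ℚ ℂ) ∈ lifts O.subtype := by
      have hs := (IsAlgClosed.splits ((minpoly ℚ t).map (algebraMap ℚ ℂ))).eq_prod_roots
      rw [((minpoly.monic hint).map _).leadingCoeff, map_one, one_mul] at hs
      rw [hs]
      refine Subsemiring.multiset_prod_mem _ _ fun q hq => ?_
      obtain ⟨a, ha, rfl⟩ := Multiset.mem_map.1 hq
      have ha' : aeval a (minpoly ℚ t) = 0 := by
        have := (mem_roots'.1 ha).2
        rwa [IsRoot.def, eval_map_algebraMap] at this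
      have haO : a ∈ O := ((h.of_aeval_minpoly ha') v).2 hv
      refine ⟨X - Polynomial.C ⟨a, haO⟩, by simp⟩
    obtain ⟨c, hc⟩ := (lifts_iff_coeff_lifts _).1 hmem n
    have h1 : v (algebraMap ℚ ℂ ((minpoly ℚ t).coeff n)) ≤ 1 := by
      rw [← coeff_map, ← hc]; exact c.2
    have h2 : e (algebraMap ℚ ℂ ((minpoly ℚ t).coeff n)) =
        algebraMap ℚ_[p] (PadicAlgCl p) (((minpoly ℚ t).coeff n : ℚ) : ℚ_[p]) := by simp
    have h3 : ‖e (algebraMap ℚ ℂ ((minpoly ℚ t).coeff n))‖ ≤ 1 := h1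
    rw [h2] at h3
    rwa [← PadicAlgCl.norm_extends]
  have : minpoly ℚ t ∈ lifts (Int.castRingHom ℚ) :=
    (lifts_iff_coeff_lifts _).2 fun n => hc n
  obtain ⟨q, hq, -, hqm⟩ := lifts_and_degree_eq_and_monic this (minpoly.monic hint)
  refine ⟨q, hqm, ?_⟩
  have h1 := minpoly.aeval ℚ t
  rw [← hq, aeval_def, eval₂_map,
    RingHom.ext_int ((algebraMap ℚ ℂ).comp (Int.castRingHom ℚ)) (algebraMap ℤ ℂ)] at h1
  exact h1

theorem numberField_of_finite (F : Type) [Field F] [a : Algebra ℚ F] [Module.Finite ℚ F] :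
    NumberField F := by
  have : CharZero F := charZero_of_injective_algebraMap (algebraMap ℚ F).injective
  obtain rfl : a = DivisionRing.toRatAlgebra := Subsingleton.elim _ _
  exact { to_charZero := inferInstance, to_finiteDimensional := inferInstance }

theorem exists_ringHom_numberField (A : Type) [CommRing A] [Nontrivial A] [Algebra ℚ A]
    [Algebra.FiniteType ℚ A] : ∃ (F : Type) (_ : Field F) (_ : NumberField F),
      Nonempty (A →+* F) := by
  obtain ⟨m, hm⟩ := Ideal.exists_maximal A
  let := Ideal.Quotient.field m
  have : Module.Finite ℚ (A ⧸ m) := finite_of_finite_type_of_isJacobsonRing ℚ (A ⧸ m)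
  exact ⟨A ⧸ m, inferInstance, numberField_of_finite (A ⧸ m), ⟨Ideal.Quotient.mk m⟩⟩

theorem finite_isAbsBounded (B : ℝ) (s : Finset ℂ) :
    {t | t ∈ Algebra.adjoin ℤ (s : Set ℂ) ∧ IsAbsBounded B t}.Finite := by
  set A := Algebra.adjoin ℚ (s : Set ℂ)
  have hAfg : Algebra.FiniteType ℚ A := (Subalgebra.fg_iff_finiteType A).1 ⟨s, rfl⟩
  obtain ⟨F, _, _, ⟨π⟩⟩ := exists_ringHom_numberField A
  have hfin := NumberField.Embeddings.finite_of_norm_le F ℂ B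
  refine (hfin.biUnion (t := fun y => {t : ℂ | aeval t (minpoly ℚ y) = 0}) fun y _ => ?_).subset ?_
  · refine (Set.Finite.subset (rootSet_finite (minpoly ℚ y) ℂ)) fun t ht => ?_
    exact mem_rootSet.2 ⟨minpoly.ne_zero (Algebra.IsIntegral.isIntegral y), ht⟩
  · rintro t ⟨htA, ht⟩
    have htA' : t ∈ A := by
      have : Algebra.adjoin ℤ (s : Set ℂ) ≤ A.restrictScalars ℤ :=
        Algebra.adjoin_le Algebra.subset_adjoin
      exact this htA
    have hint := ht.isAlgebraic.isIntegral
    have h1 : aeval (⟨t, htA'⟩ : A) (minpoly ℚ t) = 0 := by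
      apply Subtype.val_injective
      rw [← Subalgebra.coe_val, ← Polynomial.aeval_algHom_apply]
      simp
    have hz : aeval (π ⟨t, htA'⟩) (minpoly ℚ t) = 0 := by
      have : π ⟨t, htA'⟩ = π.toRatAlgHom ⟨t, htA'⟩ := rfl
      rw [this, Polynomial.aeval_algHom_apply, h1, map_zero]
    have hmin : minpoly ℚ t = minpoly ℚ (π ⟨t, htA'⟩) :=
      minpoly.eq_of_irreducible_of_monic (minpoly.irreducible hint) hz (minpoly.monic hint)
    refine Set.mem_biUnion (x := π ⟨t, htA'⟩) ⟨?_, fun φ => ?_⟩ ?_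
    · have h1 : IsIntegral ℤ (⟨t, htA'⟩ : A) := by
        rw [← isIntegral_algHom_iff (A.val.restrictScalars ℤ) Subtype.val_injective]
        exact ht.isIntegral
      exact h1.map π.toIntAlgHom
    · have h1 : aeval (φ (π ⟨t, htA'⟩)) (minpoly ℚ t) = 0 := by
        have : φ (π ⟨t, htA'⟩) = φ.toRatAlgHom (π ⟨t, htA'⟩) := rfl
        rw [this, Polynomial.aeval_algHom_apply, hz, map_zero]
      exact (ht.of_aeval_minpoly h1).norm_map_le (RingHom.id ℂ)
    · change aeval t (minpoly ℚ (π ⟨t, htA'⟩)) = 0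
      rw [← hmin]; exact minpoly.aeval ℚ t

end AbsoluteValues

section ScalarRepresentation

open Module ENNReal NNReal MulAction

theorem IsIrredRep.adjoin_range_eq_top {M K V : Type*} [Group M] [Field K] [IsAlgClosed K]
    [AddCommGroup V] [Module K V] [FiniteDimensional K V] {ρ : M →* End K V}
    (hρ : IsIrredRep ρ) : Algebra.adjoin K (Set.range ρ) = ⊤ := by
  classical
  set R := Algebra.adjoin K (Set.range ρ) with hR
  have hsimple : IsSimpleModule R V := by
    have := hρ.1
    rw [isSimpleModule_iff]
    refine { exists_pair_ne := ⟨⊥, ⊤, bot_ne_top⟩, eq_bot_or_eq_top := fun W => ?_ }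
    refine (hρ.2 (W.restrictScalars K) fun g w hw =>
      W.smul_mem (⟨ρ g, Algebra.subset_adjoin ⟨g, rfl⟩⟩ : R) hw).imp (fun h => ?_) fun h => ?_
    · exact (Submodule.restrictScalars_eq_bot_iff ..).1 h
    · exact (Submodule.restrictScalars_eq_top_iff ..).1 h
  rw [eq_top_iff]
  intro T _
  have hsc : ∀ e : End R V, ∃ c : K, ∀ w, e w = c • w := by
    intro e
    obtain ⟨c, rfl⟩ := (IsSimpleModule.algebraMap_end_bijective_of_isAlgClosed (A := R) (V := V) K).2 e
    exact ⟨c, fun w => rfl⟩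
  let f : End (End R V) V :=
    { toFun := T
      map_add' := map_add T
      map_smul' := fun e w => by
        obtain ⟨c, hc⟩ := hsc e
        simp [End.smul_def, hc] }
  obtain ⟨r, hr⟩ := jacobson_density f (Finset.univ.image (finBasis K V))
  have : T = (r : End K V) := (finBasis K V).ext fun i => hr _ (by simp)
  rw [this]
  exact r.2

theorem IsIrredRep.eq_zero_of_trace_mul {M K V : Type*} [Group M] [Field K] [IsAlgClosed K]
    [AddCommGroup V] [Module K V] [FiniteDimensional K V] {ρ : M →* End K V}
    (hρ : IsIrredRep ρ) {A : End K V}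
    (h : ∀ b, LinearMap.trace K V (A * ρ b) = 0) : A = 0 := by
  have h1 : ∀ T : End K V, LinearMap.trace K V (A * T) = 0 := by
    intro T
    have hT : T ∈ Submodule.span K (Set.range ρ) := by
      have h2 := Algebra.adjoin_eq_span K (Set.range ρ)
      rw [← MonoidHom.coe_mrange, Submonoid.closure_eq, MonoidHom.coe_mrange,
        hρ.adjoin_range_eq_top] at h2
      rw [← h2]
      trivial
    induction hT using Submodule.span_induction with
    | mem x hx => obtain ⟨b, rfl⟩ := hx; exact h b
    | zero => simp
    | add x y _ _ hx hy => rw [mul_add, map_add, hx, hy, add_zero]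
    | smul c x _ hx => rw [mul_smul_comm, map_smul, hx, smul_zero]
  ext w
  refine (Module.forall_dual_apply_eq_zero_iff K _).1 fun φ => ?_
  have h2 := h1 (φ.smulRight w)
  have h3 : A * φ.smulRight w = φ.smulRight (A w) := by ext; simp
  rwa [h3, LinearMap.trace_smulRight] at h2

variable {M : Type} [Group M] {V : Type*} [AddCommGroup V] [Module ℂ V] [FiniteDimensional ℂ V]

theorem IsRegularRep.trace_mem {𝓐 : Subalgebra ℂ (M → ℂ)} {ρ : M →* End ℂ V}
    (hreg : IsRegularRep 𝓐 ρ) : (fun g => LinearMap.trace ℂ V (ρ g)) ∈ 𝓐 := by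
  classical
  have : (fun g => LinearMap.trace ℂ V (ρ g)) =
      ∑ i, fun g => (finBasis ℂ V).coord i (ρ g (finBasis ℂ V i)) := by
    ext g
    rw [LinearMap.trace_eq_matrix_trace ℂ (finBasis ℂ V), Finset.sum_apply]
    simp [Matrix.trace, LinearMap.toMatrix_apply]
  rw [this]
  exact sum_mem fun i _ => hreg _ _

theorem IsRegularRep.det_mem {𝓐 : Subalgebra ℂ (M → ℂ)} {ρ : M →* End ℂ V}
    (hreg : IsRegularRep 𝓐 ρ) : (fun g => LinearMap.det (ρ g)) ∈ 𝓐 := by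
  classical
  have : (fun g => LinearMap.det (ρ g)) = ∑ σ : Equiv.Perm (Fin (finrank ℂ V)),
      ((Equiv.Perm.sign σ : ℤ) : ℂ) •
        ∏ i, fun g => (finBasis ℂ V).coord (σ i) (ρ g (finBasis ℂ V i)) := by
    ext g
    rw [← LinearMap.det_toMatrix (finBasis ℂ V), Finset.sum_apply, Matrix.det_apply']
    simp [LinearMap.toMatrix_apply]
  rw [this]
  exact sum_mem fun σ _ => Subalgebra.smul_mem _ (prod_mem fun i _ => hreg _ _) _

theorem apply_multiset_sum_le (v : AbsoluteValue ℂ ℝ) {r : ℝ} {s : Multiset ℂ}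
    (h : ∀ m ∈ s, v m = r) : v s.sum ≤ Multiset.card s * r := by
  induction s using Multiset.induction with
  | empty => simp
  | cons a s ih =>
    have h1 := ih fun m hm => h m (Multiset.mem_cons_of_mem hm)
    have h2 := h a (Multiset.mem_cons_self a s)
    rw [Multiset.sum_cons, Multiset.card_cons, Nat.cast_succ]
    linarith [v.add_le a s.sum]

theorem apply_multiset_sum_le_of_isNonarchimedean {v : AbsoluteValue ℂ ℝ}
    (hv : IsNonarchimedean v) {r : ℝ} (hr : 0 ≤ r) {s : Multiset ℂ}
    (h : ∀ m ∈ s, v m = r) : v s.sum ≤ r := by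
  induction s using Multiset.induction with
  | empty => simpa
  | cons a s ih =>
    rw [Multiset.sum_cons]
    exact (hv a s.sum).trans (max_le (h a (Multiset.mem_cons_self a s)).le
      (ih fun m hm => h m (Multiset.mem_cons_of_mem hm)))

/-- If all eigenvalues have the same absolute value then the normalised power of the trace is
bounded. -/
theorem isAbsBounded_trace_pow_mul_det {T T' : End ℂ V} (hT : T * T' = 1)
    (h : ∀ (v : AbsoluteValue ℂ ℝ) l m, T.HasEigenvalue l → T.HasEigenvalue m → v l ≤ v m) :
    IsAbsBounded ((finrank ℂ V : ℝ) ^ finrank ℂ V)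
      (LinearMap.trace ℂ V T ^ finrank ℂ V * LinearMap.det T') := by
  intro v
  have hs : T.charpoly.Splits := IsAlgClosed.splits _
  set n := finrank ℂ V with hn
  have hcard : Multiset.card T.charpoly.roots = n := by
    rw [← hs.natDegree_eq_card_roots, LinearMap.charpoly_natDegree]
  have hdet : LinearMap.det T * LinearMap.det T' = 1 := by rw [← map_mul, hT, map_one]
  obtain h0 | h0 := Nat.eq_zero_or_pos n
  · have h1 : LinearMap.det T' = 1 := by
      rw [LinearMap.det_eq_one_of_finrank_eq_zero h0]
    simp [h0, h1]
  obtain ⟨l, hl⟩ := Multiset.card_pos_iff_exists_mem.1 (hcard ▸ h0)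
  have hroot : ∀ m ∈ T.charpoly.roots, v m = v l := by
    have : ∀ m ∈ T.charpoly.roots, T.HasEigenvalue m := fun m hm =>
      (Module.End.hasEigenvalue_iff_isRoot_charpoly T m).2 (Polynomial.isRoot_of_mem_roots hm)
    intro m hm
    exact le_antisymm (h v _ _ (this m hm) (this l hl)) (h v _ _ (this l hl) (this m hm))
  have hd : v (LinearMap.det T) = v l ^ n := by
    rw [Module.End.det_eq_prod_roots_charpoly_of_splits hs, map_multiset_prod,
      Multiset.map_congr rfl hroot, Multiset.map_const', Multiset.prod_replicate, hcard]
  have hd' : v l ^ n * v (LinearMap.det T') = 1 := by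
    rw [← hd, ← map_mul, hdet, map_one]
  have htr : v (LinearMap.trace ℂ V T) ≤ n * v l ∧
      (IsNonarchimedean v → v (LinearMap.trace ℂ V T) ≤ v l) := by
    rw [Module.End.trace_eq_sum_roots_charpoly_of_splits hs, ← hcard]
    exact ⟨apply_multiset_sum_le v hroot, fun hv => 
      apply_multiset_sum_le_of_isNonarchimedean hv (apply_nonneg v l) hroot⟩
  have key : ∀ c : ℝ, 0 ≤ c → v (LinearMap.trace ℂ V T) ≤ c * v l →
      v (LinearMap.trace ℂ V T ^ n * LinearMap.det T') ≤ c ^ n := by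
    intro c hc h
    calc v (LinearMap.trace ℂ V T ^ n * LinearMap.det T')
        = v (LinearMap.trace ℂ V T) ^ n * v (LinearMap.det T') := by rw [map_mul, map_pow]
      _ ≤ (c * v l) ^ n * v (LinearMap.det T') := by gcongr
      _ = c ^ n := by rw [mul_pow, mul_assoc, hd', mul_one]
  refine ⟨key _ (Nat.cast_nonneg _) htr.1, fun hv => ?_⟩
  simpa using key 1 zero_le_one (by simpa using htr.2 hv)

/-- A regular function with finitely many values is constant. -/
theorem IsRegularAlgebra.eq_of_finite_range {𝓐 : Subalgebra ℂ (M → ℂ)} (h𝓐 : IsRegularAlgebra 𝓐)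
    {f : M → ℂ} (hf : f ∈ 𝓐) (hfin : (Set.range f).Finite) (u u' : M) : f u = f u' := by
  have h := h𝓐.exists_forall_ne_zero hfin.toFinset (fun c g => f g - c)
    (fun c _ => sub_mem hf (𝓐.algebraMap_mem c))
  by_contra hne
  obtain ⟨w, hw⟩ := h (by
    intro c _ hc
    exact hne ((sub_eq_zero.1 (congrFun hc u)).trans (sub_eq_zero.1 (congrFun hc u')).symm))
  exact hw (f w) (by simp) (sub_self _)

/-- An irreducible regular representation whose elements have no eigenvalues of different
absolute values is scalar. -/
theorem IsIrredRep.exists_eq_smul_one {𝓐 : Subalgebra ℂ (M → ℂ)} (h𝓐 : IsRegularAlgebra 𝓐)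
    {ρ : M →* End ℂ V} (hreg : IsRegularRep 𝓐 ρ) (hρ : IsIrredRep ρ)
    (h : ∀ (v : AbsoluteValue ℂ ℝ) a l m, (ρ a).HasEigenvalue l → (ρ a).HasEigenvalue m → v l ≤ v m)
    (a : M) : ∃ c : ℂ, ρ a = c • 1 := by
  classical
  have := hρ.1
  set n := finrank ℂ V with hn
  have hn0 : n ≠ 0 := finrank_pos.ne'
  have hn0' : (n : ℂ) ≠ 0 := by exact_mod_cast hn0
  let τ : M → ℂ := fun g => LinearMap.trace ℂ V (ρ g)
  have hτ : τ ∈ 𝓐 := hreg.trace_mem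
  let f : M → ℂ := fun g => τ g ^ n * LinearMap.det (ρ g⁻¹)
  have hf : f ∈ 𝓐 := mul_mem (pow_mem hτ n) (h𝓐.comp_inv _ hreg.det_mem)
  obtain ⟨s, hs⟩ := h𝓐.exists_adjoin f hf
  have hfin : (Set.range f).Finite := by
    refine (finite_isAbsBounded ((n : ℝ) ^ n) s).subset ?_
    rintro _ ⟨g, rfl⟩
    exact ⟨hs g, isAbsBounded_trace_pow_mul_det (by rw [← map_mul, mul_inv_cancel, map_one])
      fun v => h v g⟩
  have hτ1 : τ 1 = n := by simp [τ, hn]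
  have hf1 : ∀ g, τ g ^ n = n ^ n * LinearMap.det (ρ g) := by
    intro g
    have h1 := h𝓐.eq_of_finite_range hf hfin g 1
    have h2 : LinearMap.det (ρ g⁻¹) * LinearMap.det (ρ g) = 1 := by
      rw [← map_mul, ← map_mul, inv_mul_cancel, map_one, map_one]
    simp only [f, hτ1, inv_one, map_one, mul_one] at h1
    rw [← h1, mul_assoc, h2, mul_one]
  have hmul : ∀ a b, (n * τ (a * b)) ^ n = (τ a * τ b) ^ n := by
    intro a b
    rw [mul_pow, mul_pow, hf1, hf1, hf1, map_mul, map_mul]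
    ring
  have hτ0 : ∀ b, τ b ≠ 0 := by
    intro b hb
    have h1 := hmul b b⁻¹
    rw [mul_inv_cancel, hτ1, hb, zero_mul, zero_pow hn0] at h1
    exact mul_ne_zero hn0' hn0' (pow_eq_zero_iff hn0 |>.1 h1)
  have hmul' : ∀ b a, n * τ (a * b) = τ a * τ b := by
    intro b
    have hex := mt (h𝓐.exists_forall_ne_zero (Polynomial.nthRootsFinset n (1 : ℂ))
      (fun ζ g => n * τ (g * b) - ζ * (τ g * τ b)) fun ζ _ => ?_)
    · have hnot : ¬ ∃ u, ∀ ζ ∈ Polynomial.nthRootsFinset n (1 : ℂ),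
          n * τ (u * b) - ζ * (τ u * τ b) ≠ 0 := by
        rintro ⟨u, hu⟩
        refine hu (n * τ (u * b) / (τ u * τ b)) ?_ ?_
        · rw [Polynomial.mem_nthRootsFinset (Nat.pos_of_ne_zero hn0), div_pow, hmul,
            div_self (pow_ne_zero _ (mul_ne_zero (hτ0 _) (hτ0 _)))]
        · rw [div_mul_cancel₀ _ (mul_ne_zero (hτ0 _) (hτ0 _)), sub_self]
      have := hex hnot
      push Not at this
      obtain ⟨ζ, -, hζ⟩ := this
      have h1 := congrFun hζ 1
      simp only [one_mul, hτ1, Pi.zero_apply] at h1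
      have h2 : ζ = 1 := by
        have h3 : (1 - ζ) * (n * τ b) = 0 := by linear_combination h1
        have := (mul_eq_zero.1 h3).resolve_right (mul_ne_zero hn0' (hτ0 b))
        linear_combination -this
      intro a
      have h4 := congrFun hζ a
      simp only [h2, one_mul, Pi.zero_apply] at h4
      exact sub_eq_zero.1 h4
    · refine sub_mem (mul_mem (𝓐.algebraMap_mem _) (h𝓐.comp_mul_right _ hτ b))
        (mul_mem (𝓐.algebraMap_mem _) (mul_mem hτ (𝓐.algebraMap_mem _)))
  refine ⟨τ a / n, sub_eq_zero.1 (hρ.eq_zero_of_trace_mul fun b => ?_)⟩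
  have h1 : LinearMap.trace ℂ V (ρ a * ρ b) = τ (a * b) := by rw [← map_mul]
  rw [sub_mul, smul_mul_assoc, one_mul, map_sub, map_smul, h1, smul_eq_mul]
  have h2 := hmul' b a
  change τ (a * b) - τ a / n * τ b = 0
  field_simp
  linear_combination h2

end ScalarRepresentation

section SolvableImage

open Module

theorem derivedSeries_succ_le_ker {M A : Type*} [Group M] [Monoid A] (ρ : M →* A) (k : ℕ)
    (h : ∀ g ∈ derivedSeries M k, ∀ g' ∈ derivedSeries M k, Commute (ρ g) (ρ g')) :
    derivedSeries M (k + 1) ≤ ρ.ker := by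
  rw [derivedSeries_succ, Subgroup.commutator_le]
  intro g hg g' hg'
  rw [MonoidHom.mem_ker, commutatorElement_def, map_mul, map_mul, map_mul, (h g hg g' hg').eq,
    mul_assoc (ρ g'), ← map_mul ρ g, mul_inv_cancel, map_one, mul_one, ← map_mul, mul_inv_cancel,
    map_one]

variable {M : Type} [Group M]

/-- The subrepresentation on an invariant subspace. -/
def subRep {V : Type} [AddCommGroup V] [Module ℂ V] (ρ : M →* End ℂ V) (W : Submodule ℂ V)
    (hW : ∀ g, ∀ w ∈ W, ρ g w ∈ W) : M →* End ℂ W where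
  toFun g := (ρ g).restrict (hW g)
  map_one' := by ext; simp
  map_mul' g h := by ext; simp

/-- The quotient representation by an invariant subspace. -/
def quotRep {V : Type} [AddCommGroup V] [Module ℂ V] (ρ : M →* End ℂ V) (W : Submodule ℂ V)
    (hW : ∀ g, ∀ w ∈ W, ρ g w ∈ W) : M →* End ℂ (V ⧸ W) where
  toFun g := W.mapQ W (ρ g) (hW g)
  map_one' := by ext; simp
  map_mul' g h := by ext; simp

theorem IsRegularRep.exists_derivedSeries_le_ker {𝓐 : Subalgebra ℂ (M → ℂ)}
    (h𝓐 : IsRegularAlgebra 𝓐) (hgap : ¬ ∃ S : Finset M, HasGap S (fun H => H = ⊥)) (n : ℕ)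
    {V : Type} [AddCommGroup V] [Module ℂ V] [FiniteDimensional ℂ V] (hn : finrank ℂ V = n)
    {ρ : M →* End ℂ V} (hreg : IsRegularRep 𝓐 ρ) : ∃ k, derivedSeries M k ≤ ρ.ker := by
  induction n using Nat.strong_induction_on generalizing V with
  | _ n ih =>
  obtain hV | hV := subsingleton_or_nontrivial V
  · exact ⟨0, fun g _ => Subsingleton.elim _ _⟩
  by_cases hρ : IsIrredRep ρ
  · refine ⟨1, derivedSeries_succ_le_ker ρ 0 fun g _ g' _ => ?_⟩
    obtain ⟨c, hc⟩ := hρ.exists_eq_smul_one h𝓐 hreg (fun v a l m hl hm => by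
      by_contra! hlt
      exact hgap (hasGap_of_hasEigenvalue h𝓐 hreg hρ v hm hl hlt)) g
    rw [hc]
    exact (Commute.one_left _).smul_left c
  · have : ∃ W : Submodule ℂ V, (∀ g, ∀ w ∈ W, ρ g w ∈ W) ∧ W ≠ ⊥ ∧ W ≠ ⊤ := by
      by_contra! h
      exact hρ ⟨hV, fun W hW => or_iff_not_imp_left.2 (h W hW)⟩
    obtain ⟨W, hW, hbot, htop⟩ := this
    obtain ⟨k₁, hk₁⟩ := ih (finrank ℂ W) (hn ▸ Submodule.finrank_lt htop) rfl (ρ := subRep ρ W hW)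
      (fun φ w => by
        obtain ⟨ψ, rfl⟩ := LinearMap.exists_extend φ
        exact hreg ψ w)
    obtain ⟨k₂, hk₂⟩ := ih (finrank ℂ (V ⧸ W))
      (by
        have h1 := W.finrank_quotient_add_finrank
        have h2 := Submodule.one_le_finrank_iff.2 hbot
        omega) rfl (ρ := quotRep ρ W hW)
      (fun φ w => by
        obtain ⟨w, rfl⟩ := W.mkQ_surjective w
        exact hreg (φ.comp W.mkQ) w)
    have h1 : ∀ g ∈ derivedSeries M (max k₁ k₂), ∀ w ∈ W, ρ g w = w := by
      intro g hg w hw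
      exact congrArg Subtype.val (LinearMap.congr_fun
        (MonoidHom.mem_ker.1 (hk₁ (derivedSeries_antitone M (le_max_left _ _) hg))) ⟨w, hw⟩)
    have h2 : ∀ g ∈ derivedSeries M (max k₁ k₂), ∀ w, ρ g w - w ∈ W := by
      intro g hg w
      rw [← Submodule.Quotient.eq]
      exact LinearMap.congr_fun
        (MonoidHom.mem_ker.1 (hk₂ (derivedSeries_antitone M (le_max_right _ _) hg)))
        (Submodule.Quotient.mk w)
    refine ⟨max k₁ k₂ + 1, derivedSeries_succ_le_ker ρ _ fun g hg g' hg' => ?_⟩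
    have h3 : ∀ g ∈ derivedSeries M (max k₁ k₂), ∀ g' ∈ derivedSeries M (max k₁ k₂), ∀ w,
        ρ g (ρ g' w) = ρ g w + ρ g' w - w := by
      intro g hg g' hg' w
      have := h1 g hg _ (h2 g' hg' w)
      rw [map_sub, sub_eq_iff_eq_add] at this
      rw [this]
      abel
    ext w
    rw [Module.End.mul_apply, Module.End.mul_apply, h3 g hg g' hg', h3 g' hg' g hg]
    abel

/-- A nonsolvable group with a faithful regular representation has a spectral gap on free
orbits. -/
theorem exists_hasGap {𝓐 : Subalgebra ℂ (M → ℂ)} (h𝓐 : IsRegularAlgebra 𝓐)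
    {V : Type} [AddCommGroup V] [Module ℂ V] [FiniteDimensional ℂ V] {ρ : M →* End ℂ V}
    (hreg : IsRegularRep 𝓐 ρ) (hinj : Function.Injective ρ)
    (hsol : ¬ Group.IsSolvable M) : ∃ S : Finset M, HasGap S (fun H => H = ⊥) := by
  by_contra hgap
  obtain ⟨k, hk⟩ := hreg.exists_derivedSeries_le_ker h𝓐 hgap _ rfl
  rw [(MonoidHom.ker_eq_bot_iff ρ).2 hinj] at hk
  exact hsol ⟨⟨k, le_bot_iff.1 hk⟩⟩

end SolvableImage

section DenseFinset

open ENNReal NNReal MulAction Pointwise ZariskiGroup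

variable {M : Type} [Group M]

theorem HasGap.mono {S T : Finset M} {P : Subgroup M → Prop} (h : HasGap S P) (hST : S ⊆ T) :
    HasGap T P := by
  obtain ⟨δ, hδ, h⟩ := h
  exact ⟨δ, hδ, fun Ω _ f hf hP => (h Ω f hf hP).trans (Finset.sum_le_sum_of_subset hST)⟩

theorem HasGap.infinite_of_subset {S : Finset M} (h : HasGap S (fun H => H = ⊥)) {H : Subgroup M}
    (hS : (S : Set M) ⊆ H) : (H : Set M).Infinite := by
  classical
  intro hfin
  obtain ⟨δ, hδ, h⟩ := h
  have hsum : ∑' g, (H : Set M).indicator (1 : M → ℝ≥0∞) g = hfin.toFinset.card := by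
    rw [tsum_eq_sum (s := hfin.toFinset) (fun g hg => by
      rw [Set.Finite.mem_toFinset] at hg; exact Set.indicator_of_notMem hg _)]
    rw [Finset.sum_congr rfl fun g hg => Set.indicator_of_mem (hfin.mem_toFinset.1 hg) _]
    simp
  have h1 := h M ((H : Set M).indicator 1) (by rw [hsum]; exact ENNReal.natCast_ne_top _)
    (fun g _ => IsCancelSMul.stabilizer_eq_bot g)
  have h2 : shiftVar S ((H : Set M).indicator (1 : M → ℝ≥0∞)) = 0 := by
    refine Finset.sum_eq_zero fun s hs => ENNReal.tsum_eq_zero.2 fun g => ?_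
    have : s⁻¹ • g ∈ (H : Set M) ↔ g ∈ (H : Set M) :=
      H.mul_mem_cancel_left (H.inv_mem (hS hs))
    by_cases hg : g ∈ (H : Set M)
    · rw [Set.indicator_of_mem (this.2 hg), Set.indicator_of_mem hg]; simp
    · rw [Set.indicator_of_notMem (mt this.1 hg)]; simp
  rw [h2, hsum, nonpos_iff_eq_zero, mul_eq_zero] at h1
  have h3 : hfin.toFinset.card ≠ 0 :=
    Finset.card_ne_zero.2 ⟨1, hfin.mem_toFinset.2 H.one_mem⟩
  rcases h1 with h1 | h1
  · exact hδ.ne' (by simpa using h1)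
  · exact h3 (by exact_mod_cast h1)

variable [TopologicalSpace M] [ZariskiGroup M]

/-- A finite set with a spectral gap on free orbits can be enlarged to a topologically generating
finite set. -/
theorem exists_dense_finset (hM : ∀ N : Subgroup M, N.Normal → IsClosed (N : Set M) →
      IsIrreducible (N : Set M) → N ≠ ⊥ → N = ⊤) {S₀ : Finset M}
    (h₀ : HasGap S₀ (fun H => H = ⊥)) : ∃ S : Finset M, S₀ ⊆ S ∧ (1 : M) ∈ S ∧
      ∀ H : Subgroup M, IsClosed (H : Set M) → ↑S ⊆ (H : Set M) → H = ⊤ := by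
  classical
  let cl : Finset M → Subgroup M := fun T => closureSubgroup (Subgroup.closure (T : Set M))
  have hcl : ∀ T, IsClosed (cl T : Set M) := fun T => isClosed_closureSubgroup _
  have hsub : ∀ T : Finset M, (T : Set M) ⊆ cl T := fun T =>
    Subgroup.subset_closure.trans (le_closureSubgroup _)
  have hmono : ∀ T T' : Finset M, T ⊆ T' → cl T ≤ cl T' := fun T T' h =>
    closureSubgroup_le ((Subgroup.closure_mono (Finset.coe_subset.2 h)).trans
      (le_closureSubgroup _)) (hcl T')
  obtain ⟨n, hn⟩ := exists_rk_le M
  obtain ⟨T, hT, hmax⟩ : ∃ T, insert 1 S₀ ⊆ T ∧ ∀ T', T ⊆ T' → rk (cl T') ≤ rk (cl T) := by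
    by_contra! h
    have : ∀ k : ℕ, ∃ T, insert 1 S₀ ⊆ T ∧ k ≤ rk (cl T) := by
      intro k
      induction k with
      | zero => exact ⟨_, subset_rfl, Nat.zero_le _⟩
      | succ k ih =>
        obtain ⟨T, hT, hk⟩ := ih
        obtain ⟨T', hT', hlt⟩ := h T hT
        exact ⟨T', hT.trans hT', hk.trans_lt hlt⟩
    obtain ⟨T, -, hT⟩ := this (n + 1)
    exact (hT.trans (hn _)).not_gt (Nat.lt_succ_self n)
  have hST : S₀ ⊆ T := (Finset.subset_insert _ _).trans hT
  have hnormal : (idComp (cl T)).Normal := by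
    refine ⟨fun c hc g => ?_⟩
    have hle : idComp (cl T) ≤ idComp (cl (insert g T)) :=
      idComp_mono (hmono _ _ (Finset.subset_insert _ _))
    have heq : idComp (cl T) = idComp (cl (insert g T)) := by
      refine hle.eq_of_not_lt fun hlt => ?_
      exact (rk_lt_rk (hcl _) (hcl _) hlt).not_ge (hmax _ (Finset.subset_insert _ _))
    have hg : g ∈ cl (insert g T) := hsub _ (by simp)
    rw [heq] at hc ⊢
    exact conj_mem_idComp g (fun h hh => mul_mem (mul_mem hg hh) (inv_mem hg)) hc
  have htop : idComp (cl T) = ⊤ := by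
    refine hM _ hnormal (isClosed_idComp (hcl T)) (isIrreducible_idComp _) fun hbot => ?_
    exact h₀.infinite_of_subset ((Finset.coe_subset.2 hST).trans (hsub T))
      (finite_of_idComp_eq_bot (hcl T) hbot)
  refine ⟨T, hST, hT (Finset.mem_insert_self _ _), fun H hH hTH => ?_⟩
  rw [eq_top_iff, ← htop]
  exact (idComp_le _).trans (closureSubgroup_le ((Subgroup.closure_le H).2 hTH) hH)

theorem exists_collisionBound (hM : ∀ N : Subgroup M, N.Normal → IsClosed (N : Set M) →
      IsIrreducible (N : Set M) → N ≠ ⊥ → N = ⊤)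
    (h₀ : ∃ S : Finset M, HasGap S (fun H => H = ⊥)) :
    ∃ S : Finset M, S.Nonempty ∧ ∃ ρ : ℝ≥0, ρ < 1 ∧ CollisionBound S ρ := by
  obtain ⟨S₀, h₀⟩ := h₀
  obtain ⟨S, hS, h1, hdense⟩ := exists_dense_finset hM h₀
  obtain ⟨ρ, hρ, h⟩ := exists_walkE_coset_le h1 (hasGap_of_proper hdense hM (h₀.mono hS))
  refine ⟨S, ⟨1, h1⟩, ρ, hρ, fun H hH hne => h H fun g => ⟨?_, fun htop => hne ?_⟩⟩
  · have : ((H.map (MulAut.conj g).toMonoidHom : Subgroup M) : Set M) =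
        (fun x => g⁻¹ * x * g⁻¹⁻¹) ⁻¹' (H : Set M) := by
      ext y
      have h1 := Subgroup.mem_map_equiv (f := MulAut.conj g) (K := H) (x := y)
      rw [MulAut.conj_symm_apply] at h1
      rw [Set.mem_preimage, inv_inv]
      exact h1
    rw [this]
    exact hH.preimage (continuous_conj g⁻¹)
  · rw [← Subgroup.map_top_of_surjective (MulAut.conj g).toMonoidHom (MulAut.conj g).surjective]
      at htop
    exact Subgroup.map_injective (MulAut.conj g).injective htop

end DenseFinset

section LinearGroup

open MvPolynomial Module Topology NNReal

variable {M : Type} [Group M] {d : ℕ}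

/-- The algebra of functions given by polynomials in the matrix entries. -/
def regularFunctions (x : M →* GL (Fin d) ℂ) : Subalgebra ℂ (M → ℂ) where
  carrier := {f | ∃ Q : MvPolynomial (EntryIndex d) ℂ, ∀ u, eval (entries x u) Q = f u}
  mul_mem' := by
    rintro f g ⟨P, hP⟩ ⟨Q, hQ⟩
    exact ⟨P * Q, fun u => by rw [map_mul, hP, hQ, Pi.mul_apply]⟩
  add_mem' := by
    rintro f g ⟨P, hP⟩ ⟨Q, hQ⟩
    exact ⟨P + Q, fun u => by rw [map_add, hP, hQ, Pi.add_apply]⟩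
  algebraMap_mem' r := ⟨C r, fun u => by rw [eval_C]; rfl⟩

variable {x : M →* GL (Fin d) ℂ}

theorem mem_regularFunctions {f : M → ℂ} : f ∈ regularFunctions x ↔
    ∃ Q : MvPolynomial (EntryIndex d) ℂ, ∀ u, eval (entries x u) Q = f u := Iff.rfl

theorem isRegularAlgebra_regularFunctions
    (hint : ∃ s : Finset ℂ, ∀ u i, entries x u i ∈ Algebra.adjoin ℤ (s : Set ℂ))
    (hirr : ∀ P Q : MvPolynomial (EntryIndex d) ℂ, (∀ u, eval (entries x u) (P * Q) = 0) →
      (∀ u, eval (entries x u) P = 0) ∨ ∀ u, eval (entries x u) Q = 0) :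
    IsRegularAlgebra (regularFunctions x) where
  eq_zero_or := by
    intro f hf g hg hfg
    obtain ⟨P, hP⟩ := mem_regularFunctions.1 hf
    obtain ⟨Q, hQ⟩ := mem_regularFunctions.1 hg
    refine (hirr P Q fun u => ?_).imp (fun h => funext fun u => (hP u).symm.trans (h u))
      fun h => funext fun u => (hQ u).symm.trans (h u)
    rw [map_mul, hP, hQ]
    exact congrFun hfg u
  exists_adjoin := by
    classical
    intro f hf
    obtain ⟨Q, hQ⟩ := mem_regularFunctions.1 hf
    obtain ⟨s, hs⟩ := hint
    refine ⟨s ∪ Q.support.image Q.coeff, fun u => ?_⟩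
    rw [← hQ, eval_eq]
    refine sum_mem fun m hm => mul_mem (Algebra.subset_adjoin ?_)
      (prod_mem fun i _ => pow_mem (Algebra.adjoin_mono ?_ (hs u i)) _)
    · exact Finset.mem_coe.2 (Finset.mem_union_right _ (Finset.mem_image_of_mem _ hm))
    · exact Finset.coe_subset.2 Finset.subset_union_left
  comp_inv := by
    intro f hf
    obtain ⟨Q, hQ⟩ := mem_regularFunctions.1 hf
    refine mem_regularFunctions.2 ⟨bind₁ (fun i => X (!i.1, i.2.1, i.2.2)) Q, fun u => ?_⟩
    rw [← hQ]
    refine eval_bind₁_entries (f := fun g => g⁻¹) (fun u i => ?_) Q u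
    obtain ⟨b, i, j⟩ := i
    cases b <;> simp [entries]
  comp_mul_right := by
    intro f hf h
    obtain ⟨Q, hQ⟩ := mem_regularFunctions.1 hf
    refine mem_regularFunctions.2 ⟨bind₁ (mulRightPoly x h) Q, fun u => ?_⟩
    rw [← hQ]
    exact eval_bind₁_entries (f := fun g => g * h) (eval_mulRightPoly h) Q u

/-- The standard representation of a linear group. -/
noncomputable def stdRep (x : M →* GL (Fin d) ℂ) : M →* End ℂ (Fin d → ℂ) :=
  (Matrix.toLinAlgEquiv' : Matrix (Fin d) (Fin d) ℂ ≃ₐ[ℂ] _).toAlgHom.toRingHom.toMonoidHom.comp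
    ((Units.coeHom _).comp x)

theorem stdRep_apply (g : M) (w : Fin d → ℂ) :
    stdRep x g w = (x g : Matrix (Fin d) (Fin d) ℂ) *ᵥ w := rfl

theorem stdRep_injective (hx : Function.Injective x) : Function.Injective (stdRep x) := by
  intro g h hgh
  exact hx (Units.ext (Matrix.toLinAlgEquiv'.injective hgh))

theorem isRegularRep_stdRep : IsRegularRep (regularFunctions x) (stdRep x) := by
  intro φ w
  refine mem_regularFunctions.2
    ⟨∑ i, ∑ j, C (φ (Pi.single i 1) * w j) * X (true, i, j), fun u => ?_⟩
  rw [LinearMap.pi_apply_eq_sum_univ φ, map_sum]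
  refine Finset.sum_congr rfl fun i _ => ?_
  rw [stdRep_apply, map_sum, Matrix.mulVec, dotProduct, Finset.sum_smul]
  refine Finset.sum_congr rfl fun j _ => ?_
  have : (fun j : Fin d => if i = j then (1 : ℂ) else 0) = Pi.single i 1 := by
    ext j; simp [Pi.single_apply, eq_comm]
  simp only [this, map_mul, eval_C, eval_X, entries, cond_true, smul_eq_mul]
  ring

/-- The simultaneous avoidance theorem for an irreducible nonsolvable linear group without proper
nontrivial normal irreducible closed subgroups. -/
theorem exists_prod_eval_entries_ne_zero (hx : Function.Injective x)
    (hint : ∃ s : Finset ℂ, ∀ u i, entries x u i ∈ Algebra.adjoin ℤ (s : Set ℂ))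
    (hirr : @IsIrreducible M (zariskiTopology x) Set.univ)
    (hM : ∀ N : Subgroup M, N.Normal → IsClosed[zariskiTopology x] (N : Set M) →
      @IsIrreducible M (zariskiTopology x) (N : Set M) → N ≠ ⊥ → N = ⊤)
    (hsol : ¬ Group.IsSolvable M) (b : ℕ) :
    ∃ (S : Finset M) (C : ℕ), ∀ n, 1 ≤ n → ∀ F : Finset (MvPolynomial (EntryIndex d) ℂ),
      F.card ≤ b ^ n → (∀ P ∈ F, P.totalDegree ≤ n) →
      (∀ P ∈ F, ∃ u, eval (entries x u) P ≠ 0) →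
      ∃ l : List M, (∀ a ∈ l, a ∈ S) ∧ l.length = C * n ∧
        ∀ P ∈ F, eval (entries x l.prod) P ≠ 0 := by
  let _ := zariskiTopology x
  have := zariskiGroup hx
  have hirr' : ∀ P Q : MvPolynomial (EntryIndex d) ℂ, (∀ u, eval (entries x u) (P * Q) = 0) →
      (∀ u, eval (entries x u) P = 0) ∨ ∀ u, eval (entries x u) Q = 0 := by
    intro P Q h
    have := isPreirreducible_iff_isClosed_union_isClosed.1 hirr.2 _ _
      (isClosed_zariski_zeros x P) (isClosed_zariski_zeros x Q) (fun u _ => by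
        have := h u
        rwa [map_mul, mul_eq_zero] at this)
    exact this.imp (fun h u => h (Set.mem_univ u)) fun h u => h (Set.mem_univ u)
  have : Nontrivial M := by
    by_contra h
    rw [not_nontrivial_iff_subsingleton] at h
    exact hsol inferInstance
  obtain ⟨S, hS, ρ, hρ, hcol⟩ := exists_collisionBound hM
    (exists_hasGap (isRegularAlgebra_regularFunctions hint hirr') isRegularRep_stdRep
      (stdRep_injective hx) hsol)
  obtain ⟨C, hC⟩ := exists_prod_eval_ne_zero (entries_injective hx)
    (translatesPolynomials_entries x) (isClosed_zariski_zeros x) hirr' hS hρ hcol b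
  exact ⟨S, C, hC⟩

end LinearGroup

section MinimalSeparating

open ZariskiGroup Topology
open scoped commutatorElement

variable {G : Type} [Group G]

theorem SeparatesWords.infinite {A : Subgroup G} (hA : SeparatesWords (A : Set G)) :
    (A : Set G).Infinite := by
  intro hfin
  have : Finite A := hfin
  obtain ⟨γ, hγ, h⟩ := hA (xGen G ^ Nat.card A) (xGen_pow_ne_one Nat.card_pos.ne')
  refine h ?_
  have h1 : (⟨γ, hγ⟩ : A) ^ Nat.card A = 1 := pow_card_eq_one'
  rw [map_pow]
  have h2 : evalWord γ (xGen G) = γ := by simp [evalWord, xGen]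
  rw [h2]
  exact congrArg A.subtype h1

theorem SeparatesWords.ne_bot {A : Subgroup G} (hA : SeparatesWords (A : Set G)) : A ≠ ⊥ := by
  rintro rfl
  exact hA.infinite (by simp)

theorem SeparatesWords.exists_not_commute {A : Subgroup G} (hA : SeparatesWords (A : Set G)) :
    ∃ a ∈ A, ∃ b ∈ A, a * b ≠ b * a := by
  obtain ⟨c, hc, hc1⟩ := A.bot_or_exists_ne_one.resolve_left hA.ne_bot
  obtain ⟨γ, hγ, h⟩ := hA _ (commutator_word_ne_one hc1)
  refine ⟨γ, hγ, c, hc, fun hcomm => h ?_⟩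
  have h2 : evalWord γ (xGen G) = γ := by simp [evalWord, xGen]
  have h3 : evalWord γ (Monoid.Coprod.inl c) = c := by simp [evalWord]
  rw [map_mul, map_mul, map_mul, map_inv, map_inv, h2, h3, hcomm]
  group

theorem SeparatesWords.not_isSolvable {M : Subgroup G} (hM : SeparatesWords (M : Set G)) :
    ¬ Group.IsSolvable M := by
  rintro ⟨hk⟩
  classical
  have hk0 : Nat.find hk ≠ 0 := by
    intro h0
    have h1 := Nat.find_spec hk
    rw [h0, derivedSeries_zero] at h1
    refine hM.ne_bot ?_
    have := congrArg (Subgroup.map M.subtype) h1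
    rwa [← MonoidHom.range_eq_map, Subgroup.range_subtype, Subgroup.map_bot] at this
  obtain ⟨j, hj⟩ := Nat.exists_eq_succ_of_ne_zero hk0
  have h1 := Nat.find_spec hk
  rw [hj, derivedSeries_succ] at h1
  have h2 := Nat.find_min hk (m := j) (by omega)
  set D := derivedSeries M j
  have hsep : SeparatesWords ((D.map M.subtype : Subgroup G) : Set G) := by
    refine hM.of_normalized ?_ ?_
    · rwa [Ne, Subgroup.map_eq_bot_iff_of_injective _ M.subtype_injective]
    · rintro m hm _ ⟨c, hc, rfl⟩
      exact ⟨⟨m, hm⟩ * c * ⟨m, hm⟩⁻¹,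
        (inferInstance : (derivedSeries M j).Normal).conj_mem c hc _, by simp⟩
  obtain ⟨_, ⟨a, ha, rfl⟩, _, ⟨b, hb, rfl⟩, hab⟩ := hsep.exists_not_commute
  refine hab ?_
  have h3 : ⁅a, b⁆ = 1 := by
    rw [← Subgroup.mem_bot, ← h1]
    exact Subgroup.commutator_mem_commutator ha hb
  rw [← map_mul, commutatorElement_eq_one_iff_mul_comm.1 h3, map_mul]

theorem exists_minimal_separating [TopologicalSpace G] [ZariskiGroup G]
    (hG : SeparatesWords (Set.univ : Set G)) : ∃ M : Subgroup G, IsClosed (M : Set G) ∧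
      IsIrreducible (M : Set G) ∧ SeparatesWords (M : Set G) ∧ ∀ N ≤ M,
        (∀ m ∈ M, ∀ c ∈ N, m * c * m⁻¹ ∈ N) → IsClosed (N : Set G) →
          IsIrreducible (N : Set G) → N ≠ ⊥ → N = M := by
  classical
  have htop : SeparatesWords ((⊤ : Subgroup G) : Set G) := by rwa [Subgroup.coe_top]
  have hex : ∃ k, ∃ M : Subgroup G, IsClosed (M : Set G) ∧ IsIrreducible (M : Set G) ∧
      SeparatesWords (M : Set G) ∧ rk M = k := by
    have hcl : IsClosed ((⊤ : Subgroup G) : Set G) := by rw [Subgroup.coe_top]; exact isClosed_univ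
    refine ⟨_, idComp ⊤, isClosed_idComp hcl, isIrreducible_idComp _, htop.of_normalized ?_ ?_, rfl⟩
    · exact fun h => htop.infinite (finite_of_idComp_eq_bot hcl h)
    · exact fun m _ c hc => conj_mem_idComp m (fun _ _ => Subgroup.mem_top _) hc
  have hid : ∀ N : Subgroup G, IsIrreducible (N : Set G) → idComp N = N := fun N hN =>
    le_antisymm (idComp_le N) (subset_idComp hN N.one_mem subset_rfl)
  obtain ⟨M, hMc, hMi, hMs, hMk⟩ := Nat.find_spec hex
  refine ⟨M, hMc, hMi, hMs, fun N hNM hnorm hNc hNi hN => hNM.eq_of_not_lt fun hlt => ?_⟩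
  refine Nat.find_min hex (m := rk N) ?_ ⟨N, hNc, hNi, hMs.of_normalized hN hnorm, rfl⟩
  rw [← hMk]
  exact rk_lt_rk hNc hMc (by rwa [hid N hNi, hid M hMi])

theorem entries_comp_subtype {d : ℕ} (x : G →* GL (Fin d) ℂ) (M : Subgroup G) (u : M) :
    entries (x.comp M.subtype) u = entries x u := by
  ext ⟨b, i, j⟩
  cases b <;> rfl

theorem zariskiTopology_comp_subtype {d : ℕ} (x : G →* GL (Fin d) ℂ) (M : Subgroup G) :
    zariskiTopology (x.comp M.subtype) =
      TopologicalSpace.induced Subtype.val (zariskiTopology x) := by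
  have h : specPoint (x.comp M.subtype) = specPoint x ∘ Subtype.val := by
    funext u
    refine PrimeSpectrum.ext ?_
    change RingHom.ker (MvPolynomial.eval (entries (x.comp M.subtype) u)) =
      RingHom.ker (MvPolynomial.eval (entries x u))
    rw [entries_comp_subtype]
  rw [zariskiTopology, h]
  exact induced_compose.symm

/-- A linear group over a finitely generated ring which separates mixed words contains, for every
`b`, a subset of linear-size products avoiding exponentially many hypersurfaces, relative to a
subgroup which still separates mixed words. -/
theorem exists_subgroup_avoiding {d : ℕ} {x : G →* GL (Fin d) ℂ} (hx : Function.Injective x)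
    (hint : ∃ s : Finset ℂ, ∀ u i, entries x u i ∈ Algebra.adjoin ℤ (s : Set ℂ))
    (hG : SeparatesWords (Set.univ : Set G)) (b : ℕ) :
    ∃ M : Subgroup G, SeparatesWords (M : Set G) ∧ ∃ (S : Finset M) (C : ℕ), ∀ n, 1 ≤ n →
      ∀ F : Finset (MvPolynomial (EntryIndex d) ℂ), F.card ≤ b ^ n →
      (∀ P ∈ F, P.totalDegree ≤ n) →
      (∀ P ∈ F, ∃ u ∈ M, MvPolynomial.eval (entries x u) P ≠ 0) →
      ∃ l : List M, (∀ a ∈ l, a ∈ S) ∧ l.length = C * n ∧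
        ∀ P ∈ F, MvPolynomial.eval (entries x l.prod) P ≠ 0 := by
  let τ := zariskiTopology x
  have := zariskiGroup hx
  obtain ⟨M, hMc, hMi, hMs, hM⟩ := exists_minimal_separating hG
  have hent := entries_comp_subtype x M
  have hτ : zariskiTopology (x.comp M.subtype) = instTopologicalSpaceSubtype :=
    zariskiTopology_comp_subtype x M
  refine ⟨M, hMs, ?_⟩
  have h_int : ∃ s : Finset ℂ, ∀ u i,
      entries (x.comp M.subtype) u i ∈ Algebra.adjoin ℤ (s : Set ℂ) := by
    obtain ⟨s, hs⟩ := hint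
    refine ⟨s, fun u i => ?_⟩
    rw [hent]
    exact hs u i
  have h_irr : @IsIrreducible M (zariskiTopology (x.comp M.subtype)) Set.univ := by
    rw [hτ]
    have := Subtype.irreducibleSpace hMi
    exact IrreducibleSpace.isIrreducible_univ M
  have h_min : ∀ N : Subgroup M, N.Normal →
      IsClosed[zariskiTopology (x.comp M.subtype)] (N : Set M) →
      @IsIrreducible M (zariskiTopology (x.comp M.subtype)) (N : Set M) → N ≠ ⊥ → N = ⊤ := by
    rw [hτ]
    intro N hN hNc hNi hNb
    have h1 := hM (N.map M.subtype) (Subgroup.map_subtype_le N) ?_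
      (hMc.isClosedEmbedding_subtypeVal.isClosedMap _ hNc)
      (hNi.image _ continuous_subtype_val.continuousOn) ?_
    · refine Subgroup.map_injective M.subtype_injective ?_
      rw [h1, ← MonoidHom.range_eq_map, Subgroup.range_subtype]
    · rintro m hm _ ⟨c, hc, rfl⟩
      exact ⟨⟨m, hm⟩ * c * ⟨m, hm⟩⁻¹, hN.conj_mem c hc _, by simp⟩
    · rwa [Ne, Subgroup.map_eq_bot_iff_of_injective _ M.subtype_injective]
  obtain ⟨S, C, h⟩ := exists_prod_eval_entries_ne_zero
    (hx.comp M.subtype_injective : Function.Injective (x.comp M.subtype))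
    h_int h_irr h_min hMs.not_isSolvable b
  refine ⟨S, C, fun n hn F hF hdeg hF0 => ?_⟩
  simp only [hent] at h
  exact h n hn F hF hdeg fun P hP => (hF0 P hP).elim fun u hu => ⟨⟨u, hu.1⟩, hu.2⟩

end MinimalSeparating

section WordPolynomials

open MvPolynomial

variable {G : Type} [Group G] {d : ℕ}

/-- The evaluation of a letter is a matrix of affine polynomials in the entries. -/
theorem exists_matrix_eval_entries_letter (x : G →* GL (Fin d) ℂ) {X : Set G} {a : MixedWordGroup G}
    (ha : a = 1 ∨ a ∈ mixedGenSet X) :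
    ∃ A : Matrix (Fin d) (Fin d) (MvPolynomial (EntryIndex d) ℂ),
      (∀ i j, (A i j).totalDegree ≤ 1) ∧
      ∀ γ i j, eval (entries x γ) (A i j) = (x (evalWord γ a) : Matrix (Fin d) (Fin d) ℂ) i j := by
  rcases ha with rfl | ⟨g, -, rfl⟩ | rfl | rfl
  · refine ⟨fun i j => C ((1 : Matrix (Fin d) (Fin d) ℂ) i j), by simp, fun γ i j => ?_⟩
    simp
  · refine ⟨fun i j => C ((x g : Matrix (Fin d) (Fin d) ℂ) i j), by simp, fun γ i j => ?_⟩
    simp [evalWord]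
  · refine ⟨fun i j => MvPolynomial.X (true, i, j), fun i j => by simp [totalDegree_X],
      fun γ i j => ?_⟩
    simp [evalWord, xGen, entries]
  · refine ⟨fun i j => MvPolynomial.X (false, i, j), fun i j => by simp [totalDegree_X],
      fun γ i j => ?_⟩
    simp [evalWord, xGen, entries]

/-- The evaluation of a product of `n` letters is a matrix of polynomials of degree at most `n` in
the entries. -/
theorem exists_matrix_eval_entries_prod (x : G →* GL (Fin d) ℂ) {X : Set G}
    (l : List (MixedWordGroup G)) (hl : ∀ a ∈ l, a = 1 ∨ a ∈ mixedGenSet X) :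
    ∃ A : Matrix (Fin d) (Fin d) (MvPolynomial (EntryIndex d) ℂ),
      (∀ i j, (A i j).totalDegree ≤ l.length) ∧
      ∀ γ i j, eval (entries x γ) (A i j) =
        (x (evalWord γ l.prod) : Matrix (Fin d) (Fin d) ℂ) i j := by
  induction l with
  | nil =>
    refine ⟨fun i j => C ((1 : Matrix (Fin d) (Fin d) ℂ) i j), by simp, fun γ i j => ?_⟩
    simp
  | cons a l ih =>
    obtain ⟨A, hA, hA'⟩ := exists_matrix_eval_entries_letter x (hl a List.mem_cons_self)
    obtain ⟨B, hB, hB'⟩ := ih fun b hb => hl b (List.mem_cons_of_mem _ hb)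
    refine ⟨A * B, fun i j => ?_, fun γ i j => ?_⟩
    · rw [Matrix.mul_apply]
      refine totalDegree_finsetSum_le fun k _ => (totalDegree_mul _ _).trans ?_
      rw [List.length_cons, add_comm]
      exact add_le_add (hB k j) (hA i k) |>.trans' (by rw [add_comm])
    · rw [Matrix.mul_apply, map_sum, List.prod_cons, map_mul, map_mul, Units.val_mul,
        Matrix.mul_apply]
      exact Finset.sum_congr rfl fun k _ => by rw [map_mul, hA', hB']

/-- A nontrivial value of a product of letters is detected by a polynomial in the entries. -/
theorem exists_polynomial_of_evalWord_ne_one {x : G →* GL (Fin d) ℂ} (hx : Function.Injective x)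
    {X : Set G} (l : List (MixedWordGroup G)) (hl : ∀ a ∈ l, a = 1 ∨ a ∈ mixedGenSet X) {u : G}
    (hu : evalWord u l.prod ≠ 1) :
    ∃ P : MvPolynomial (EntryIndex d) ℂ, P.totalDegree ≤ l.length ∧ eval (entries x u) P ≠ 0 ∧
      ∀ γ, eval (entries x γ) P ≠ 0 → evalWord γ l.prod ≠ 1 := by
  obtain ⟨A, hA, hA'⟩ := exists_matrix_eval_entries_prod x l hl
  have h : ∃ i j, (x (evalWord u l.prod) : Matrix (Fin d) (Fin d) ℂ) i j ≠
      (1 : Matrix (Fin d) (Fin d) ℂ) i j := by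
    by_contra! h
    refine hu (hx ?_)
    rw [map_one]
    exact Units.ext (Matrix.ext h)
  obtain ⟨i, j, hij⟩ := h
  refine ⟨A i j - C ((1 : Matrix (Fin d) (Fin d) ℂ) i j),
    (totalDegree_sub_C_le _ _).trans (hA i j), ?_, fun γ hγ h => hγ ?_⟩
  · rwa [map_sub, eval_C, hA', sub_ne_zero]
  · rw [map_sub, eval_C, hA', h, map_one, Units.val_one, sub_self]

end WordPolynomials

section WordLength

variable {G : Type} [Group G]

theorem exists_list_length_eq_wordLength {S : Set G} (hS : ∀ a ∈ S, a⁻¹ ∈ S)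
    {g : G} (hg : g ∈ Subgroup.closure S) :
    ∃ l : List G, (∀ a ∈ l, a ∈ S) ∧ l.length = wordLength S g ∧ l.prod = g := by
  refine Nat.sInf_mem (s := {n | ∃ l : List G, (∀ a ∈ l, a ∈ S) ∧ l.length = n ∧ l.prod = g}) ?_
  rw [← Subgroup.mem_toSubmonoid, Subgroup.closure_toSubmonoid] at hg
  obtain ⟨l, hl, h⟩ := Submonoid.exists_list_of_mem_closure hg
  exact ⟨_, l, fun a ha => (hl a ha).elim id fun h => inv_inv a ▸ hS _ h, rfl, h⟩

theorem wordLength_prod_le {S : Set G} (l : List G) (hl : ∀ a ∈ l, a ∈ S) :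
    wordLength S l.prod ≤ l.length :=
  Nat.sInf_le ⟨l, hl, rfl, rfl⟩

theorem wordLength_mul_le {S : Set G} (hS : ∀ a ∈ S, a⁻¹ ∈ S) (hgen : Subgroup.closure S = ⊤)
    (g h : G) : wordLength S (g * h) ≤ wordLength S g + wordLength S h := by
  obtain ⟨l, hl, hl', rfl⟩ := exists_list_length_eq_wordLength hS (hgen ▸ Subgroup.mem_top g)
  obtain ⟨m, hm, hm', rfl⟩ := exists_list_length_eq_wordLength hS (hgen ▸ Subgroup.mem_top h)
  rw [← hl', ← hm', ← List.length_append, ← List.prod_append]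
  exact wordLength_prod_le _ fun a ha => (List.mem_append.1 ha).elim (hl a) (hm a)

theorem wordLength_list_prod_le {S : Set G} (hS : ∀ a ∈ S, a⁻¹ ∈ S)
    (hgen : Subgroup.closure S = ⊤) {L : ℕ} (l : List G) (hl : ∀ a ∈ l, wordLength S a ≤ L) :
    wordLength S l.prod ≤ L * l.length := by
  induction l with
  | nil => exact wordLength_prod_le [] (by simp)
  | cons a l ih =>
    rw [List.prod_cons, List.length_cons, Nat.mul_succ, add_comm]
    exact (wordLength_mul_le hS hgen _ _).trans (add_le_add (hl a List.mem_cons_self)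
      (ih fun b hb => hl b (List.mem_cons_of_mem _ hb)))

theorem inv_mem_mixedGenSet {X : Set G} (hX : ∀ a ∈ X, a⁻¹ ∈ X) :
    ∀ a ∈ mixedGenSet X, a⁻¹ ∈ mixedGenSet X := by
  rintro _ (⟨g, hg, rfl⟩ | rfl | rfl)
  · exact Or.inl ⟨g⁻¹, hX g hg, map_inv _ g⟩
  · exact Or.inr (Or.inr rfl)
  · exact Or.inr (Or.inl (inv_inv _))

theorem closure_mixedGenSet {X : Set G} (hX : Subgroup.closure X = ⊤) :
    Subgroup.closure (mixedGenSet X) = ⊤ := by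
  rw [eq_top_iff, ← Monoid.Coprod.range_inl_sup_range_inr, sup_le_iff]
  constructor
  · rw [MonoidHom.range_eq_map, ← hX, MonoidHom.map_closure]
    exact Subgroup.closure_mono Set.subset_union_left
  · rintro _ ⟨k, rfl⟩
    have h : (Monoid.Coprod.inr k : MixedWordGroup G) = xGen G ^ k.toAdd := by
      rw [xGen, ← map_zpow, ← ofAdd_zsmul, smul_eq_mul, mul_one, ofAdd_toAdd]
    have hx : xGen G ∈ mixedGenSet X := Or.inr (Or.inl rfl)
    rw [h]
    exact zpow_mem (Subgroup.subset_closure hx) _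

theorem exists_finset_entries_mem_adjoin {d : ℕ} (x : G →* GL (Fin d) ℂ) (X : Finset G)
    (hX : ∀ a ∈ X, a⁻¹ ∈ X) (hgen : Subgroup.closure (X : Set G) = ⊤) :
    ∃ s : Finset ℂ, ∀ u i, entries x u i ∈ Algebra.adjoin ℤ (s : Set ℂ) := by
  classical
  let s : Finset ℂ := (X ×ˢ (Finset.univ : Finset (Fin d × Fin d))).image
    fun p => (x p.1 : Matrix (Fin d) (Fin d) ℂ) p.2.1 p.2.2
  have key : ∀ (g : G) (i j : Fin d),
      (x g : Matrix (Fin d) (Fin d) ℂ) i j ∈ Algebra.adjoin ℤ (s : Set ℂ) := by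
    intro g
    obtain ⟨l, hl, -, rfl⟩ := exists_list_length_eq_wordLength (S := (X : Set G)) hX
      (hgen ▸ Subgroup.mem_top g)
    induction l with
    | nil =>
      intro i j
      rw [List.prod_nil, map_one, Units.val_one, Matrix.one_apply]
      split_ifs
      · exact one_mem _
      · exact zero_mem _
    | cons a l ih =>
      intro i j
      rw [List.prod_cons, map_mul, Units.val_mul, Matrix.mul_apply]
      refine sum_mem fun k _ => mul_mem (Algebra.subset_adjoin ?_)
        (ih (fun b hb => hl b (List.mem_cons_of_mem _ hb)) k j)
      exact Finset.mem_coe.2 (Finset.mem_image.2 ⟨(a, i, k), by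
        simpa using hl a List.mem_cons_self, rfl⟩)
  exact ⟨s, fun u i => key _ _ _⟩

end WordLength

section Detection

open MvPolynomial

variable {G : Type} [Group G] {d : ℕ}

/-- Finitely many polynomials detect the nontriviality of all words of length at most `n`. -/
theorem exists_finset_detecting {x : G →* GL (Fin d) ℂ} (hx : Function.Injective x)
    {X : Finset G} (hX : ∀ a ∈ X, a⁻¹ ∈ X) (hgen : Subgroup.closure (X : Set G) = ⊤) :
    ∃ b : ℕ, ∀ A : Set G, SeparatesWords A → ∀ n,
      ∃ F : Finset (MvPolynomial (EntryIndex d) ℂ), F.card ≤ b ^ n ∧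
        (∀ P ∈ F, P.totalDegree ≤ n) ∧ (∀ P ∈ F, ∃ u ∈ A, eval (entries x u) P ≠ 0) ∧
        ∀ γ, (∀ P ∈ F, eval (entries x γ) P ≠ 0) → ∀ w : MixedWordGroup G, w ≠ 1 →
          wordLength (mixedGenSet (X : Set G)) w ≤ n → evalWord γ w ≠ 1 := by
  classical
  let T : Finset (MixedWordGroup G) :=
    insert 1 (X.image (Monoid.Coprod.inl : G →* MixedWordGroup G) ∪ {xGen G, (xGen G)⁻¹})
  have hT : ∀ a, a ∈ T ↔ a = 1 ∨ a ∈ mixedGenSet (X : Set G) := by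
    intro a
    simp [T, mixedGenSet]
  refine ⟨T.card, fun A hA n => ?_⟩
  let word : (Fin n → T) → List (MixedWordGroup G) := fun f => List.ofFn fun k => (f k : _)
  have hword : ∀ f, ∀ a ∈ word f, a = 1 ∨ a ∈ mixedGenSet (X : Set G) := by
    intro f a ha
    obtain ⟨k, rfl⟩ := (List.mem_ofFn' _ _).1 ha
    exact (hT _).1 (f k).2
  have hP : ∀ f, ∃ P : MvPolynomial (EntryIndex d) ℂ, (word f).prod ≠ 1 →
      P.totalDegree ≤ n ∧ (∃ u ∈ A, eval (entries x u) P ≠ 0) ∧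
      ∀ γ, eval (entries x γ) P ≠ 0 → evalWord γ (word f).prod ≠ 1 := by
    intro f
    by_cases hf : (word f).prod = 1
    · exact ⟨0, fun h => absurd hf h⟩
    · obtain ⟨u, hu, hu'⟩ := hA _ hf
      obtain ⟨P, h1, h2, h3⟩ := exists_polynomial_of_evalWord_ne_one hx (word f) (hword f) hu'
      exact ⟨P, fun _ => ⟨by simpa [word] using h1, ⟨u, hu, h2⟩, h3⟩⟩
  choose P hP using hP
  refine ⟨(Finset.univ.filter fun f => (word f).prod ≠ 1).image P, ?_, ?_, ?_, ?_⟩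
  · refine Finset.card_image_le.trans ((Finset.card_filter_le _ _).trans ?_)
    simp
  · intro Q hQ
    obtain ⟨f, hf, rfl⟩ := Finset.mem_image.1 hQ
    exact (hP f (Finset.mem_filter.1 hf).2).1
  · intro Q hQ
    obtain ⟨f, hf, rfl⟩ := Finset.mem_image.1 hQ
    exact (hP f (Finset.mem_filter.1 hf).2).2.1
  · intro γ hγ w hw hwn
    obtain ⟨l, hl, hlen, rfl⟩ := exists_list_length_eq_wordLength
      (inv_mem_mixedGenSet (X := (X : Set G)) hX)
      (closure_mixedGenSet hgen ▸ Subgroup.mem_top w)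
    rw [← hlen] at hwn
    let l' := l ++ List.replicate (n - l.length) 1
    have hl' : ∀ a ∈ l', a ∈ T := by
      intro a ha
      rcases List.mem_append.1 ha with h | h
      · exact (hT a).2 (Or.inr (hl a h))
      · exact (hT a).2 (Or.inl (List.eq_of_mem_replicate h))
    have hlen' : l'.length = n := by
      simp only [l', List.length_append, List.length_replicate]
      omega
    have hprod : l'.prod = l.prod := by simp [l']
    let f : Fin n → T := fun k => ⟨l'.get (k.cast hlen'.symm), hl' _ (List.get_mem _ _)⟩
    have hf : word f = l' := by
      refine List.ext_get (by simp [word, hlen']) fun k h1 h2 => ?_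
      simp [word, f]
    have hf1 : (word f).prod ≠ 1 := by rwa [hf, hprod]
    have := (hP f hf1).2.2 γ (hγ _ (Finset.mem_image.2
      ⟨f, Finset.mem_filter.2 ⟨Finset.mem_univ _, hf1⟩, rfl⟩))
    rwa [hf, hprod] at this

end Detection

theorem stmt1 (d : ℕ) (hd : 1 ≤ d) (Γ : Subgroup (GL (Fin d) ℂ))
    (X : Finset Γ) (hXsymm : ∀ a ∈ X, a⁻¹ ∈ X)
    (hXgen : Subgroup.closure (X : Set Γ) = ⊤)
    (hMIF : ∀ w : MixedWordGroup Γ, w ≠ 1 → ∃ γ : Γ, evalWord γ w ≠ 1) :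
    ∃ C : ℝ, 0 < C ∧
      ∀ n : ℕ, 0 < n →
        ∃ γ : Γ, (wordLength (X : Set Γ) γ : ℝ) ≤ C * n ∧
          ∀ w : MixedWordGroup Γ, w ≠ 1 →
            wordLength (mixedGenSet (X : Set Γ)) w ≤ n →
            evalWord γ w ≠ 1 := by
  have hx : Function.Injective Γ.subtype := Γ.subtype_injective
  obtain ⟨b, hb⟩ := exists_finset_detecting hx hXsymm hXgen
  have hsep : SeparatesWords (Set.univ : Set Γ) := fun w hw =>
    (hMIF w hw).imp fun γ hγ => ⟨Set.mem_univ γ, hγ⟩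
  obtain ⟨M, hM, S, C, hS⟩ := exists_subgroup_avoiding hx
    (exists_finset_entries_mem_adjoin Γ.subtype X hXsymm hXgen) hsep b
  let L := S.sup fun s => wordLength (X : Set Γ) (s : Γ)
  refine ⟨L * C + 1, by positivity, fun n hn => ?_⟩
  obtain ⟨F, hFcard, hFdeg, hF0, hF⟩ := hb M hM n
  obtain ⟨l, hl, hlen, hlF⟩ := hS n hn F hFcard hFdeg hF0
  refine ⟨l.prod, ?_, hF _ hlF⟩
  have h := wordLength_list_prod_le (S := (X : Set Γ)) hXsymm hXgen (L := L)
    (l.map M.subtype) (by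
      intro a ha
      obtain ⟨s, hs, rfl⟩ := List.mem_map.1 ha
      exact Finset.le_sup (f := fun s : M => wordLength (X : Set Γ) (s : Γ)) (hl s hs))
  rw [← map_list_prod, List.length_map, hlen] at h
  have h' := (Nat.cast_le (α := ℝ)).2 h
  push_cast [-Subgroup.val_list_prod] at h'
  have : (0 : ℝ) ≤ n := Nat.cast_nonneg n
  change (wordLength (X : Set Γ) (M.subtype l.prod) : ℝ) ≤ _
  linarith
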